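/- arXiv:0912.1749 — 2 statements merged into one kernel-verified Lean document; each statement's English description precedes it below -/
import Mathlib

section
/- Let q ≥ 3 be an integer, λ = 2·cos(π/q), and α ∈ [1/2, 1/λ]. For every G_q-irrational x ∈ [(α−1)λ, αλ) there are infinitely many n ∈ ℕ with q_n²·|x − p_n/q_n| ≤ ℋ_q, where p_n/q_n are the α-Rosen convergents of x. Moreover ℋ_q is best possible: for every c < ℋ_q there exists a G_q-irrational x ∈ [(α−1)λ, αλ) such that q_n²·|x − p_n/q_n| ≤ c holds for only finitely many n. -/
/-- The digit `d(x) = ⌊|1/(λx)| + 1 - α⌋` of the α-Rosen continued fraction. -/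
noncomputable def rosenD (lam α x : ℝ) : ℤ := ⌊|1 / (lam * x)| + 1 - α⌋

/-- The α-Rosen continued fraction map `T_α` on `[(α-1)λ, αλ)`. -/
noncomputable def rosenT (lam α x : ℝ) : ℝ :=
  if x = 0 then 0 else Real.sign x / x - lam * (rosenD lam α x : ℝ)

/-- `x` is `G_q`-irrational: the orbit of `x` under `T_α` never hits `0`. -/
def GIrrational (lam α x : ℝ) : Prop := ∀ n : ℕ, (rosenT lam α)^[n] x ≠ 0

/-- The recursion `u_n = d_n(x)·λ·u_{n-1} + ε_n(x)·u_{n-2}` for the numerators and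
denominators of the α-Rosen convergents, with the index shifted by one:
`rosenPQ lam α x a b n = u_{n-1}` where `u_{-1} = a`, `u_0 = b`. -/
noncomputable def rosenPQ (lam α x a b : ℝ) : ℕ → ℝ
  | 0 => a
  | 1 => b
  | n + 2 =>
      (rosenD lam α ((rosenT lam α)^[n] x) : ℝ) * lam * rosenPQ lam α x a b (n + 1)
        + Real.sign ((rosenT lam α)^[n] x) * rosenPQ lam α x a b n

/-- The approximation coefficient `Θ_n(x) = q_n² · |x - p_n/q_n|` of the α-Rosen
expansion of `x` (with `p_{-1}=1, q_{-1}=0, p_0=0, q_0=1`). -/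
noncomputable def rosenTheta (lam α x : ℝ) (n : ℕ) : ℝ :=
  (rosenPQ lam α x 0 1 (n + 1)) ^ 2 *
    |x - rosenPQ lam α x 1 0 (n + 1) / rosenPQ lam α x 0 1 (n + 1)|

/-- The natural extension map `𝒯_α(t,v) = (T_α(t), 1/(d(t)λ + ε(t)v))`. -/
noncomputable def rosenNE (lam α : ℝ) (tv : ℝ × ℝ) : ℝ × ℝ :=
  (rosenT lam α tv.1, 1 / ((rosenD lam α tv.1 : ℝ) * lam + Real.sign tv.1 * tv.2))


/-- The numbers `S j = sin (j δ) / sin δ`. -/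
noncomputable def rosS (δ : ℝ) (j : ℕ) : ℝ := Real.sin (j * δ) / Real.sin δ

/-- Basic facts about the sequence `S j` used throughout. -/
structure SFacts (q : ℕ) (lam : ℝ) (s : ℕ → ℝ) : Prop where
  zero : s 0 = 0
  one : s 1 = 1
  rec' : ∀ j, s (j + 2) = lam * s (j + 1) - s j
  nonneg : ∀ j, j ≤ q → 0 ≤ s j
  one_le : ∀ j, 1 ≤ j → j < q → 1 ≤ s j
  cross : ∀ i k, s (i + 1) * s (i + k) - s i * s (i + k + 1) = s k
  symm : ∀ i j, i + j = q → s i = s j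

lemma sfacts (q : ℕ) (hq : 3 ≤ q) (lam : ℝ) (hlam : lam = 2 * Real.cos (Real.pi / (q : ℝ))) :
    SFacts q lam (rosS (Real.pi / q)) := by
  have hq0 : (0 : ℝ) < q := by positivity
  have hq3 : (3 : ℝ) ≤ q := by exact_mod_cast hq
  set δ := Real.pi / (q : ℝ) with hδ
  have hpi := Real.pi_pos
  have hδ0 : 0 < δ := by positivity
  have hqδ : q * δ = Real.pi := by rw [hδ]; field_simp
  have hδ3 : 3 * δ ≤ Real.pi := by nlinarith
  have hsin : 0 < Real.sin δ := Real.sin_pos_of_pos_of_lt_pi hδ0 (by linarith)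
  refine ⟨by simp [rosS], by simp [rosS, hsin.ne'], ?_, ?_, ?_, ?_, ?_⟩
  · intro j
    have e1 : ((j : ℝ) + 2) * δ = (j + 1) * δ + δ := by ring
    have e2 : (j : ℝ) * δ = (j + 1) * δ - δ := by ring
    have key : Real.sin (((j : ℝ) + 2) * δ)
        = 2 * Real.cos δ * Real.sin (((j : ℝ) + 1) * δ) - Real.sin ((j : ℝ) * δ) := by
      rw [e1, e2, Real.sin_add, Real.sin_sub]
      ring
    simp only [rosS]
    rw [hlam]
    push_cast
    rw [key]
    ring
  · intro j hj
    have : (j : ℝ) ≤ q := by exact_mod_cast hj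
    apply div_nonneg _ hsin.le
    apply Real.sin_nonneg_of_nonneg_of_le_pi (by positivity)
    nlinarith
  · intro j h1 h2
    have h1' : (1 : ℝ) ≤ j := by exact_mod_cast h1
    have h2' : (j : ℝ) + 1 ≤ q := by exact_mod_cast h2
    simp only [rosS]
    rw [le_div_iff₀ hsin, one_mul]
    have e : Real.sin (j * δ) - Real.sin δ
        = 2 * Real.sin ((j * δ - δ) / 2) * Real.cos ((j * δ + δ) / 2) := Real.sin_sub_sin _ _
    have p1 : 0 ≤ Real.sin ((j * δ - δ) / 2) := by
      apply Real.sin_nonneg_of_nonneg_of_le_pi <;> nlinarith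
    have p2 : 0 ≤ Real.cos ((j * δ + δ) / 2) := by
      apply Real.cos_nonneg_of_neg_pi_div_two_le_of_le <;> nlinarith
    nlinarith [mul_nonneg p1 p2]
  · intro i k
    have e1 : ((i : ℝ) + 1) * δ = i * δ + δ := by ring
    have e2 : ((i : ℝ) + k) * δ = i * δ + k * δ := by ring
    have e3 : ((i : ℝ) + k + 1) * δ = (i * δ + k * δ) + δ := by ring
    have key : Real.sin (((i : ℝ) + 1) * δ) * Real.sin (((i : ℝ) + k) * δ)
        - Real.sin ((i : ℝ) * δ) * Real.sin (((i : ℝ) + k + 1) * δ)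
        = Real.sin δ * Real.sin (k * δ) := by
      rw [e1, e2, e3]
      simp only [Real.sin_add, Real.cos_add]
      have := Real.sin_sq_add_cos_sq (i * δ)
      linear_combination Real.sin δ * Real.sin (k * δ) * this
    simp only [rosS]
    push_cast
    rw [div_mul_div_comm, div_mul_div_comm, ← sub_div, key,
      mul_div_mul_left _ _ hsin.ne']
  · intro i j hij
    simp only [rosS]
    congr 1
    have : (i : ℝ) = q - j := by
      rw [← hij]; push_cast; ring
    rw [this, sub_mul, hqδ, Real.sin_pi_sub]

lemma SFacts.even_mid {m : ℕ} {lam : ℝ} {s : ℕ → ℝ} (hm : 2 ≤ m) (h : SFacts (2 * m) lam s) :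
    s (m + 1) = s (m - 1) ∧ s (m - 1) = lam / 2 * s m := by
  obtain ⟨k, rfl⟩ : ∃ k, m = k + 1 := ⟨m - 1, by omega⟩
  have h1 : s (k + 1 + 1) = s k := h.symm _ _ (by omega)
  have h2 := h.rec' k
  simp only [Nat.add_sub_cancel]
  refine ⟨h1, ?_⟩
  have h3 : s (k + 2) = s k := h1
  linarith

lemma SFacts.odd_mid {m : ℕ} {lam : ℝ} {s : ℕ → ℝ} (hm : 1 ≤ m) (h : SFacts (2 * m + 1) lam s) :
    s (m + 1) = s m ∧ s (m - 1) = (lam - 1) * s m ∧ s (m + 2) = (lam - 1) * s m := by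
  obtain ⟨k, rfl⟩ : ∃ k, m = k + 1 := ⟨m - 1, by omega⟩
  have h1 : s (k + 1 + 1) = s (k + 1) := h.symm _ _ (by omega)
  have h1' : s (k + 2) = s (k + 1) := h1
  have h2 := h.rec' k
  have h3 := h.rec' (k + 1)
  simp only [Nat.add_sub_cancel]
  refine ⟨h1, by linarith, ?_⟩
  have h4 : s (k + 1 + 1) = s (k + 1) := h1
  rw [h3, h4]; ring

/-- the quadratic relation -/
lemma SFacts.quad {q : ℕ} {lam : ℝ} {s : ℕ → ℝ} (h : SFacts q lam s) (k : ℕ) :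
    s (k + 1) ^ 2 - lam * s (k + 1) * s k + s k ^ 2 = 1 := by
  have h1 := h.cross k 1
  have h2 := h.rec' k
  rw [h.one] at h1
  have e : s (k + 1 + 1) = s (k + 2) := rfl
  rw [e, h2] at h1
  linarith


/-- Nonnegative vectors of the Hecke–Farey tree. -/
inductive RW (q : ℕ) (s : ℕ → ℝ) : ℝ → ℝ → Prop
  | e1 : RW q s 1 0
  | e2 : RW q s 0 1
  | step (i : ℕ) (hi : i + 1 < q) (x y : ℝ) (h : RW q s x y) :
      RW q s (s (i + 1) * x + s (i + 2) * y) (s i * x + s (i + 1) * y)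

/-- The orbit of the cusp vectors. -/
def RV (q : ℕ) (s : ℕ → ℝ) (x y : ℝ) : Prop := RW q s |x| |y|

section
variable {q : ℕ} {lam : ℝ} {s : ℕ → ℝ}

lemma RW.nonneg (hs : SFacts q lam s) {x y : ℝ} (h : RW q s x y) :
    0 ≤ x ∧ 0 ≤ y ∧ 1 ≤ x ^ 2 + y ^ 2 := by
  induction h with
  | e1 => norm_num
  | e2 => norm_num
  | step i hi x y h ih =>
    obtain ⟨h1, h2, h3⟩ := ih
    have a1 := hs.one_le (i + 1) (by omega) hi
    have a0 := hs.nonneg i (by omega)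
    have a2 := hs.nonneg (i + 2) (by omega)
    have b1 : x ≤ s (i + 1) * x + s (i + 2) * y := by nlinarith [mul_nonneg a2 h2]
    have b2 : y ≤ s i * x + s (i + 1) * y := by nlinarith [mul_nonneg a0 h1]
    refine ⟨by linarith, by linarith, ?_⟩
    nlinarith

lemma RW.swap (hs : SFacts q lam s) {x y : ℝ} (h : RW q s x y) : RW q s y x := by
  induction h with
  | e1 => exact RW.e2
  | e2 => exact RW.e1
  | step i hi x y h ih =>
    obtain ⟨j, hj⟩ : ∃ j, i + j + 2 = q := ⟨q - 2 - i, by omega⟩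
    have := RW.step (q := q) (s := s) j (by omega) y x ih
    rw [hs.symm (j + 1) (i + 1) (by omega), hs.symm (j + 2) i (by omega),
      hs.symm j (i + 2) (by omega)] at this
    rw [add_comm (s i * x), add_comm (s (i + 1) * x)]
    exact this

lemma RW.shift (hs : SFacts q lam s) (hq : 3 ≤ q) (hl : 1 ≤ lam) {x y : ℝ} (h : RW q s x y) :
    RW q s |x - lam * y| y := by
  have s2 : s 2 = lam := by
    have := hs.rec' 0
    rw [hs.zero, hs.one] at this; simpa using this
  cases h with
  | e1 => simpa using RW.e1
  | e2 =>
    have := RW.step (q := q) (s := s) 0 (by omega) 0 1 RW.e2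
    simp [hs.one, hs.zero, s2] at this
    simpa [abs_of_nonneg (by linarith : 0 ≤ lam)] using this
  | step i hi x y h =>
    rcases i with _ | i
    · simp only [Nat.zero_add, hs.one, hs.zero, s2]
      have := h.nonneg hs
      have e : 1 * x + lam * y - lam * (0 * x + 1 * y) = x := by ring
      rw [e, abs_of_nonneg this.1]
      simpa using h
    · have h1 := (RW.step (q := q) (s := s) i (by omega) x y h).swap hs
      have h2 := h1.nonneg hs
      have r1 := hs.rec' i
      have r2 := hs.rec' (i + 1)
      have e : s (i + 1 + 1) * x + s (i + 1 + 2) * y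
          - lam * (s (i + 1) * x + s (i + 1 + 1) * y) = -(s i * x + s (i + 1) * y) := by
        rw [r2]
        have : s (i + 1 + 1) = s (i + 2) := rfl
        rw [this, r1]; ring
      rw [e, abs_neg, abs_of_nonneg h2.1]
      exact h1

lemma RV.neg_left {x y : ℝ} (h : RV q s x y) : RV q s (-x) y := by
  unfold RV at *; rwa [abs_neg]

lemma RV.neg_right {x y : ℝ} (h : RV q s x y) : RV q s x (-y) := by
  unfold RV at *; rwa [abs_neg]

lemma RV.swap (hs : SFacts q lam s) {x y : ℝ} (h : RV q s x y) : RV q s y x := RW.swap hs h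

lemma RV.shift (hs : SFacts q lam s) (hq : 3 ≤ q) (hl : 1 ≤ lam) {x y : ℝ} (h : RV q s x y) :
    RV q s (x + lam * y) y := by
  have s2 : s 2 = lam := by
    have := hs.rec' 0
    rw [hs.zero, hs.one] at this; simpa using this
  unfold RV at *
  rcases le_total 0 (x * y) with hxy | hxy
  · have h1 := RW.step (q := q) (s := s) 0 (by omega) _ _ h
    simp only [Nat.zero_add, hs.one, hs.zero, s2] at h1
    have e : |x + lam * y| = 1 * |x| + lam * |y| := by
      have : lam * |y| = |lam * y| := by rw [abs_mul, abs_of_nonneg (by linarith : 0 ≤ lam)]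
      rw [this, one_mul, abs_add_eq_add_abs_iff]
      rcases le_total 0 x with hx | hx <;> rcases le_total 0 y with hy | hy
      · left; exact ⟨hx, by positivity⟩
      · rcases eq_or_lt_of_le hx with rfl | hx
        · right; exact ⟨le_rfl, by nlinarith⟩
        · left; exact ⟨hx.le, by nlinarith⟩
      · rcases eq_or_lt_of_le hx with rfl | hx
        · left; exact ⟨le_rfl, by nlinarith⟩
        · right; exact ⟨hx.le, by nlinarith⟩
      · right; exact ⟨hx, by nlinarith⟩
    rw [e]
    simpa using h1
  · have h1 := RW.shift hs hq hl h
    have e : |x + lam * y| = abs (|x| - lam * |y|) := by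
      rcases le_total 0 x with hx | hx <;> rcases le_total 0 y with hy | hy
      · have : x * y = 0 := le_antisymm hxy (mul_nonneg hx hy)
        rcases mul_eq_zero.1 this with rfl | rfl <;> simp
      · rw [abs_of_nonneg hx, abs_of_nonpos hy]; congr 1; ring
      · rw [abs_of_nonpos hx, abs_of_nonneg hy, ← abs_neg]; congr 1; ring
      · have : x * y = 0 := le_antisymm hxy (mul_nonneg_of_nonpos_of_nonpos hx hy)
        rcases mul_eq_zero.1 this with rfl | rfl <;> simp
    rw [e]; exact h1

lemma RV.shiftNat (hs : SFacts q lam s) (hq : 3 ≤ q) (hl : 1 ≤ lam) {x y : ℝ} (h : RV q s x y)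
    (n : ℕ) : RV q s (x + n * lam * y) y := by
  induction n with
  | zero => simpa using h
  | succ n ih =>
    have := RV.shift hs hq hl ih
    convert this using 1
    push_cast; ring

lemma RV.shiftInt (hs : SFacts q lam s) (hq : 3 ≤ q) (hl : 1 ≤ lam) {x y : ℝ} (h : RV q s x y)
    (n : ℤ) : RV q s (x + n * lam * y) y := by
  obtain ⟨n, rfl | rfl⟩ := n.eq_nat_or_neg
  · simpa using RV.shiftNat hs hq hl h n
  · have := (RV.shiftNat hs hq hl h.neg_left n).neg_left
    convert this using 1
    push_cast; ring

end

lemma form_even {m : ℕ} {lam : ℝ} {s : ℕ → ℝ} (hm : 2 ≤ m) (hs : SFacts (2 * m) lam s)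
    {x y : ℝ} (h : RW (2 * m) s x y) : 1 ≤ |x ^ 2 - y ^ 2| := by
  obtain ⟨e1, e2⟩ := hs.even_mid hm
  -- for `i + 1 < m` the value is at least one
  have key : ∀ i, i + 1 < m → ∀ x y : ℝ, RW (2 * m) s x y →
      1 ≤ (s (i + 1) * x + s (i + 2) * y) ^ 2 - (s i * x + s (i + 1) * y) ^ 2 := by
    intro i hi x y h
    obtain ⟨hx, hy, hxy⟩ := h.nonneg hs
    have q1 := hs.quad i
    have q2 := hs.quad (i + 1)
    have p0 := hs.nonneg i (by omega)
    have p1 := hs.nonneg (i + 1) (by omega)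
    have p2 := hs.nonneg (i + 2) (by omega)
    have pm := hs.one_le m (by omega) (by omega)
    have mono : ∀ j, j < m → s j ≤ lam / 2 * s (j + 1) := by
      intro j hj
      obtain ⟨k, hk⟩ : ∃ k, j + k + 1 = m := ⟨m - 1 - j, by omega⟩
      have c := hs.cross j k
      have n := hs.nonneg k (by omega)
      have : m - 1 = j + k := by omega
      rw [this] at e2
      rw [hk, e2] at c
      by_contra hc
      push Not at hc
      nlinarith
    have m0 := mono i (by omega)
    have m1 := mono (i + 1) (by omega)
    have m1' : s (i + 1) ≤ lam / 2 * s (i + 2) := m1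
    have q2' : s (i + 2) ^ 2 - lam * s (i + 2) * s (i + 1) + s (i + 1) ^ 2 = 1 := q2
    have r := hs.rec' i
    have a1 : 1 ≤ s (i + 1) ^ 2 - s i ^ 2 := by nlinarith
    have a2 : 1 ≤ s (i + 2) ^ 2 - s (i + 1) ^ 2 := by nlinarith
    have a3 : 0 ≤ s (i + 1) * (s (i + 2) - s i) := mul_nonneg p1 (by linarith)
    nlinarith [mul_nonneg a3 (mul_nonneg hx hy), sq_nonneg x, sq_nonneg y]
  induction h with
  | e1 => norm_num
  | e2 => norm_num
  | step i hi x y h ih =>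
    rcases lt_trichotomy (i + 1) m with hlt | heq | hgt
    · exact le_trans (key i hlt x y h) (le_abs_self _)
    · have e3 : s (i + 2) = s i := by
        have : m - 1 = i := by omega
        rw [← this, ← e1]; congr 1; omega
      have q1 := hs.quad i
      have r := hs.rec' i
      have : (s (i + 1) * x + s (i + 2) * y) ^ 2 - (s i * x + s (i + 1) * y) ^ 2
          = x ^ 2 - y ^ 2 := by
        have q3 : s (i + 1) ^ 2 - s i ^ 2 = 1 := by
          rw [e3] at r
          linear_combination q1 - s i * r
        rw [e3]
        linear_combination (x ^ 2 - y ^ 2) * q3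
      rw [this]; exact ih
    · obtain ⟨j, hj⟩ : ∃ j, i + j + 2 = 2 * m := ⟨2 * m - 2 - i, by omega⟩
      have := key j (by omega) y x (h.swap hs)
      rw [hs.symm (j + 1) (i + 1) (by omega), hs.symm (j + 2) i (by omega),
        hs.symm j (i + 2) (by omega)] at this
      rw [abs_sub_comm]
      refine le_trans ?_ (le_abs_self _)
      linarith

lemma form_odd {m : ℕ} {lam : ℝ} {s : ℕ → ℝ} (hm : 1 ≤ m) (hs : SFacts (2 * m + 1) lam s)
    (hl : 1 ≤ lam) (hl2 : lam < 2)
    {x y : ℝ} (h : RW (2 * m + 1) s x y) :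
    1 ≤ |x ^ 2 - (2 - lam) * x * y - y ^ 2| ∧ 1 ≤ |x ^ 2 + (2 - lam) * x * y - y ^ 2| := by
  obtain ⟨e1, e2, -⟩ := hs.odd_mid hm
  have pm := hs.one_le m (by omega) (by omega)
  have qm : (2 - lam) * s m ^ 2 = 1 := by
    have := hs.quad m
    rw [e1] at this; linarith
  have mono : ∀ j, j < m → s j ≤ (lam - 1) * s (j + 1) := by
    intro j hj
    obtain ⟨k, hk⟩ : ∃ k, j + k + 1 = m := ⟨m - 1 - j, by omega⟩
    have c := hs.cross j k
    have n := hs.nonneg k (by omega)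
    have : m - 1 = j + k := by omega
    rw [this] at e2
    rw [hk, e2] at c
    by_contra hc
    push Not at hc
    nlinarith
  -- form `f` for small index
  have key1 : ∀ i, i + 1 < m → ∀ x y : ℝ, RW (2 * m + 1) s x y →
      1 ≤ (s (i + 1) * x + s (i + 2) * y) ^ 2
        - (2 - lam) * (s (i + 1) * x + s (i + 2) * y) * (s i * x + s (i + 1) * y)
        - (s i * x + s (i + 1) * y) ^ 2 := by
    intro i hi x y h
    obtain ⟨hx, hy, hxy⟩ := h.nonneg hs
    have q1 := hs.quad i
    have q2' : s (i + 2) ^ 2 - lam * s (i + 2) * s (i + 1) + s (i + 1) ^ 2 = 1 := hs.quad (i + 1)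
    have p0 := hs.nonneg i (by omega)
    have p1 := hs.nonneg (i + 1) (by omega)
    have p2 := hs.nonneg (i + 2) (by omega)
    have m0 := mono i (by omega)
    have m1' : s (i + 1) ≤ (lam - 1) * s (i + 2) := mono (i + 1) (by omega)
    have r := hs.rec' i
    have a1 : 1 ≤ s (i + 1) ^ 2 - (2 - lam) * s (i + 1) * s i - s i ^ 2 := by nlinarith
    have a2 : 1 ≤ s (i + 2) ^ 2 - (2 - lam) * s (i + 2) * s (i + 1) - s (i + 1) ^ 2 := by
      nlinarith
    have a3 : 0 ≤ 2 * s (i + 1) * s (i + 2)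
        - (2 - lam) * (s (i + 1) ^ 2 + s i * s (i + 2)) - 2 * s i * s (i + 1) := by
      rw [r]
      have g : s i ≤ s (i + 1) := by nlinarith
      have : 2 * s (i + 1) * (lam * s (i + 1) - s i)
          - (2 - lam) * (s (i + 1) ^ 2 + s i * (lam * s (i + 1) - s i)) - 2 * s i * s (i + 1)
          = ((lam - 1) * s (i + 1) - s i) * (2 * s (i + 1) + (2 - lam) * lam * s (i + 1)
            + 2 * s (i + 1) - (2 - lam) * (s i + (lam - 1) * s (i + 1)))
            + (2 - lam) ^ 2 * s (i + 1) ^ 2 := by ring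
      rw [this]
      have t1 : 0 ≤ (lam - 1) * s (i + 1) - s i := by linarith
      have t2 : 0 ≤ 2 * s (i + 1) + (2 - lam) * lam * s (i + 1)
            + 2 * s (i + 1) - (2 - lam) * (s i + (lam - 1) * s (i + 1)) := by
        nlinarith [mul_nonneg (sub_nonneg.2 hl2.le) p1, mul_nonneg (sub_nonneg.2 hl2.le) p0,
          mul_nonneg (sub_nonneg.2 hl2.le) (sub_nonneg.2 g)]
      have := mul_nonneg t1 t2
      positivity
    nlinarith [mul_nonneg a3 (mul_nonneg hx hy), sq_nonneg x, sq_nonneg y]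
  have key2 : ∀ i, i + 1 ≤ m → ∀ x y : ℝ, RW (2 * m + 1) s x y →
      1 ≤ (s (i + 1) * x + s (i + 2) * y) ^ 2
        + (2 - lam) * (s (i + 1) * x + s (i + 2) * y) * (s i * x + s (i + 1) * y)
        - (s i * x + s (i + 1) * y) ^ 2 := by
    intro i hi x y h
    obtain ⟨hx, hy, hxy⟩ := h.nonneg hs
    have q1 := hs.quad i
    have q2' : s (i + 2) ^ 2 - lam * s (i + 2) * s (i + 1) + s (i + 1) ^ 2 = 1 := hs.quad (i + 1)
    have p0 := hs.nonneg i (by omega)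
    have p1 := hs.nonneg (i + 1) (by omega)
    have p2 := hs.nonneg (i + 2) (by omega)
    have m0 := mono i (by omega)
    have r := hs.rec' i
    have l2 : 0 ≤ 2 - lam := by linarith
    have n1 := mul_nonneg l2 (mul_nonneg p1 p0)
    have n2 := mul_nonneg l2 (mul_nonneg p1 p2)
    have n3 := mul_nonneg l2 (mul_nonneg p0 p2)
    have a1 : 1 ≤ s (i + 1) ^ 2 + (2 - lam) * s (i + 1) * s i - s i ^ 2 := by nlinarith
    have a2 : 1 ≤ s (i + 2) ^ 2 + (2 - lam) * s (i + 2) * s (i + 1) - s (i + 1) ^ 2 := by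
      rcases hi.lt_or_eq with hlt | heq
      · have m1' : s (i + 1) ≤ (lam - 1) * s (i + 2) := mono (i + 1) (by omega)
        nlinarith
      · have e3 : s (i + 2) = s (i + 1) := by
          rw [heq, ← e1, ← heq]
        rw [e3, heq]; linarith
    have a3 : 0 ≤ 2 * s (i + 1) * s (i + 2)
        + (2 - lam) * (s (i + 1) ^ 2 + s i * s (i + 2)) - 2 * s i * s (i + 1) := by
      have : s i ≤ s (i + 2) := by rw [r]; nlinarith
      have := mul_nonneg p1 (sub_nonneg.2 this)
      have := mul_nonneg l2 (sq_nonneg (s (i + 1)))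
      nlinarith
    nlinarith [mul_nonneg a3 (mul_nonneg hx hy), sq_nonneg x, sq_nonneg y]
  have key0 : ∀ i, i + 1 = m → ∀ x y : ℝ, 
      (s (i + 1) * x + s (i + 2) * y) ^ 2
        - (2 - lam) * (s (i + 1) * x + s (i + 2) * y) * (s i * x + s (i + 1) * y)
        - (s i * x + s (i + 1) * y) ^ 2 = x ^ 2 + (2 - lam) * x * y - y ^ 2 := by
    intro i hi x y
    have e3 : s (i + 2) = s m := by rw [← e1, ← hi]
    have e4 : s i = (lam - 1) * s m := by rw [← e2]; congr 1; omega
    rw [e3, e4, hi]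
    linear_combination (x ^ 2 + (2 - lam) * x * y - y ^ 2) * qm
  induction h with
  | e1 => norm_num
  | e2 => norm_num
  | step i hi x y h ih =>
    obtain ⟨ih1, ih2⟩ := ih
    obtain ⟨j, hj⟩ : ∃ j, i + j + 2 = 2 * m + 1 := ⟨2 * m + 1 - 2 - i, by omega⟩
    have f1 := hs.symm (j + 1) (i + 1) (by omega)
    have f2 := hs.symm (j + 2) i (by omega)
    have f3 := hs.symm j (i + 2) (by omega)
    have k1 := key1 j
    have k2 := key2 j
    have k0 := key0 j
    rw [f1, f2, f3] at k1 k2 k0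
    constructor
    · rcases lt_trichotomy (i + 1) m with hlt | heq | hgt
      · exact le_trans (key1 i hlt x y h) (le_abs_self _)
      · rw [key0 i heq x y]; exact ih2
      · have := k2 (by omega) y x (h.swap hs)
        rw [← abs_neg]
        refine le_trans ?_ (le_abs_self _)
        linarith
    · rcases le_or_gt (i + 1) m with hlt | hgt
      · exact le_trans (key2 i hlt x y h) (le_abs_self _)
      · rcases (show j + 1 ≤ m by omega).lt_or_eq with hlt | heq
        · have := k1 hlt y x (h.swap hs)
          rw [← abs_neg]
          refine le_trans ?_ (le_abs_self _)
          linarith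
        · have := k0 heq y x
          rw [← abs_neg] at ih1 ⊢
          convert ih1 using 2
          linarith


/-- The linear forms `s (j+1) - s j * u`. -/
def rlin (s : ℕ → ℝ) (u : ℝ) (j : ℕ) : ℝ := s (j + 1) - s j * u

section
variable {q : ℕ} {lam : ℝ} {s : ℕ → ℝ}

lemma rlin_zero (hs : SFacts q lam s) (u : ℝ) : rlin s u 0 = 1 := by
  simp [rlin, hs.zero, hs.one]

lemma SFacts.two (hs : SFacts q lam s) : s 2 = lam := by
  have := hs.rec' 0
  rw [hs.zero, hs.one] at this; simpa using this

lemma rlin_one (hs : SFacts q lam s) (u : ℝ) : rlin s u 1 = lam - u := by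
  simp [rlin, hs.two, hs.one]

lemma rlin_rec (hs : SFacts q lam s) (u : ℝ) (j : ℕ) :
    rlin s u (j + 2) = lam * rlin s u (j + 1) - rlin s u j := by
  have h1 := hs.rec' (j + 1)
  have h2 := hs.rec' j
  simp only [rlin]
  rw [show j + 2 + 1 = j + 1 + 2 by ring, h1, show j + 1 + 1 = j + 2 by ring, h2]
  ring

lemma rlin_pos (hs : SFacts q lam s) {u : ℝ} {k : ℕ} (hk : k < q) (h : 0 < rlin s u k) (j : ℕ)
    (hj : j ≤ k) : 0 < rlin s u j := by
  rcases Nat.eq_zero_or_pos j with rfl | hj0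
  · rw [rlin_zero hs]; norm_num
  obtain ⟨i, rfl⟩ := Nat.exists_eq_add_of_le hj
  have h1 := hs.cross j i
  have h2 := hs.nonneg i (by omega)
  have h3 := hs.one_le j hj0 (by omega)
  have h4 := hs.one_le (j + i) (by omega) hk
  have h5 : s (j + i) * rlin s u j = s j * rlin s u (j + i) + s i := by
    rw [← h1]; simp only [rlin]; ring
  have h6 : 0 < s (j + i) * rlin s u j := by
    rw [h5]; have := mul_pos (by linarith : 0 < s j) h; linarith
  exact (mul_pos_iff_of_pos_left (by linarith)).1 h6

lemma rlin_pos' (hs : SFacts q lam s) {w : ℝ} (hw : w ≤ 0) (j : ℕ) (hj : j + 1 < q) :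
    0 < rlin s w j := by
  have h1 := hs.one_le (j + 1) (by omega) hj
  have h2 := hs.nonneg j (by omega)
  simp only [rlin]
  nlinarith

end

/-- One step of the natural extension, in terms of `a = 1/|t|`. -/
structure RStp (lam α t v : ℝ) (d : ℤ) (t' v' a : ℝ) : Prop where
  apos : 0 < a
  lo : (α - 1) * lam ≤ t
  hi : t < α * lam
  lo' : (α - 1) * lam ≤ t'
  hi' : t' < α * lam
  d1 : 1 ≤ d
  ht : t' = a - d * lam
  sg : (t * a = 1 ∧ v' = 1 / (d * lam + v)) ∨ (t * a = -1 ∧ v' = 1 / (d * lam - v))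

/-- The chain invariant. -/
def RChain (x y : ℕ → ℝ) (K : ℕ) (t v : ℝ) : Prop :=
  ∀ j, j < K → t < 0 → x (j + 1) ≤ -t * x j → v * y (j + 1) ≤ y j

/-- Parameters. -/
structure RPar (lam α : ℝ) : Prop where
  l1 : 1 ≤ lam
  l2 : lam < 2
  a1 : 1 / 2 ≤ α
  a2 : α * lam ≤ 1

section
variable {lam α t v t' v' a : ℝ} {d : ℤ}

lemma RStp.cases (h : RStp lam α t v d t' v' a) : (d = 1 ∨ d = 2 ∨ 3 ≤ d) := by
  have := h.d1; omega

lemma RStp.tneg (h : RStp lam α t v d t' v' a) (ht : t * a = -1) : t < 0 := by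
  have := h.apos; by_contra hc; push Not at hc; nlinarith [mul_nonneg hc this.le]

lemma RStp.tpos (h : RStp lam α t v d t' v' a) (ht : t * a = 1) : 0 < t := by
  have := h.apos; by_contra hc; push Not at hc; nlinarith

/-- lower bound for `a` when `t < 0`. -/
lemma RStp.a_lo (h : RStp lam α t v d t' v' a) (ht : t * a = -1) :
    1 ≤ a * ((1 - α) * lam) := by
  have := h.apos; have := h.lo; nlinarith

lemma RStp.a_lo2 (hp : RPar lam α) (h : RStp lam α t v d t' v' a) (ht : t * a = -1) :
    2 ≤ a * lam := by
  have := h.a_lo ht; have := h.apos; have := hp.a1; have := hp.l1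
  have : a * ((1 - α) * lam) ≤ a * (1 / 2 * lam) := by gcongr; linarith
  linarith

lemma RStp.a_lo1 (hp : RPar lam α) (h : RStp lam α t v d t' v' a) (ht : t * a = 1) :
    1 < a := by
  have := h.apos; have := h.hi; have := hp.a2; have := hp.l1
  by_contra hc
  push Not at hc
  have := h.tpos ht
  nlinarith

/-- generic upper bound for `v'`. -/
lemma RStp.vub (hp : RPar lam α) (h : RStp lam α t v d t' v' a) (hv : 0 ≤ v) (hv1 : v ≤ 1)
    (hc : ¬ (d = 1 ∧ t * a = -1)) : 0 ≤ v' ∧ v' * lam ≤ 1 := by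
  have hl := hp.l1
  rcases h.sg with ⟨h1, h2⟩ | ⟨h1, h2⟩
  · have hd : (1 : ℝ) ≤ d := by exact_mod_cast h.d1
    have : lam ≤ d * lam + v := by nlinarith
    rw [h2]
    refine ⟨by apply div_nonneg <;> linarith, ?_⟩
    rw [div_mul_eq_mul_div, one_mul, div_le_one (by linarith)]
    exact this
  · have hd : (2 : ℤ) ≤ d := by have := h.d1; have : d ≠ 1 := fun e => hc ⟨e, h1⟩; omega
    have hd : (2 : ℝ) ≤ d := by exact_mod_cast hd
    have : lam ≤ d * lam - v := by nlinarith
    rw [h2]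
    refine ⟨by apply div_nonneg <;> linarith, ?_⟩
    rw [div_mul_eq_mul_div, one_mul, div_le_one (by linarith)]
    exact this

/-- upper bound for `v'` from a lower bound of the digit. -/
lemma RStp.vle (h : RStp lam α t v d t' v' a)
    {c : ℝ} (hc : 0 ≤ c) (hpos : t * a = 1 → c ≤ d * lam + v) (hneg : t * a = -1 → c ≤ d * lam - v) :
    v' * c ≤ 1 := by
  have hd : (1 : ℝ) ≤ d := by exact_mod_cast h.d1
  rcases h.sg with ⟨h1, h2⟩ | ⟨h1, h2⟩
  · have := hpos h1
    rw [h2, div_mul_eq_mul_div, one_mul]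
    exact div_le_one_of_le₀ this (by linarith)
  · have := hneg h1
    rw [h2, div_mul_eq_mul_div, one_mul]
    exact div_le_one_of_le₀ this (by linarith)

lemma RStp.vnn (hp : RPar lam α) (h : RStp lam α t v d t' v' a) (hv : 0 ≤ v) (hv1 : v ≤ 1) :
    0 ≤ v' := by
  have hl := hp.l1
  have hd : (1 : ℝ) ≤ d := by exact_mod_cast h.d1
  rcases h.sg with ⟨h1, h2⟩ | ⟨h1, h2⟩ <;> rw [h2] <;> apply div_nonneg <;> nlinarith

lemma chain_step (hp : RPar lam α) (h : RStp lam α t v d t' v' a) (hv : 0 ≤ v) (hv1 : v ≤ 1)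
    {x y : ℕ → ℝ} {K : ℕ} (hx : ∀ j, x (j + 2) = lam * x (j + 1) - x j)
    (hy : ∀ j, y (j + 2) = lam * y (j + 1) - y j)
    (hy0 : ∀ j, j ≤ K → 0 < y j)
    (h0 : 0 < K → t' < 0 → x 1 ≤ -t' * x 0 → v' * y 1 ≤ y 0)
    (hc : RChain x y K t v) : RChain x y K t' v' := by
  intro j hj ht hxj
  rcases j with _ | j
  · exact h0 hj ht hxj
  have y0 := hy0 j (by omega)
  have y1 := hy0 (j + 1) (by omega)
  by_cases hd : d = 1 ∧ t * a = -1
  · obtain ⟨rfl, ha⟩ := hd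
    have hv' : v' = 1 / (lam - v) := by
      rcases h.sg with ⟨h1, h2⟩ | ⟨h1, h2⟩
      · linarith
      · simpa using h2
    have hl := hp.l1
    have ht' : t' = a - lam := by simpa using h.ht
    have tn := h.tneg ha
    rw [show j + 1 + 1 = j + 2 by ring, hx, ht'] at hxj
    have h2 : x (j + 1) ≤ - t * x j := by
      have : a * x (j + 1) ≤ x j := by linarith
      have h3 := mul_le_mul_of_nonneg_left this (by linarith : 0 ≤ -t)
      have : -t * (a * x (j + 1)) = x (j + 1) := by
        rw [← mul_assoc]; rw [show -t * a = 1 by linarith]; ring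
      linarith
    have h3 := hc j (by omega) tn h2
    rw [show j + 1 + 1 = j + 2 by ring, hy, hv', div_mul_eq_mul_div]
    exact div_le_of_le_mul₀ (by linarith) y1.le (by linarith)
  · have h2 := (h.vub hp hv hv1 hd)
    rw [show j + 1 + 1 = j + 2 by ring, hy]
    nlinarith [mul_nonneg h2.1 y0.le]

end


section
variable {lam α t v t' v' a : ℝ} {d : ℤ} {s : ℕ → ℝ} {k : ℕ}

/-- Even invariant. -/
def EInv (s : ℕ → ℝ) (k : ℕ) (t v : ℝ) : Prop :=
  0 ≤ v ∧ v ≤ 1 ∧ RChain (rlin s 1) (rlin s (-1)) (k + 1) t v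

lemma even_vals (hs : SFacts (2 * (k + 2)) lam s) :
    s (k + 3) = lam / 2 * s (k + 2) ∧ s (k + 1) = lam / 2 * s (k + 2) ∧
    s k = (lam ^ 2 / 2 - 1) * s (k + 2) ∧ 1 ≤ s (k + 2) ∧ 2 ≤ lam ^ 2 := by
  obtain ⟨h1, h2⟩ := hs.even_mid (by omega)
  rw [show k + 2 - 1 = k + 1 by omega] at h1 h2
  have h3 := hs.rec' k
  have h4 := hs.one_le (k + 2) (by omega) (by omega)
  have h5 : s k = (lam ^ 2 / 2 - 1) * s (k + 2) := by
    rw [h2] at h3; linear_combination h3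
  refine ⟨h1.trans h2, h2, h5, h4, ?_⟩
  have := hs.nonneg k (by omega)
  rw [h5] at this
  by_contra hc
  push Not at hc
  nlinarith

lemma even_end (hs : SFacts (2 * (k + 2)) lam s) (l2 : lam < 2)
    (hc : RChain (rlin s 1) (rlin s (-1)) (k + 1) t v) (ht : t < 0) (h : 1 ≤ -t * (lam + 1)) :
    v ≤ lam - 1 := by
  obtain ⟨e3, e1, e0, e2, hl⟩ := even_vals hs
  have := hc k (by omega) ht (by
    simp only [rlin]
    rw [show k + 1 + 1 = k + 2 by ring, e1, e0]
    have : 0 ≤ (-t * (lam + 1) - 1) * ((1 - lam / 2) * s (k + 2)) := by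
      apply mul_nonneg (by linarith); apply mul_nonneg <;> linarith
    nlinarith)
  simp only [rlin] at this
  rw [show k + 1 + 1 = k + 2 by ring, e1, e0] at this
  have h3 : 0 ≤ ((1 + lam / 2) * s (k + 2)) * (lam - 1 - v) := by nlinarith
  have h4 : 0 < (1 + lam / 2) * s (k + 2) := by
    have : 0 ≤ lam ∨ lam ≤ 0 := le_total _ _
    have hsp : 0 < s (k + 2) := by linarith
    have h1 : 0 ≤ lam := by
      have := hs.nonneg (k + 1) (by omega)
      rw [e1] at this
      by_contra hcc
      push Not at hcc
      nlinarith
    positivity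
  have := nonneg_of_mul_nonneg_right h3 h4
  linarith

lemma even_step (hs : SFacts (2 * (k + 2)) lam s) (hp : RPar lam α)
    (h : RStp lam α t v d t' v' a) (hi : EInv s k t v) : EInv s k t' v' := by
  obtain ⟨v0, v1, hc⟩ := hi
  have l1 := hp.l1
  have l2 := hp.l2
  have hend : t * a = -1 → a ≤ lam + 1 → v ≤ lam - 1 := by
    intro ha hle
    have tn := h.tneg ha
    exact even_end hs hp.l2 hc tn (by nlinarith)
  have ht := h.ht
  refine ⟨h.vnn hp v0 v1, ?_, ?_⟩
  · have := h.vle (c := 1) (by norm_num) ?_ ?_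
    · linarith
    · intro ha
      have hd : (1 : ℝ) ≤ d := by exact_mod_cast h.d1
      nlinarith
    · intro ha
      rcases h.cases with rfl | hd
      · have := h.hi'
        have := hp.a2
        push_cast at *
        have := hend ha (by nlinarith)
        linarith
      · have : (2 : ℤ) ≤ d := by omega
        have : (2 : ℝ) ≤ d := by exact_mod_cast this
        nlinarith
  · apply chain_step hp h v0 v1 (rlin_rec hs 1) (rlin_rec hs (-1)) _ _ hc
    · intro j hj
      exact rlin_pos' hs (by norm_num) j (by omega)
    · intro _ tn hx
      rw [rlin_one hs, rlin_zero hs] at *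
      have hle : a - d * lam ≤ 1 - lam := by linarith
      have := h.vle (c := lam + 1) (by linarith) ?_ ?_
      · linarith
      · intro ha
        have a1 := h.a_lo1 hp ha
        rcases h.cases with rfl | hd
        · push_cast at *; linarith
        · have : (2 : ℤ) ≤ d := by omega
          have : (2 : ℝ) ≤ d := by exact_mod_cast this
          nlinarith
      · intro ha
        have a1 := h.a_lo2 hp ha
        rcases h.cases with rfl | rfl | hd
        · push_cast at *; nlinarith
        · push_cast at *
          have := hend ha (by linarith)
          linarith
        · have : (3 : ℝ) ≤ d := by exact_mod_cast hd
          nlinarith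

/-- Constants for odd `q`. -/
structure RGold (lam P r : ℝ) : Prop where
  mul : P * r = 1
  sub : P - r = 2 - lam
  rpos : 0 < r

lemma RGold.facts {P r : ℝ} (g : RGold lam P r) (l1 : 1 ≤ lam) (l2 : lam < 2) :
    1 < P ∧ r < 1 ∧ lam / 2 < r ∧ lam - 1 < r ∧ (lam - 1) * P < 1 ∧ P < 3 - lam ∧
    P + r ≤ 2 + (2 - lam) ^ 2 / 4 := by
  have h1 := g.mul
  have h2 := g.sub
  have h3 := g.rpos
  have hP : P = r + 2 - lam := by linarith
  subst hP
  have r1 : r < 1 := by nlinarith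
  have hr : lam / 2 < r := by
    by_contra hc; push Not at hc
    nlinarith [mul_nonneg h3.le (by linarith : 0 ≤ lam / 2 - r)]
  refine ⟨?_, r1, hr, by linarith, by nlinarith, by linarith, ?_⟩
  · nlinarith
  · have : r ≤ 1 - (2 - lam) / 2 + (2 - lam) ^ 2 / 8 := by
      by_contra hc; push Not at hc
      nlinarith [mul_pos h3 (by linarith : 0 < r - (1 - (2 - lam) / 2 + (2 - lam) ^ 2 / 8)), sq_nonneg (2 - lam)]
    nlinarith

lemma odd_vals (hs : SFacts (2 * (k + 2) + 1) lam s) (l1 : 1 ≤ lam) :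
    s (k + 3) = s (k + 2) ∧ s (k + 1) = (lam - 1) * s (k + 2) ∧
    s k = (lam ^ 2 - lam - 1) * s (k + 2) ∧ 1 ≤ s (k + 2) ∧ lam + 1 ≤ lam ^ 2 ∧ 8 / 5 < lam := by
  obtain ⟨h1, h2, _⟩ := hs.odd_mid (by omega)
  rw [show k + 2 - 1 = k + 1 by omega] at h2
  rw [show k + 2 + 1 = k + 3 by omega] at h1
  have h3 := hs.rec' k
  have h4 := hs.one_le (k + 2) (by omega) (by omega)
  have h5 : s k = (lam ^ 2 - lam - 1) * s (k + 2) := by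
    rw [h2] at h3; linear_combination h3
  have h6 : lam + 1 ≤ lam ^ 2 := by
    have := hs.nonneg k (by omega)
    rw [h5] at this
    by_contra hc
    push Not at hc
    nlinarith
  exact ⟨h1, h2, h5, h4, h6, by nlinarith⟩

lemma odd_end1 {P r : ℝ} (g : RGold lam P r) (hs : SFacts (2 * (k + 2) + 1) lam s) (l1 : 1 ≤ lam)
    (l2 : lam < 2)
    (hc : RChain (rlin s r) (rlin s (-P)) (k + 2) t v) (ht : t < 0) (h : 1 ≤ -t * (lam + P)) :
    v ≤ lam - r := by
  obtain ⟨e3, e1, e0, e2, hl, hl'⟩ := odd_vals hs l1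
  obtain ⟨g1, g2, g3, g4, g5, g6, g7⟩ := g.facts l1 l2
  have gm := g.mul
  have gs := g.sub
  have := hc (k + 1) (by omega) ht (by
    simp only [rlin]
    rw [show k + 1 + 1 + 1 = k + 3 by ring, show k + 1 + 1 = k + 2 by ring, e1, e3]
    have : 0 ≤ (-t * (lam + P) - 1) * ((1 - r) * s (k + 2)) := by
      apply mul_nonneg (by linarith); apply mul_nonneg <;> linarith
    have e : (lam + P) * (1 - r) = 1 - (lam - 1) * r := by linear_combination gs - gm
    have : (-t * (lam + P) - 1) * ((1 - r) * s (k + 2))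
      = -t * (1 - (lam - 1) * r) * s (k + 2) - (1 - r) * s (k + 2) := by rw [← e]; ring
    nlinarith)
  simp only [rlin] at this
  rw [show k + 1 + 1 + 1 = k + 3 by ring, show k + 1 + 1 = k + 2 by ring, e1, e3] at this
  have e : (lam - r) * (1 + P) = 1 + (lam - 1) * P := by linear_combination gs - gm
  have h3 : 0 ≤ ((1 + P) * s (k + 2)) * (lam - r - v) := by
    have : ((1 + P) * s (k + 2)) * (lam - r - v) =
      ((lam - r) * (1 + P)) * s (k + 2) - v * (1 + P) * s (k + 2) := by ring
    rw [this, e]; linarith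
  have h4 : 0 < (1 + P) * s (k + 2) := by apply mul_pos <;> linarith
  have := nonneg_of_mul_nonneg_right h3 h4
  linarith

lemma odd_end2 {P r : ℝ} (g : RGold lam P r) (hs : SFacts (2 * (k + 2) + 1) lam s) (l1 : 1 ≤ lam)
    (l2 : lam < 2)
    (hc : RChain (rlin s P) (rlin s (-r)) (k + 1) t v) (ht : t < 0) (h : 1 ≤ -t * (lam + r)) :
    v ≤ lam - P := by
  obtain ⟨e3, e1, e0, e2, hl, hl'⟩ := odd_vals hs l1
  obtain ⟨g1, g2, g3, g4, g5, g6, g7⟩ := g.facts l1 l2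
  have gm := g.mul
  have gs := g.sub
  have := hc k (by omega) ht (by
    simp only [rlin]
    rw [show k + 1 + 1 = k + 2 by ring, e1, e0]
    have : 0 ≤ (-t * (lam + r) - 1) * ((1 - (lam - 1) * P) * s (k + 2)) := by
      apply mul_nonneg (by linarith); apply mul_nonneg <;> linarith
    have e : (lam + r) * (1 - (lam - 1) * P) = (lam - 1) - (lam ^ 2 - lam - 1) * P := by
      linear_combination -gs - (lam - 1) * gm
    have : (-t * (lam + r) - 1) * ((1 - (lam - 1) * P) * s (k + 2))
      = -t * ((lam - 1) - (lam ^ 2 - lam - 1) * P) * s (k + 2) - (1 - (lam - 1) * P) * s (k + 2) := by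
      rw [← e]; ring
    nlinarith)
  simp only [rlin] at this
  rw [show k + 1 + 1 = k + 2 by ring, e1, e0] at this
  have e : (lam - P) * (1 + (lam - 1) * r) = (lam - 1) + (lam ^ 2 - lam - 1) * r := by
    linear_combination -gs - (lam - 1) * gm
  have h3 : 0 ≤ ((1 + (lam - 1) * r) * s (k + 2)) * (lam - P - v) := by
    have : ((1 + (lam - 1) * r) * s (k + 2)) * (lam - P - v) =
      ((lam - P) * (1 + (lam - 1) * r)) * s (k + 2) - v * (1 + (lam - 1) * r) * s (k + 2) := by ring
    rw [this, e]; nlinarith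
  have h4 : 0 < (1 + (lam - 1) * r) * s (k + 2) := by
    have := g.rpos
    have : 0 ≤ (lam - 1) * r := mul_nonneg (by linarith) this.le
    apply mul_pos <;> linarith
  have := nonneg_of_mul_nonneg_right h3 h4
  linarith

/-- Odd invariant, `α λ ≤ r`. -/
def OInv (P r : ℝ) (s : ℕ → ℝ) (k : ℕ) (t v : ℝ) : Prop :=
  0 ≤ v ∧ v ≤ 1 ∧ RChain (rlin s r) (rlin s (-P)) (k + 2) t v ∧
    RChain (rlin s P) (rlin s (-r)) (k + 1) t v

set_option maxHeartbeats 2000000 in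
lemma odd_step {P r : ℝ} (g : RGold lam P r) (hs : SFacts (2 * (k + 2) + 1) lam s)
    (hp : RPar lam α) (hr : α * lam ≤ r)
    (h : RStp lam α t v d t' v' a) (hi : OInv P r s k t v) : OInv P r s k t' v' := by
  obtain ⟨v0, v1, hc1, hc2⟩ := hi
  have l1 := hp.l1
  have l2 := hp.l2
  obtain ⟨e3, e1, e0, e2, hl, hl'⟩ := odd_vals hs l1
  obtain ⟨g1, g2, g3, g4, g5, g6, g7⟩ := g.facts l1 l2
  have gm := g.mul
  have gs := g.sub
  have rp := g.rpos
  have hend1 : t * a = -1 → a ≤ lam + P → v ≤ lam - r := by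
    intro ha hle
    have tn := h.tneg ha
    exact odd_end1 g hs l1 l2 hc1 tn (by nlinarith)
  have hend2 : t * a = -1 → a ≤ lam + r → v ≤ lam - P := by
    intro ha hle
    have tn := h.tneg ha
    exact odd_end2 g hs l1 l2 hc2 tn (by nlinarith)
  have ht := h.ht
  have aP : t * a = 1 → P < a := by
    intro ha
    have := h.tpos ha
    have := h.hi
    have := h.apos
    have : t < r := by linarith
    nlinarith
  refine ⟨h.vnn hp v0 v1, ?_, ?_, ?_⟩
  · have := h.vle (c := 1) (by norm_num) ?_ ?_
    · linarith
    · intro ha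
      have hd : (1 : ℝ) ≤ d := by exact_mod_cast h.d1
      nlinarith
    · intro ha
      rcases h.cases with rfl | hd
      · have := h.hi'
        have := hp.a2
        push_cast at *
        have := hend2 ha (by nlinarith)
        linarith
      · have : (2 : ℤ) ≤ d := by omega
        have : (2 : ℝ) ≤ d := by exact_mod_cast this
        nlinarith
  · apply chain_step hp h v0 v1 (rlin_rec hs _) (rlin_rec hs _) _ _ hc1
    · intro j hj
      exact rlin_pos' hs (by linarith) j (by omega)
    · intro _ tn hx
      rw [rlin_one hs, rlin_zero hs] at *
      have hle : a - d * lam ≤ r - lam := by linarith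
      have := h.vle (c := lam + P) (by linarith) ?_ ?_
      · linarith
      · intro ha
        have a1 := aP ha
        rcases h.cases with rfl | hd
        · push_cast at *; linarith
        · have : (2 : ℤ) ≤ d := by omega
          have : (2 : ℝ) ≤ d := by exact_mod_cast this
          nlinarith
      · intro ha
        have a1 := h.a_lo2 hp ha
        rcases h.cases with rfl | rfl | hd
        · push_cast at *; nlinarith
        · push_cast at *
          have := hend2 ha (by linarith)
          linarith
        · have : (3 : ℝ) ≤ d := by exact_mod_cast hd
          nlinarith
  · apply chain_step hp h v0 v1 (rlin_rec hs _) (rlin_rec hs _) _ _ hc2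
    · intro j hj
      exact rlin_pos' hs (by linarith) j (by omega)
    · intro _ tn hx
      rw [rlin_one hs, rlin_zero hs] at *
      have hle : a - d * lam ≤ P - lam := by linarith
      have := h.vle (c := lam + r) (by linarith) ?_ ?_
      · linarith
      · intro ha
        have a1 := aP ha
        rcases h.cases with rfl | hd
        · push_cast at *; linarith
        · have : (2 : ℤ) ≤ d := by omega
          have : (2 : ℝ) ≤ d := by exact_mod_cast this
          nlinarith
      · intro ha
        have a1 := h.a_lo2 hp ha
        rcases h.cases with rfl | rfl | hd
        · push_cast at *; nlinarith
        · push_cast at *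
          have := hend1 ha (by linarith)
          linarith
        · have : (3 : ℝ) ≤ d := by exact_mod_cast hd
          nlinarith

/-- Odd invariant, `α λ > r`. -/
def PInv (lam : ℝ) (s : ℕ → ℝ) (k : ℕ) (t v : ℝ) : Prop :=
  0 ≤ v ∧ v ≤ 1 ∧ RChain (rlin s (2 / lam)) (rlin s 0) (k + 1) t v

lemma odd_end3 (hs : SFacts (2 * (k + 2) + 1) lam s) (l1 : 1 ≤ lam)
    (l2 : lam < 2)
    (hc : RChain (rlin s (2 / lam)) (rlin s 0) (k + 1) t v) (ht : t < 0) (h : 1 ≤ -t * (lam + 1)) :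
    v ≤ lam - 1 := by
  obtain ⟨e3, e1, e0, e2, hl, hl'⟩ := odd_vals hs l1
  have hl0 : 2 / lam * lam = 2 := by field_simp
  set z := 2 / lam with hz
  have := hc k (by omega) ht (by
    simp only [rlin]
    rw [show k + 1 + 1 = k + 2 by ring, e1, e0]
    have hz1 : (lam - 1) * z ≤ 1 := by nlinarith
    have : 0 ≤ (-t * (lam + 1) - 1) * ((1 - (lam - 1) * z) * s (k + 2)) := by
      apply mul_nonneg (by linarith); apply mul_nonneg <;> linarith
    have e : (lam + 1) * (1 - (lam - 1) * z) = (lam - 1) - (lam ^ 2 - lam - 1) * z := by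
      linear_combination - hl0
    have : (-t * (lam + 1) - 1) * ((1 - (lam - 1) * z) * s (k + 2))
      = -t * ((lam - 1) - (lam ^ 2 - lam - 1) * z) * s (k + 2) - (1 - (lam - 1) * z) * s (k + 2) := by
      rw [← e]; ring
    nlinarith)
  simp only [rlin] at this
  rw [show k + 1 + 1 = k + 2 by ring, e1, e0] at this
  have h3 : 0 ≤ s (k + 2) * (lam - 1 - v) := by linarith
  have := nonneg_of_mul_nonneg_right h3 (by linarith)
  linarith

lemma odd_step2 (hs : SFacts (2 * (k + 2) + 1) lam s)
    (hp : RPar lam α) (hr : 1 / 2 < α)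
    (h : RStp lam α t v d t' v' a) (hi : PInv lam s k t v) : PInv lam s k t' v' := by
  obtain ⟨v0, v1, hc⟩ := hi
  have l1 := hp.l1
  have l2 := hp.l2
  have hl0 : 2 / lam * lam = 2 := by field_simp
  obtain ⟨e3, e1, e0, e2, hl, hl'⟩ := odd_vals hs l1
  have hend : t * a = -1 → a ≤ lam + 1 → v ≤ lam - 1 := by
    intro ha hle
    have tn := h.tneg ha
    exact odd_end3 hs l1 l2 hc tn (by nlinarith)
  have ht := h.ht
  refine ⟨h.vnn hp v0 v1, ?_, ?_⟩
  · have := h.vle (c := 1) (by norm_num) ?_ ?_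
    · linarith
    · intro ha
      have hd : (1 : ℝ) ≤ d := by exact_mod_cast h.d1
      nlinarith
    · intro ha
      rcases h.cases with rfl | hd
      · have := h.hi'
        have := hp.a2
        push_cast at *
        have := hend ha (by nlinarith)
        linarith
      · have : (2 : ℤ) ≤ d := by omega
        have : (2 : ℝ) ≤ d := by exact_mod_cast this
        nlinarith
  · apply chain_step hp h v0 v1 (rlin_rec hs _) (rlin_rec hs _) _ _ hc
    · intro j hj
      exact rlin_pos' hs le_rfl j (by omega)
    · intro _ tn hx
      rw [rlin_one hs, rlin_zero hs] at *
      have hle : a - d * lam ≤ 2 / lam - lam := by linarith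
      have := h.vle (c := lam) (by linarith) ?_ ?_
      · linarith
      · intro ha
        have hd : (1 : ℝ) ≤ d := by exact_mod_cast h.d1
        nlinarith
      · intro ha
        have a1 := h.a_lo ha
        rcases h.cases with rfl | hd
        · push_cast at *
          exfalso
          have h1 : a * lam ≤ 2 := by nlinarith
          have h2 : a * ((1 - α) * lam) = (1 - α) * (a * lam) := by ring
          have h3 := h.a_lo2 hp ha
          nlinarith
        · have : (2 : ℤ) ≤ d := by omega
          have : (2 : ℝ) ≤ d := by exact_mod_cast this
          nlinarith

/-- Invariant for `q = 3`. -/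
def TInv (r : ℝ) (t v : ℝ) : Prop :=
  0 ≤ v ∧ v ≤ r ∧ (t < 0 → 1 ≤ -t * (2 + r) → v ≤ 1 - r)

lemma three_step {r : ℝ} (hr0 : 0 < r) (hr : r * (1 + r) = 1) (hp : RPar 1 α) (hα : α ≤ r)
    (h : RStp 1 α t v d t' v' a) (hi : TInv r t v) : TInv r t' v' := by
  obtain ⟨v0, v1, hc⟩ := hi
  have ht := h.ht
  have r1 : r < 5 / 8 := by nlinarith
  have r2 : 3 / 5 < r := by nlinarith
  have hend : t * a = -1 → a ≤ 2 + r → v ≤ 1 - r := by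
    intro ha hle
    have tn := h.tneg ha
    exact hc tn (by nlinarith)
  have a2 : t * a = -1 → 2 ≤ a := fun ha => by have := h.a_lo2 hp ha; linarith
  have a1 : t * a = 1 → 1 + r < a := by
    intro ha
    have := h.tpos ha
    have := h.hi
    have := h.apos
    have : t < r := by linarith
    nlinarith
  have hi' := h.hi'
  refine ⟨h.vnn hp v0 (by linarith), ?_, ?_⟩
  · have := h.vle (c := 1 + r) (by linarith) ?_ ?_
    · nlinarith
    · intro ha
      have := a1 ha
      rcases h.cases with rfl | hd
      · push_cast at *; linarith
      · have : (2 : ℤ) ≤ d := by omega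
        have : (2 : ℝ) ≤ d := by exact_mod_cast this
        linarith
    · intro ha
      have := a2 ha
      rcases h.cases with rfl | rfl | hd
      · push_cast at *; linarith [hp.a1]
      · push_cast at *
        have := hend ha (by linarith)
        linarith
      · have : (3 : ℝ) ≤ d := by exact_mod_cast hd
        linarith
  · intro tn hle
    have e : (1 - r) * (2 + r) = 1 := by linarith
    have htt : t' ≤ -(1 - r) := by
      by_contra hcc; push Not at hcc
      nlinarith
    have := h.vle (c := 2 + r) (by linarith) ?_ ?_
    · nlinarith
    · intro ha
      have := a1 ha
      rcases h.cases with rfl | rfl | hd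
      · push_cast at *; linarith
      · push_cast at *; linarith
      · have : (3 : ℝ) ≤ d := by exact_mod_cast hd
        linarith
    · intro ha
      have := a2 ha
      rcases h.cases with rfl | rfl | hd
      · push_cast at *; linarith
      · push_cast at *; linarith
      · rcases eq_or_lt_of_le hd with rfl | hd
        · push_cast at *
          have := hend ha (by linarith)
          linarith
        · have : (4 : ℤ) ≤ d := by omega
          have : (4 : ℝ) ≤ d := by exact_mod_cast this
          linarith

lemma three_step2 (hp : RPar 1 α)
    (h : RStp 1 α t v d t' v' a) (hi : 0 ≤ v ∧ v ≤ 1) : 0 ≤ v' ∧ v' ≤ 1 := by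
  obtain ⟨v0, v1⟩ := hi
  refine ⟨h.vnn hp v0 v1, ?_⟩
  have ht := h.ht
  have hi' := h.hi'
  have := h.vle (c := 1) (by linarith) ?_ ?_
  · linarith
  · intro ha
    have hd : (1 : ℝ) ≤ d := by exact_mod_cast h.d1
    linarith
  · intro ha
    have a1 := h.a_lo2 hp ha
    rcases h.cases with rfl | hd
    · push_cast at *
      exfalso
      have := hp.a2
      linarith
    · have : (2 : ℤ) ≤ d := by omega
      have : (2 : ℝ) ≤ d := by exact_mod_cast this
      linarith

end


/-- An orbit all of whose approximation coefficients are bad from `N` on. -/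
structure RBad (lam α h : ℝ) (t v a : ℕ → ℝ) (d : ℕ → ℤ) (N : ℕ) : Prop where
  par : RPar lam α
  stp : ∀ n, RStp lam α (t n) (v n) (d n) (t (n + 1)) (v (n + 1)) (a n)
  v0 : ∀ n, 0 ≤ v n
  v1 : ∀ n, v n ≤ 1
  dp : ∀ n, t n * a n = 1 → 0 < d n * lam + v n
  dn : ∀ n, t n * a n = -1 → 0 < d n * lam - v n
  bp : ∀ n, N ≤ n → t n * a n = 1 → a n + v n < h
  bn : ∀ n, N ≤ n → t n * a n = -1 → a n - v n < h

section
variable {lam α h : ℝ} {t v a : ℕ → ℝ} {d : ℕ → ℤ} {N : ℕ} {q : ℕ} {s : ℕ → ℝ}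

lemma RBad.sg (B : RBad lam α h t v a d N) (n : ℕ) : t n * a n = 1 ∨ t n * a n = -1 := by
  rcases (B.stp n).sg with h | h
  · exact Or.inl h.1
  · exact Or.inr h.1

lemma RBad.ne (B : RBad lam α h t v a d N) (n : ℕ) : t n ≠ 0 := by
  intro h0
  rcases B.sg n with h | h <;> rw [h0] at h <;> norm_num at h

lemma RBad.neg (B : RBad lam α h t v a d N) {n : ℕ} (hn : t n < 0) : t n * a n = -1 := by
  rcases B.sg n with h | h
  · have := (B.stp n).tpos h; linarith
  · exact h

lemma RBad.pos' (B : RBad lam α h t v a d N) {n : ℕ} (hn : 0 < t n) : t n * a n = 1 := by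
  rcases B.sg n with h | h
  · exact h
  · have := (B.stp n).tneg h; linarith

lemma RBad.vneg (B : RBad lam α h t v a d N) {n : ℕ} (hn : t n * a n = -1) :
    v (n + 1) * (d n * lam - v n) = 1 := by
  rcases (B.stp n).sg with h | h
  · linarith [h.1]
  · rw [h.2]; have := B.dn n hn; field_simp

lemma RBad.vpos (B : RBad lam α h t v a d N) {n : ℕ} (hn : t n * a n = 1) :
    v (n + 1) * (d n * lam + v n) = 1 := by
  rcases (B.stp n).sg with h | h
  · rw [h.2]; have := B.dp n hn; field_simp
  · linarith [h.1]

lemma RBad.pos (B : RBad lam α h t v a d N) {n : ℕ} (hN : N ≤ n) (hn : 0 < t (n + 1)) :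
    t (n + 1) + a (n + 1) < h := by
  have h1 := B.pos' hn
  have h2 := B.bp (n + 1) (by omega) h1
  have h3 := (B.stp n).ht
  have ha := (B.stp (n + 1)).apos
  have hv0 := B.v0 (n + 1)
  obtain ⟨D, hD0, hD1, hD2⟩ : ∃ D, 0 < D ∧ v (n + 1) * D = 1 ∧ t (n + 1) + D < h := by
    rcases B.sg n with h4 | h4
    · exact ⟨_, B.dp n h4, B.vpos h4, by have := B.bp n hN h4; linarith⟩
    · exact ⟨_, B.dn n h4, B.vneg h4, by have := B.bn n hN h4; linarith⟩
  have h5 : 1 < (h - t (n + 1)) * (h - a (n + 1)) := by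
    rw [← hD1]
    have : v (n + 1) * D < (h - a (n + 1)) * (h - t (n + 1)) := by
      apply mul_lt_mul'' <;> linarith
    linarith
  have hh : 0 < h := by linarith
  nlinarith

/-- following an orbit along digits equal to one. -/
lemma RBad.follow (B : RBad lam α h t v a d N) (hs : SFacts q lam s) {n : ℕ} {u w : ℝ} (hw : w ≤ 0)
    (ht : t (n + 1) = u - lam) (hv : v (n + 1) * (lam - w) = 1) {k : ℕ} (hk : k + 1 < q)
    (hx : 0 < rlin s u k) (j : ℕ) (hj : j < k) :
    t (n + 1 + j) * rlin s u j = - rlin s u (j + 1) ∧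
    v (n + 1 + j) * rlin s w (j + 1) = rlin s w j := by
  have xp := fun j hj => rlin_pos hs (by omega) hx j hj
  induction j with
  | zero =>
    rw [rlin_zero hs, rlin_one hs, rlin_zero hs, rlin_one hs]
    simp only [Nat.add_zero]
    exact ⟨by rw [ht]; ring, hv⟩
  | succ j ih =>
    obtain ⟨i1, i2⟩ := ih (by omega)
    have x0 := xp j (by omega)
    have x1 := xp (j + 1) (by omega)
    have x2 := xp (j + 2) (by omega)
    have y0 : 0 < rlin s w j := rlin_pos' hs hw _ (by omega)
    have y1 : 0 < rlin s w (j + 1) := rlin_pos' hs hw _ (by omega)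
    have y2 : 0 < rlin s w (j + 2) := rlin_pos' hs hw _ (by omega)
    have r1 := rlin_rec hs u j
    have r2 := rlin_rec hs w j
    set M := n + 1 + j with hM
    have tn : t M < 0 := by
      by_contra hc; push Not at hc
      nlinarith [mul_nonneg hc x0.le]
    have e := B.neg tn
    have S := B.stp M
    have ea : a M * rlin s u (j + 1) = rlin s u j := by
      have : t M * a M * rlin s u j = -(a M * rlin s u (j + 1)) := by
        linear_combination (a M) * i1
      rw [e] at this; linarith
    have al : a M < lam := by
      by_contra hc; push Not at hc
      nlinarith
    have hd : d M = 1 := by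
      rcases S.cases with hd | hd
      · exact hd
      · exfalso
        have : (2 : ℤ) ≤ d M := by omega
        have : (2 : ℝ) ≤ d M := by exact_mod_cast this
        have h1 := S.lo'
        rw [S.ht] at h1
        have := B.par.l1
        have := B.par.a1
        nlinarith
    have ev := B.vneg e
    have et := S.ht
    rw [hd] at ev et
    push_cast at ev et
    rw [show n + 1 + (j + 1) = M + 1 by omega, show j + 1 + 1 = j + 2 by ring, r1, r2, et]
    refine ⟨by linarith, ?_⟩
    have : v (M + 1) * ((1 * lam - v M) * rlin s w (j + 1)) = rlin s w (j + 1) := by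
      rw [← mul_assoc, ev]; ring
    linear_combination this + v (M + 1) * i2

/-- digits cannot be one with negative sign for ever. -/
lemma RBad.event (B : RBad lam α h t v a d N) (hs : SFacts q lam s) (hq : 3 ≤ q) (M : ℕ) :
    ∃ n, M ≤ n ∧ ¬ (t n * a n = -1 ∧ d n = 1) := by
  by_contra hc
  push Not at hc
  have key : ∀ j, t (M + 1 + j) * rlin s (a M) j = - rlin s (a M) (j + 1) ∧ 0 < rlin s (a M) j := by
    intro j
    induction j with
    | zero =>
      rw [rlin_zero hs, rlin_one hs]
      have et := (B.stp M).ht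
      rw [(hc M le_rfl).2] at et
      push_cast at et
      simp only [Nat.add_zero]
      exact ⟨by rw [et]; ring, one_pos⟩
    | succ j ih =>
      obtain ⟨i1, i2⟩ := ih
      have c := hc (M + 1 + j) (by omega)
      have tn := (B.stp (M + 1 + j)).tneg c.1
      have et := (B.stp (M + 1 + j)).ht
      rw [c.2] at et
      push_cast at et
      have r1 := rlin_rec hs (a M) j
      have x1 : 0 < rlin s (a M) (j + 1) := by nlinarith
      have ea : a (M + 1 + j) * rlin s (a M) (j + 1) = rlin s (a M) j := by
        have : t (M + 1 + j) * a (M + 1 + j) * rlin s (a M) j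
          = -(a (M + 1 + j) * rlin s (a M) (j + 1)) := by
          linear_combination (a (M + 1 + j)) * i1
        rw [c.1] at this; linarith
      refine ⟨?_, x1⟩
      rw [show M + 1 + (j + 1) = M + 1 + j + 1 by omega, show j + 1 + 1 = j + 2 by ring, r1, et]
      linarith
  have h1 := (key (q - 1)).2
  simp only [rlin] at h1
  rw [show q - 1 + 1 = q by omega, hs.symm q 0 (by omega), hs.zero] at h1
  have h2 := hs.one_le (q - 1) (by omega) (by omega)
  have := (B.stp M).apos
  nlinarith

end

section
variable {lam α : ℝ} {t v a : ℕ → ℝ} {d : ℕ → ℤ} {N : ℕ} {s : ℕ → ℝ} {k : ℕ}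

lemma evenq_neg (B : RBad lam α 2 t v a d N) {n : ℕ} (hN : N < n) : t n < 0 := by
  obtain ⟨n, rfl⟩ : ∃ i, n = i + 1 := ⟨n - 1, by omega⟩
  by_contra hc
  push Not at hc
  have hc : 0 < t (n + 1) := lt_of_le_of_ne hc (B.ne _).symm
  have h1 := B.pos (by omega) hc
  have h2 := B.pos' hc
  have h3 := (B.stp (n + 1)).apos
  have h4 : 0 < (2 - (t (n + 1) + a (n + 1))) * (2 + (t (n + 1) + a (n + 1))) := by
    apply mul_pos <;> linarith
  nlinarith [sq_nonneg (t (n + 1) - a (n + 1))]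

lemma even_d2 (hs : SFacts (2 * (k + 2)) lam s) (B : RBad lam α 2 t v a d N) {n : ℕ} (hN : N < n)
    (hd : d n ≠ 1) : d n = 2 ∧ lam / 2 ≤ a n - lam ∧ a n - lam < lam := by
  obtain ⟨e3, e1, e0, e2, hl⟩ := even_vals hs
  have tn := evenq_neg B hN
  have e := B.neg tn
  have S := B.stp n
  have b := B.bn n hN.le e
  have v1 := B.v1 n
  have lo := S.lo'
  have ht := S.ht
  have l1 := B.par.l1
  have a1 := B.par.a1
  have : (d n : ℝ) * lam ≤ a n + (1 - α) * lam := by linarith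
  rcases S.cases with h | h | h
  · exact absurd h hd
  · refine ⟨h, ?_⟩
    rw [h] at ht
    push_cast at *
    have := evenq_neg B (n := n + 1) (by omega)
    constructor
    · nlinarith
    · linarith
  · exfalso
    have : (3 : ℝ) ≤ d n := by exact_mod_cast h
    have l3 : 7 / 5 < lam := by nlinarith
    nlinarith

/-- if `a ≥ λ` we are at an event. -/
lemma even_isev (B : RBad lam α 2 t v a d N) {n : ℕ} (hN : N < n)
    (ha : lam ≤ a n) : d n ≠ 1 := by
  intro hd
  have ht := (B.stp n).ht
  rw [hd] at ht
  push_cast at ht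
  have := evenq_neg B (n := n + 1) (by omega)
  linarith

lemma even_next (hs : SFacts (2 * (k + 2)) lam s) (B : RBad lam α 2 t v a d N) {n : ℕ} (hN : N < n)
    (hd : d n ≠ 1) (hu : lam * (a n - lam) < 2) :
    ∃ n', n < n' ∧ d n' ≠ 1 ∧
      (a n' - lam) * (1 - lam / 2 * (a n - lam)) = (a n - lam) - lam / 2 := by
  obtain ⟨e3, e1, e0, e2, hl⟩ := even_vals hs
  obtain ⟨d2, u1, u2⟩ := even_d2 hs B hN hd
  have e := B.neg (evenq_neg B hN)
  have S := B.stp n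
  have ht := S.ht
  have hv := B.vneg e
  rw [d2] at ht hv
  push_cast at ht hv
  have v1 := B.v1 n
  have l1 := B.par.l1
  set u := a n - lam with hudef
  have xk : rlin s u (k + 1) = s (k + 2) * (1 - lam / 2 * u) := by
    simp only [rlin]; rw [show k + 1 + 1 = k + 2 by ring, e1]; ring
  have xk0 : rlin s u k = s (k + 2) * (lam / 2 - (lam ^ 2 / 2 - 1) * u) := by
    simp only [rlin]; rw [e1, e0]; ring
  have xp : 0 < rlin s u (k + 1) := by
    rw [xk]; apply mul_pos <;> linarith
  obtain ⟨f1, f2⟩ := B.follow hs (n := n) (u := u) (w := v n - lam) (by linarith) (by linarith)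
    (by rw [← hv]; ring) (k := k + 1) (by omega) xp k (by omega)
  have tn := evenq_neg B (n := n + 1 + k) (by omega)
  have e' := B.neg tn
  set M := n + 1 + k with hM
  have ea : a M * rlin s u (k + 1) = rlin s u k := by
    have : t M * a M * rlin s u k = -(a M * rlin s u (k + 1)) := by
      linear_combination (a M) * f1
    rw [e'] at this; linarith
  have key : (a M - lam) * (1 - lam / 2 * u) = u - lam / 2 := by
    rw [xk, xk0] at ea
    have h1 : s (k + 2) * (a M * (1 - lam / 2 * u) - (lam / 2 - (lam ^ 2 / 2 - 1) * u)) = 0 := by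
      linear_combination ea
    rcases mul_eq_zero.1 h1 with h1 | h1
    · linarith
    · linear_combination h1
  refine ⟨M, by omega, even_isev B (by omega) ?_, key⟩
  have : 0 < 1 - lam / 2 * u := by linarith
  by_contra hc
  push Not at hc
  nlinarith

lemma even_no_small (hs : SFacts (2 * (k + 2)) lam s) (B : RBad lam α 2 t v a d N)
    {n : ℕ} (hN : N < n) (hd : d n ≠ 1) : ¬ (a n - lam < 1) := by
  intro hu
  have l1 := B.par.l1
  have l2 := B.par.l2
  set κ := (1 + lam / 2) / (1 - lam / 2) with hκ
  have hκ1 : 1 < κ := by rw [hκ, lt_div_iff₀ (by linarith)]; linarith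
  have hκm : κ * (1 - lam / 2) = 1 + lam / 2 := by
    exact div_mul_cancel₀ _ (by linarith)
  have key : ∀ i : ℕ, ∀ n, N < n → d n ≠ 1 → a n - lam < 1 →
      κ ^ i * (1 - (a n - lam)) ≤ 1 + (a n - lam) := by
    intro i
    induction i with
    | zero =>
      intro n hN hd hu
      obtain ⟨_, u1, u2⟩ := even_d2 hs B hN hd
      simp; linarith
    | succ i ih =>
      intro n hN hd hu
      obtain ⟨_, u1, u2⟩ := even_d2 hs B hN hd
      obtain ⟨n', h1, h2, h3⟩ := even_next hs B hN hd (by nlinarith)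
      set u := a n - lam
      set u' := a n' - lam
      have p : 0 < 1 - lam / 2 * u := by nlinarith
      have q1 : (1 - u') * (1 - lam / 2 * u) = (1 + lam / 2) * (1 - u) := by linear_combination -h3
      have q2 : (1 + u') * (1 - lam / 2 * u) = (1 - lam / 2) * (1 + u) := by linear_combination h3
      have hu' : u' < 1 := by
        by_contra hc; push Not at hc
        have : 0 < (1 + lam / 2) * (1 - u) := by apply mul_pos <;> linarith
        nlinarith
      have h4 := ih n' (by omega) h2 hu'
      have h5 : κ ^ i * ((1 - u') * (1 - lam / 2 * u)) ≤ (1 + u') * (1 - lam / 2 * u) := by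
        rw [← mul_assoc]; exact mul_le_mul_of_nonneg_right h4 p.le
      rw [q1, q2, ← hκm] at h5
      have h6 : (1 - lam / 2) * (κ ^ (i + 1) * (1 - u)) ≤ (1 - lam / 2) * (1 + u) := by
        calc _ = κ ^ i * (κ * (1 - lam / 2) * (1 - u)) := by ring
          _ ≤ _ := h5
      exact le_of_mul_le_mul_left h6 (by linarith)
  obtain ⟨i, hi⟩ := pow_unbounded_of_one_lt ((1 + (a n - lam)) / (1 - (a n - lam))) hκ1
  rw [div_lt_iff₀ (by linarith)] at hi
  linarith [key i n hN hd hu]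

lemma even_big (hs : SFacts (2 * (k + 2)) lam s) (B : RBad lam α 2 t v a d N)
    {n : ℕ} (hN : N < n) (hd : d n ≠ 1) : lam * (a n - lam) < 2 := by
  by_contra hu
  push Not at hu
  obtain ⟨e3, e1, e0, e2, hl⟩ := even_vals hs
  obtain ⟨d2, u1, u2⟩ := even_d2 hs B hN hd
  have e := B.neg (evenq_neg B hN)
  have S := B.stp n
  have ht := S.ht
  have hv := B.vneg e
  have hb := B.bn n hN.le e
  rw [d2] at ht hv
  push_cast at ht hv
  have v1 := B.v1 n
  have l1 := B.par.l1
  have l2 := B.par.l2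
  set u := a n - lam with hudef
  have u3 : u < 3 - lam := by linarith
  rcases Nat.eq_zero_or_pos k with rfl | hk
  · rw [hs.zero] at e0
    have : lam ^ 2 / 2 - 1 = 0 := by
      rcases mul_eq_zero.1 e0.symm with h | h
      · exact h
      · linarith
    nlinarith
  obtain ⟨j, rfl⟩ : ∃ j, k = j + 1 := ⟨k - 1, by omega⟩
  have g : ∀ z, rlin s z (j + 1) = s (j + 3) * (lam / 2 - (lam ^ 2 / 2 - 1) * z) := by
    intro z
    simp only [rlin]; rw [e1, e0]; ring
  have g0 : ∀ z, rlin s z j = lam * rlin s z (j + 1) - s (j + 3) * (1 - lam / 2 * z) := by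
    intro z
    have := rlin_rec hs z j
    have h2 : rlin s z (j + 2) = s (j + 3) * (1 - lam / 2 * z) := by
      simp only [rlin]
      have e1' : s (j + 2) = lam / 2 * s (j + 3) := e1
      rw [show j + 2 + 1 = j + 3 by ring, e1']; ring
    linarith
  have xp : 0 < rlin s u (j + 1) := by
    rw [g]
    apply mul_pos
    · have : s (j + 1 + 2) = s (j + 3) := rfl
      linarith
    · have h1 : (lam ^ 2 - 2) * u ≤ (lam ^ 2 - 2) * (3 - lam) := by
        apply mul_le_mul_of_nonneg_left u3.le; linarith
      have h2 : 0 < (2 - lam) * (3 + lam - lam ^ 2) := by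
        apply mul_pos <;> nlinarith
      nlinarith
  have hw : v n - lam ≤ 0 := by linarith
  obtain ⟨f1, f2⟩ := B.follow hs (n := n) (u := u) (w := v n - lam) hw (by linarith)
    (by rw [← hv]; ring) (k := j + 1) (by omega) xp j (by omega)
  have tn := evenq_neg B (n := n + 1 + j) (by omega)
  have e' := B.neg tn
  set M := n + 1 + j with hM
  have ea : a M * rlin s u (j + 1) = rlin s u j := by
    have : t M * a M * rlin s u j = -(a M * rlin s u (j + 1)) := by
      linear_combination (a M) * f1
    rw [e'] at this; linarith
  have sp : 0 < s (j + 3) := by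
    have : s (j + 1 + 2) = s (j + 3) := rfl
    linarith
  have aM : lam ≤ a M := by
    have : (a M - lam) * rlin s u (j + 1) = s (j + 3) * (lam / 2 * u - 1) := by
      rw [g0] at ea; linear_combination ea
    by_contra hc; push Not at hc
    have h1 : 0 ≤ s (j + 3) * (lam / 2 * u - 1) := by
      apply mul_nonneg sp.le; linarith
    nlinarith
  have hd' := even_isev B (n := M) (by omega) aM
  refine even_no_small hs B (n := M) (by omega) hd' ?_
  have hb' := B.bn M (by omega) e'
  have vM : v M ≤ lam - 1 := by
    set w := v n - lam with hwd
    have yp : 0 < rlin s w (j + 1) := rlin_pos' hs hw _ (by omega)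
    rw [g0] at f2
    have h1 : (lam - 1 - v M) * rlin s w (j + 1) = s (j + 3) * ((1 - lam / 2) * (1 - (1 + lam) * w)) := by
      have := g w
      linear_combination -f2 - this
    have h2 : 0 ≤ s (j + 3) * ((1 - lam / 2) * (1 - (1 + lam) * w)) := by
      apply mul_nonneg sp.le
      apply mul_nonneg <;> nlinarith
    rw [← h1] at h2
    have := nonneg_of_mul_nonneg_left h2 yp
    linarith
  linarith

theorem even_contra (hs : SFacts (2 * (k + 2)) lam s) (B : RBad lam α 2 t v a d N)
    (hi : ∀ n, EInv s k (t n) (v n)) : False := by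
  have l1 := B.par.l1
  have l2 := B.par.l2
  have ev : ∀ n, N < n → d n ≠ 1 → 1 < a n - lam := by
    intro n hN hd
    by_contra hu
    push Not at hu
    have tn := evenq_neg B hN
    have e := B.neg tn
    have hv := even_end hs l2 (hi n).2.2 tn (by nlinarith)
    exact even_no_small hs B hN hd (by linarith [B.bn n hN.le e])
  obtain ⟨n, hN, hd⟩ := B.event hs (by omega) (N + 1)
  have hd : d n ≠ 1 := fun h => hd ⟨B.neg (evenq_neg B (by omega)), h⟩
  set κ := (1 + lam / 2) / (1 - lam / 2) with hκ
  have hκ1 : 1 < κ := by rw [hκ, lt_div_iff₀ (by linarith)]; linarith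
  have hκm : κ * (1 - lam / 2) = 1 + lam / 2 := by
    exact div_mul_cancel₀ _ (by linarith)
  have key : ∀ i : ℕ, ∀ n, N < n → d n ≠ 1 →
      κ ^ i * ((a n - lam) - 1) ≤ 1 + (a n - lam) := by
    intro i
    induction i with
    | zero =>
      intro n hN hd
      simp; linarith
    | succ i ih =>
      intro n hN hd
      have hu := ev n hN hd
      have hb := even_big hs B hN hd
      obtain ⟨n', h1, h2, h3⟩ := even_next hs B hN hd hb
      set u := a n - lam
      set u' := a n' - lam
      have p : 0 < 1 - lam / 2 * u := by nlinarith
      have q1 : (u' - 1) * (1 - lam / 2 * u) = (1 + lam / 2) * (u - 1) := by linear_combination h3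
      have q2 : (1 + u') * (1 - lam / 2 * u) = (1 - lam / 2) * (1 + u) := by linear_combination h3
      have h4 := ih n' (by omega) h2
      have h5 : κ ^ i * ((u' - 1) * (1 - lam / 2 * u)) ≤ (1 + u') * (1 - lam / 2 * u) := by
        rw [← mul_assoc]; exact mul_le_mul_of_nonneg_right h4 p.le
      rw [q1, q2, ← hκm] at h5
      have h6 : (1 - lam / 2) * (κ ^ (i + 1) * (u - 1)) ≤ (1 - lam / 2) * (1 + u) := by
        calc _ = κ ^ i * (κ * (1 - lam / 2) * (u - 1)) := by ring
          _ ≤ _ := h5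
      exact le_of_mul_le_mul_left h6 (by linarith)
  have hu := ev n (by omega) hd
  obtain ⟨i, hi⟩ := pow_unbounded_of_one_lt ((1 + (a n - lam)) / ((a n - lam) - 1)) hκ1
  rw [div_lt_iff₀ (by linarith)] at hi
  linarith [key i n (by omega) hd]

end


section
variable {lam α P r : ℝ} {t v a : ℕ → ℝ} {d : ℕ → ℤ} {N : ℕ} {s : ℕ → ℝ} {k : ℕ}

/-- Events of the odd case. -/
def OEv (lam : ℝ) (t v a : ℕ → ℝ) (d : ℕ → ℤ) (n : ℕ) (u w : ℝ) : Prop :=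
  (t n * a n = -1 ∧ d n = 2 ∧ u = a n - lam ∧ w = v n - lam) ∨
  (t n * a n = 1 ∧ d n = 1 ∧ u = a n ∧ w = - v n)

lemma odd_pos (g : RGold lam P r) (B : RBad lam α (P + r) t v a d N) {n : ℕ} (hN : N < n)
    (ht : t n * a n = 1) : 1 < a n ∧ a n < P ∧ r < t n := by
  obtain ⟨n, rfl⟩ : ∃ i, n = i + 1 := ⟨n - 1, by omega⟩
  obtain ⟨g1, g2, g3, g4, g5, g6, g7⟩ := g.facts B.par.l1 B.par.l2
  have S := B.stp (n + 1)
  have tp := S.tpos ht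
  have h1 := B.pos (by omega) tp
  have h2 := S.a_lo1 B.par ht
  have ap := S.apos
  have gm := g.mul
  have rp := g.rpos
  have h3 : (a (n + 1) - r) * (P - a (n + 1)) > 0 := by nlinarith
  have h4 : a (n + 1) < P := by
    by_contra hc; push Not at hc
    nlinarith [mul_nonneg (by linarith : 0 ≤ a (n + 1) - r) (by linarith : 0 ≤ a (n + 1) - P)]
  refine ⟨h2, h4, ?_⟩
  by_contra hc; push Not at hc
  nlinarith

lemma odd_class (g : RGold lam P r) (hs : SFacts (2 * (k + 2) + 1) lam s)
    (B : RBad lam α (P + r) t v a d N) {n : ℕ} (hN : N < n)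
    (hd : ¬ (t n * a n = -1 ∧ d n = 1)) : ∃ u w, OEv lam t v a d n u w := by
  have l1 := B.par.l1
  have l2 := B.par.l2
  obtain ⟨g1, g2, g3, g4, g5, g6, g7⟩ := g.facts l1 l2
  obtain ⟨e3, e1, e0, e2, hl, hl'⟩ := odd_vals hs l1
  have S := B.stp n
  have lo := S.lo'
  have ht := S.ht
  have a1 := B.par.a1
  rcases B.sg n with h | h
  · obtain ⟨p1, p2, p3⟩ := odd_pos g B hN h
    rcases S.cases with hd | hd
    · exact ⟨_, _, Or.inr ⟨h, hd, rfl, rfl⟩⟩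
    · exfalso
      have : (2 : ℤ) ≤ d n := by omega
      have : (2 : ℝ) ≤ d n := by exact_mod_cast this
      nlinarith
  · have b := B.bn n hN.le h
    have v1 := B.v1 n
    rcases S.cases with hd' | hd' | hd'
    · exact absurd ⟨h, hd'⟩ hd
    · exact ⟨_, _, Or.inl ⟨h, hd', rfl, rfl⟩⟩
    · exfalso
      have : (3 : ℝ) ≤ d n := by exact_mod_cast hd'
      nlinarith

lemma odd_props (g : RGold lam P r) (hs : SFacts (2 * (k + 2) + 1) lam s)
    (B : RBad lam α (P + r) t v a d N) {n : ℕ} (hN : N < n) {u w : ℝ}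
    (h : OEv lam t v a d n u w) :
    t (n + 1) = u - lam ∧ v (n + 1) * (lam - w) = 1 ∧ w ≤ 0 ∧ u - w < P + r ∧ lam / 2 ≤ u ∧
    (lam - 1) * u < 1 := by
  have l1 := B.par.l1
  have l2 := B.par.l2
  obtain ⟨g1, g2, g3, g4, g5, g6, g7⟩ := g.facts l1 l2
  obtain ⟨e3, e1, e0, e2, hl, hl'⟩ := odd_vals hs l1
  have S := B.stp n
  have lo := S.lo'
  have ht := S.ht
  have a1 := B.par.a1
  have v1 := B.v1 n
  have v0 := B.v0 n
  rcases h with ⟨h1, h2, rfl, rfl⟩ | ⟨h1, h2, rfl, rfl⟩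
  · have b := B.bn n hN.le h1
    have ev := B.vneg h1
    rw [h2] at ht ev
    push_cast at ht ev
    refine ⟨by linarith, by rw [← ev]; ring, by linarith, by linarith, by nlinarith, ?_⟩
    have h3 : a n - lam < 1 + (2 - lam) + (2 - lam) ^ 2 / 4 := by linarith
    have h4 : 0 < lam - 1 := by linarith
    have h5 : (lam - 1) * (a n - lam) < (lam - 1) * (1 + (2 - lam) + (2 - lam) ^ 2 / 4) :=
      mul_lt_mul_of_pos_left h3 h4
    have h6 : (lam - 1) * (1 + (2 - lam) + (2 - lam) ^ 2 / 4)
      = 1 - (2 - lam) ^ 2 * (3 / 4 + (2 - lam) / 4) := by ring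
    have h7 : 0 ≤ (2 - lam) ^ 2 * (3 / 4 + (2 - lam) / 4) := by
      apply mul_nonneg (sq_nonneg _); linarith
    linarith
  · have b := B.bp n hN.le h1
    have ev := B.vpos h1
    obtain ⟨p1, p2, p3⟩ := odd_pos g B hN h1
    rw [h2] at ht ev
    push_cast at ht ev
    refine ⟨by linarith, by rw [← ev]; ring, by linarith, by linarith, by linarith, ?_⟩
    nlinarith

lemma odd_A (g : RGold lam P r) (hs : SFacts (2 * (k + 2) + 1) lam s)
    (B : RBad lam α (P + r) t v a d N) {n : ℕ} (hN : N < n) {u w : ℝ}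
    (h : OEv lam t v a d n u w) (hu : u < 1) :
    ∃ n' u' w', n < n' ∧ OEv lam t v a d n' u' w' ∧ u' * (1 - u) = u - (lam - 1) ∧ 1 ≤ u' := by
  have l1 := B.par.l1
  have l2 := B.par.l2
  obtain ⟨e3, e1, e0, e2, hl, hl'⟩ := odd_vals hs l1
  obtain ⟨p1, p2, p3, p4, p5, p6⟩ := odd_props g hs B hN h
  have xk : rlin s u (k + 2) = s (k + 2) * (1 - u) := by
    simp only [rlin]; rw [show k + 2 + 1 = k + 3 by ring, e3]; ring
  have xk0 : rlin s u (k + 1) = s (k + 2) * (1 - (lam - 1) * u) := by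
    simp only [rlin]; rw [show k + 1 + 1 = k + 2 by ring, e1]; ring
  have xp : 0 < rlin s u (k + 2) := by rw [xk]; apply mul_pos <;> linarith
  have xp0 : 0 < rlin s u (k + 1) := by rw [xk0]; apply mul_pos <;> linarith
  obtain ⟨f1, f2⟩ := B.follow hs p3 p1 p2 (k := k + 2) (by omega) xp (k + 1) (by omega)
  set M := n + 1 + (k + 1) with hM
  rw [show k + 1 + 1 = k + 2 by ring] at f1
  have tn : t M < 0 := by
    by_contra hc; push Not at hc
    nlinarith [mul_nonneg hc xp0.le]
  have e' := B.neg tn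
  have ea : a M * rlin s u (k + 2) = rlin s u (k + 1) := by
    have : t M * a M * rlin s u (k + 1) = -(a M * rlin s u (k + 2)) := by
      linear_combination (a M) * f1
    rw [e'] at this; linarith
  have key : (a M - lam) * (1 - u) = u - (lam - 1) := by
    rw [xk, xk0] at ea
    have h1 : s (k + 2) * (a M * (1 - u) - (1 - (lam - 1) * u)) = 0 := by
      linear_combination ea
    rcases mul_eq_zero.1 h1 with h1 | h1
    · linarith
    · linear_combination h1
  have y1 : 1 ≤ a M - lam := by
    by_contra hc; push Not at hc
    nlinarith
  have hd : ¬ (t M * a M = -1 ∧ d M = 1) := by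
    rintro ⟨_, hd⟩
    have ht := (B.stp M).ht
    have hi := (B.stp M).hi'
    rw [hd] at ht; push_cast at ht
    linarith [B.par.a2]
  obtain ⟨u', w', hev⟩ := odd_class g hs B (n := M) (by omega) hd
  have hu' : u' = a M - lam := by
    rcases hev with ⟨_, _, h1, _⟩ | ⟨h1, _⟩
    · exact h1
    · linarith
  exact ⟨M, u', w', by omega, hev, by rw [hu']; exact key, by rw [hu']; exact y1⟩

lemma odd_aux {w : ℝ} (h1 : 8 / 5 < lam) (h2 : lam < 2) (hw : lam - 1 ≤ -w)
    (h5 : 1 - w < (1 + (2 - lam) ^ 2 / 4) * (1 - (lam - 1) * w)) : False := by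
  obtain ⟨ε, rfl⟩ : ∃ ε, lam = 2 - ε := ⟨2 - lam, by ring⟩
  have ε0 : 0 < ε := by linarith
  have ε1 : ε < 2 / 5 := by linarith
  have p2 := pow_pos ε0 2
  have h6 : (-w) * (1 - (1 + ε ^ 2 / 4) * (1 - ε)) < ε ^ 2 / 4 := by
    ring_nf at h5 ⊢; linarith
  have e : 1 - (1 + ε ^ 2 / 4) * (1 - ε) = ε * (1 - ε / 4 + ε ^ 2 / 4) := by ring
  rw [e] at h6
  have c0 : 0 < ε * (1 - ε / 4 + ε ^ 2 / 4) := by apply mul_pos ε0; linarith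
  have h7 := mul_le_mul_of_nonneg_right hw c0.le
  have h8 : ε * ((1 - ε) * (1 - ε / 4 + ε ^ 2 / 4) - ε / 4) < ε * 0 := by
    ring_nf at h6 h7 ⊢; linarith
  have h9 := lt_of_mul_lt_mul_left h8 ε0.le
  have h10 : 3 / 5 * (9 / 10) ≤ (1 - ε) * (1 - ε / 4 + ε ^ 2 / 4) := by
    apply mul_le_mul <;> linarith
  linarith

set_option maxHeartbeats 1000000 in
lemma odd_B (g : RGold lam P r) (hs : SFacts (2 * (k + 2) + 1) lam s)
    (B : RBad lam α (P + r) t v a d N) {n : ℕ} (hN : N < n) {u w : ℝ}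
    (h : OEv lam t v a d n u w) (hu : 1 ≤ u) :
    u ≠ 1 ∧ ∃ n' u' w', n < n' ∧ OEv lam t v a d n' u' w' ∧
     ((t n' * a n' = 1 ∧ 1 < u' ∧ u' * (u - 1) = 1 - (lam - 1) * u) ∨
      (0 < u' ∧ u' < 1 ∧ u' * (1 - (lam - 1) * u) = u - 1)) := by
  have l1 := B.par.l1
  have l2 := B.par.l2
  obtain ⟨g1, g2, g3, g4, g5, g6, g7⟩ := g.facts l1 l2
  obtain ⟨e3, e1, e0, e2, hl, hl'⟩ := odd_vals hs l1
  obtain ⟨p1, p2, p3, p4, p5, p6⟩ := odd_props g hs B hN h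
  have xk : ∀ u, rlin s u (k + 1) = s (k + 2) * (1 - (lam - 1) * u) := by
    intro u; simp only [rlin]; rw [show k + 1 + 1 = k + 2 by ring, e1]; ring
  have xk0 : ∀ u, rlin s u k = s (k + 2) * ((lam - 1) - (lam ^ 2 - lam - 1) * u) := by
    intro u; simp only [rlin]; rw [e1, e0]; ring
  have xp : 0 < rlin s u (k + 1) := by rw [xk]; apply mul_pos <;> linarith
  have xp0 : 0 < rlin s u k := rlin_pos hs (by omega) xp k (by omega)
  obtain ⟨f1, f2⟩ := B.follow hs p3 p1 p2 (k := k + 1) (by omega) xp k (by omega)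
  set M := n + 1 + k with hM
  have tn : t M < 0 := by
    by_contra hc; push Not at hc
    nlinarith [mul_nonneg hc xp0.le]
  have e' := B.neg tn
  have ea : a M * rlin s u (k + 1) = rlin s u k := by
    have : t M * a M * rlin s u k = -(a M * rlin s u (k + 1)) := by
      linear_combination (a M) * f1
    rw [e'] at this; linarith
  have key : (a M - lam) * (1 - (lam - 1) * u) = u - 1 := by
    rw [xk, xk0] at ea
    have h1 : s (k + 2) * (a M * (1 - (lam - 1) * u) - ((lam - 1) - (lam ^ 2 - lam - 1) * u)) = 0 := by
      linear_combination ea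
    rcases mul_eq_zero.1 h1 with h1 | h1
    · linarith
    · linear_combination h1
  have keyv : (v M - lam) * (1 - (lam - 1) * w) = w - 1 := by
    rw [xk, xk0] at f2
    have h1 : s (k + 2) * (v M * (1 - (lam - 1) * w) - ((lam - 1) - (lam ^ 2 - lam - 1) * w)) = 0 := by
      linear_combination f2
    rcases mul_eq_zero.1 h1 with h1 | h1
    · linarith
    · linear_combination h1
  have S := B.stp M
  have ht := S.ht
  have lo := S.lo'
  have pp : 0 < 1 - (lam - 1) * u := by linarith
  have hne : u ≠ 1 := by
    intro h1
    rw [h1] at key pp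
    have h2 : a M = lam := by
      have : (a M - lam) * (1 - (lam - 1) * 1) = 0 := by linarith
      rcases mul_eq_zero.1 this with h | h
      · linarith
      · linarith
    rcases S.cases with hd | hd
    · rw [hd, h2] at ht; push_cast at ht
      exact B.ne (M + 1) (by linarith)
    · have : (2 : ℤ) ≤ d M := by omega
      have : (2 : ℝ) ≤ d M := by exact_mod_cast this
      have := B.par.a1
      nlinarith
  have hu1 : 1 < u := lt_of_le_of_ne hu hne.symm
  have y0 : 0 < a M - lam := by
    by_contra hc; push Not at hc
    nlinarith
  have y1 : a M - lam < 1 := by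
    rcases h with ⟨h1, h2, h3, h4⟩ | ⟨h1, h2, h3, h4⟩
    · by_contra hc; push Not at hc
      have b := B.bn M (by omega) e'
      have v1 := B.v1 n
      have hw : lam - 1 ≤ -w := by linarith
      have z : lam - v M < 1 + (2 - lam) ^ 2 / 4 := by linarith
      have hq : 0 < 1 - (lam - 1) * w := by nlinarith
      have h5 : 1 - w < (1 + (2 - lam) ^ 2 / 4) * (1 - (lam - 1) * w) := by
        have := mul_lt_mul_of_pos_right z hq
        linarith
      exact odd_aux hl' l2 hw h5
    · obtain ⟨q1, q2, q3⟩ := odd_pos g B hN h1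
      have gm := g.mul
      have : lam * u < 2 := by
        rw [h3]
        have := g.rpos
        nlinarith
      by_contra hc; push Not at hc
      nlinarith
  refine ⟨hne, ?_⟩
  by_cases hd : d M = 1
  · rw [hd] at ht; push_cast at ht
    have tp : 0 < t (M + 1) := by linarith
    have e2 := B.pos' tp
    obtain ⟨u', w', hev⟩ := odd_class g hs B (n := M + 1) (by omega) (by rintro ⟨h, _⟩; linarith)
    have hu' : u' = a (M + 1) := by
      rcases hev with ⟨h1, _⟩ | ⟨_, _, h1, _⟩
      · linarith
      · exact h1
    obtain ⟨q1, q2, q3⟩ := odd_pos g B (n := M + 1) (by omega) e2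
    refine ⟨M + 1, u', w', by omega, hev, Or.inl ⟨e2, by rw [hu']; exact q1, ?_⟩⟩
    rw [← key, hu', show a M - lam = t (M + 1) by linarith, ← mul_assoc, mul_comm (a (M + 1)), e2]
    ring
  · obtain ⟨u', w', hev⟩ := odd_class g hs B (n := M) (by omega) (by rintro ⟨_, h⟩; exact hd h)
    have hu' : u' = a M - lam := by
      rcases hev with ⟨_, _, h1, _⟩ | ⟨h1, _⟩
      · exact h1
      · linarith
    refine ⟨M, u', w', by omega, hev, Or.inr ?_⟩
    rw [hu']
    exact ⟨y0, y1, key⟩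

/-- normalised event parameter -/
def OY (lam : ℝ) (t v a : ℕ → ℝ) (d : ℕ → ℤ) (n : ℕ) (Y : ℝ) : Prop :=
  ∃ u w, OEv lam t v a d n u w ∧ 1 < Y ∧ (Y * u = 1 ∨ Y = u)

lemma odd_Y (g : RGold lam P r) (hs : SFacts (2 * (k + 2) + 1) lam s)
    (B : RBad lam α (P + r) t v a d N) {n : ℕ} (hN : N < n) {Y : ℝ} (h : OY lam t v a d n Y) :
    ∃ n' Y', n < n' ∧ OY lam t v a d n' Y' ∧ Y' * (Y - 1) = 1 - (lam - 1) * Y := by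
  obtain ⟨u, w, hev, hY, hu | hu⟩ := h
  · have u1 : u < 1 := by
      by_contra hc; push Not at hc
      nlinarith
    obtain ⟨n', u', w', h1, h2, h3, h4⟩ := odd_A g hs B hN hev u1
    have h5 := (odd_B g hs B (n := n') (by omega) h2 h4).1
    refine ⟨n', u', h1, ⟨u', w', h2, lt_of_le_of_ne h4 h5.symm, Or.inr rfl⟩, ?_⟩
    have : Y * (u' * (1 - u)) = Y * (u - (lam - 1)) := by rw [h3]
    linear_combination this + (1 + u') * hu
  · subst hu
    obtain ⟨h1, n', u', w', h2, h3, h4 | h4⟩ := odd_B g hs B hN hev hY.le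
    · exact ⟨n', u', h2, ⟨u', w', h3, h4.2.1, Or.inr rfl⟩, h4.2.2⟩
    · refine ⟨n', u'⁻¹, h2, ⟨u', w', h3, (one_lt_inv₀ h4.1).2 h4.2.1, Or.inl ?_⟩, ?_⟩
      · exact inv_mul_cancel₀ h4.1.ne'
      · rw [← h4.2.2, ← mul_assoc, inv_mul_cancel₀ h4.1.ne']; ring

lemma odd_YP (g : RGold lam P r) (hs : SFacts (2 * (k + 2) + 1) lam s)
    (B : RBad lam α (P + r) t v a d N) {n : ℕ} (hN : N < n) {Y : ℝ} (h : OY lam t v a d n Y) :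
    Y = P := by
  have l1 := B.par.l1
  have l2 := B.par.l2
  obtain ⟨g1, g2, g3, g4, g5, g6, g7⟩ := g.facts l1 l2
  have gm := g.mul
  have gs := g.sub
  have rp := g.rpos
  set κ := (1 + r) / (P - 1) with hκ
  have hκ1 : 1 < κ := by rw [hκ, lt_div_iff₀ (by linarith)]; linarith
  have hκm : κ * (P - 1) = 1 + r := div_mul_cancel₀ _ (by linarith)
  have κ0 : 0 < κ := by linarith
  have key : ∀ i : ℕ, ∀ n Y, N < n → OY lam t v a d n Y → κ ^ i * |Y - P| ≤ Y + r := by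
    intro i
    induction i with
    | zero =>
      intro n Y hN hY
      obtain ⟨_, _, _, hY, _⟩ := hY
      rw [pow_zero, one_mul, abs_le]; constructor <;> linarith
    | succ i ih =>
      intro n Y hN hY
      obtain ⟨n', Y', h1, h2, h3⟩ := odd_Y g hs B hN hY
      have h4 := ih n' Y' (by omega) h2
      obtain ⟨_, _, _, hY1, _⟩ := hY
      have q1 : (Y' - P) * (Y - 1) = -((1 + r) * (Y - P)) := by linear_combination h3 - Y * gs - gm
      have q2 : (Y' + r) * (Y - 1) = (P - 1) * (Y + r) := by linear_combination h3 - Y * gs - gm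
      have q1' : |Y' - P| * (Y - 1) = (1 + r) * |Y - P| := by
        have e1 : |(Y' - P) * (Y - 1)| = |Y' - P| * (Y - 1) := by
          rw [abs_mul, abs_of_pos (by linarith : 0 < Y - 1)]
        rw [← e1, q1, abs_neg, abs_mul, abs_of_pos (by linarith : 0 < 1 + r)]
      have h5 : κ ^ i * (|Y' - P| * (Y - 1)) ≤ (Y' + r) * (Y - 1) := by
        rw [← mul_assoc]; exact mul_le_mul_of_nonneg_right h4 (by linarith)
      rw [q1', q2, ← hκm] at h5
      have h6 : (P - 1) * (κ ^ (i + 1) * |Y - P|) ≤ (P - 1) * (Y + r) := by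
        calc _ = κ ^ i * (κ * (P - 1) * |Y - P|) := by ring
          _ ≤ _ := h5
      exact le_of_mul_le_mul_left h6 (by linarith)
  by_contra hne
  have hpos : 0 < |Y - P| := abs_pos.2 (sub_ne_zero.2 hne)
  obtain ⟨i, hi⟩ := pow_unbounded_of_one_lt ((Y + r) / |Y - P|) hκ1
  rw [div_lt_iff₀ hpos] at hi
  linarith [key i n Y hN h]

lemma odd_exY (g : RGold lam P r) (hs : SFacts (2 * (k + 2) + 1) lam s)
    (B : RBad lam α (P + r) t v a d N) {n : ℕ} (hN : N < n) {u w : ℝ}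
    (h : OEv lam t v a d n u w) : u = P ∨ u = r := by
  have l1 := B.par.l1
  have gm := g.mul
  obtain ⟨p1, p2, p3, p4, p5, p6⟩ := odd_props g hs B hN h
  have u0 : 0 < u := by linarith
  rcases lt_or_ge u 1 with hu | hu
  · right
    have := odd_YP g hs B hN (Y := u⁻¹) ⟨u, w, h, (one_lt_inv₀ u0).2 hu, Or.inl (inv_mul_cancel₀ u0.ne')⟩
    rw [← this] at gm
    field_simp at gm
    linarith
  · left
    have := (odd_B g hs B hN h hu).1
    exact odd_YP g hs B hN ⟨u, w, h, lt_of_le_of_ne hu this.symm, Or.inr rfl⟩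

theorem odd_contra1 (g : RGold lam P r) (hs : SFacts (2 * (k + 2) + 1) lam s)
    (B : RBad lam α (P + r) t v a d N) (hr : α * lam ≤ r)
    (hi : ∀ n, OInv P r s k (t n) (v n)) : False := by
  have l1 := B.par.l1
  have l2 := B.par.l2
  obtain ⟨n, hN, hd⟩ := B.event hs (by omega) (N + 1)
  obtain ⟨u, w, h⟩ := odd_class g hs B (n := n) (by omega) hd
  have hu := odd_exY g hs B (n := n) (by omega) h
  obtain ⟨_, _, c1, c2⟩ := hi n
  rcases h with ⟨h1, h2, h3, h4⟩ | ⟨h1, h2, h3, h4⟩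
  · have tn := (B.stp n).tneg h1
    have b := B.bn n (by omega) h1
    rcases hu with hu | hu
    · have := odd_end1 g hs l1 l2 c1 tn (by rw [show lam + P = a n by linarith]; linarith)
      linarith
    · have := odd_end2 g hs l1 l2 c2 tn (by rw [show lam + r = a n by linarith]; linarith)
      linarith
  · have := odd_pos g B (n := n) (by omega) h1
    linarith [(B.stp n).hi]

theorem odd_contra2 (g : RGold lam P r) (hs : SFacts (2 * (k + 2) + 1) lam s)
    (B : RBad lam α (P + r) t v a d N) (hr : r < α * lam) : False := by
  have l1 := B.par.l1
  have l2 := B.par.l2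
  obtain ⟨g1, g2, g3, g4, g5, g6, g7⟩ := g.facts l1 l2
  have key : ∀ n u w, N < n → OEv lam t v a d n u w → t n * a n = -1 ∧ u = P := by
    intro n u w hN h
    have hu := odd_exY g hs B hN h
    rcases h with ⟨h1, h2, h3, h4⟩ | ⟨h1, h2, h3, h4⟩
    · refine ⟨h1, ?_⟩
      rcases hu with hu | hu
      · exact hu
      · have lo := (B.stp n).lo'
        have ht := (B.stp n).ht
        rw [h2] at ht; push_cast at ht
        nlinarith
    · have := odd_pos g B hN h1
      rcases hu with hu | hu <;> linarith
  obtain ⟨n, hN, hd⟩ := B.event hs (by omega) (N + 1)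
  obtain ⟨u, w, h⟩ := odd_class g hs B (n := n) (by omega) hd
  have h1 := key n u w (by omega) h
  obtain ⟨_, n', u', w', h2, h3, h4⟩ := odd_B g hs B (n := n) (by omega) h (by linarith)
  have h5 := key n' u' w' (by omega) h3
  rcases h4 with h4 | h4 <;> linarith

/-- the case `q = 3` -/
theorem three_contra (g : RGold 1 P r) (B : RBad 1 α (P + r) t v a d N)
    (hi : α ≤ r → ∀ n, TInv r (t n) (v n)) : False := by
  have gm := g.mul
  have gs := g.sub
  have rp := g.rpos
  obtain ⟨g1, g2, g3, g4, g5, g6, g7⟩ := g.facts le_rfl (by norm_num)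
  have a1 := B.par.a1
  have a2 := B.par.a2
  have hP : P = 1 + r := by linarith
  have r1 : r < 5 / 8 := by nlinarith
  have r2 : 3 / 5 < r := by nlinarith
  have neg : ∀ n, N < n → t n * a n = -1 := by
    intro n hN
    rcases B.sg n with h | h
    · exfalso
      have h1 := odd_pos g B hN h
      have ht := (B.stp n).ht
      have lo := (B.stp n).lo'
      rcases (B.stp n).cases with hd | hd
      · rw [hd] at ht; push_cast at ht
        have tp : 0 < t (n + 1) := by linarith
        have := odd_pos g B (n := n + 1) (by omega) (B.pos' tp)
        linarith
      · have : (2 : ℤ) ≤ d n := by omega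
        have : (2 : ℝ) ≤ d n := by exact_mod_cast this
        linarith [(B.stp n).hi]
    · exact h
  have dig : ∀ n, N < n → d n = 3 := by
    intro n hN
    have S := B.stp n
    have e := neg n hN
    have aa := S.a_lo2 B.par e
    have ht := S.ht
    have hi' := S.hi'
    have lo' := S.lo'
    rcases S.cases with hd | hd | hd
    · exfalso; rw [hd] at ht; push_cast at ht; linarith
    · exfalso; rw [hd] at ht; push_cast at ht
      have := (B.stp (n + 1)).tneg (neg (n + 1) (by omega))
      linarith
    · by_contra hne
      have : (4 : ℤ) ≤ d n := by omega
      have : (4 : ℝ) ≤ d n := by exact_mod_cast this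
      have b := B.bn n hN.le e
      have v1 := B.v1 n
      linarith
  set κ := (2 + r) / (1 - r) with hκ
  have hκ1 : 1 < κ := by rw [hκ, lt_div_iff₀ (by linarith)]; linarith
  have hκm : κ * (1 - r) = 2 + r := div_mul_cancel₀ _ (by linarith)
  have hr : r * (1 + r) = 1 := by rw [← hP]; linarith
  have key : ∀ i : ℕ, ∀ n, N < n → κ ^ i * |a n - (2 + r)| ≤ a n - (1 - r) := by
    intro i
    induction i with
    | zero =>
      intro n hN
      have aa := (B.stp n).a_lo2 B.par (neg n hN)
      rw [pow_zero, one_mul, abs_le]; constructor <;> linarith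
    | succ i ih =>
      intro n hN
      have h4 := ih (n + 1) (by omega)
      have e' := neg (n + 1) (by omega)
      have ht := (B.stp n).ht
      rw [dig n hN] at ht
      push_cast at ht
      have h3 : a (n + 1) * (3 - a n) = 1 := by rw [ht] at e'; linarith
      have ap := (B.stp (n + 1)).apos
      have hp : 0 < 3 - a n := by
        by_contra hc; push Not at hc
        nlinarith
      have q1 : (a (n + 1) - (2 + r)) * (3 - a n) = (2 + r) * (a n - (2 + r)) := by
        linear_combination h3 + hr
      have q2 : (a (n + 1) - (1 - r)) * (3 - a n) = (1 - r) * (a n - (1 - r)) := by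
        linear_combination h3 + hr
      have q1' : |a (n + 1) - (2 + r)| * (3 - a n) = (2 + r) * |a n - (2 + r)| := by
        have e1 : |(a (n + 1) - (2 + r)) * (3 - a n)| = |a (n + 1) - (2 + r)| * (3 - a n) := by
          rw [abs_mul, abs_of_pos hp]
        rw [← e1, q1, abs_mul, abs_of_pos (by linarith : 0 < 2 + r)]
      have h5 : κ ^ i * (|a (n + 1) - (2 + r)| * (3 - a n)) ≤ (a (n + 1) - (1 - r)) * (3 - a n) := by
        rw [← mul_assoc]; exact mul_le_mul_of_nonneg_right h4 (by linarith)
      rw [q1', q2, ← hκm] at h5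
      have h6 : (1 - r) * (κ ^ (i + 1) * |a n - κ * (1 - r)|) ≤ (1 - r) * (a n - (1 - r)) := by
        calc _ = κ ^ i * (κ * (1 - r) * |a n - κ * (1 - r)|) := by ring
          _ ≤ _ := h5
      rw [hκm] at h6
      exact le_of_mul_le_mul_left h6 (by linarith)
  have fin : a (N + 1) = 2 + r := by
    by_contra hne
    have hpos : 0 < |a (N + 1) - (2 + r)| := abs_pos.2 (sub_ne_zero.2 hne)
    obtain ⟨i, hi⟩ := pow_unbounded_of_one_lt ((a (N + 1) - (1 - r)) / |a (N + 1) - (2 + r)|) hκ1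
    rw [div_lt_iff₀ hpos] at hi
    linarith [key i (N + 1) (by omega)]
  have e := neg (N + 1) (by omega)
  rcases le_or_gt α r with hα | hα
  · have b := B.bn (N + 1) (by omega) e
    have h1 := (hi hα (N + 1)).2.2 ((B.stp (N + 1)).tneg e) (by rw [← fin]; linarith)
    linarith
  · have ht := (B.stp (N + 1)).ht
    have lo' := (B.stp (N + 1)).lo'
    rw [dig (N + 1) (by omega)] at ht
    push_cast at ht
    linarith

end


section
variable {lam α : ℝ}

lemma rosenT_mem (hp : RPar lam α) {x : ℝ} :
    (α - 1) * lam ≤ rosenT lam α x ∧ rosenT lam α x < α * lam := by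
  have l1 := hp.l1
  have a1 := hp.a1
  have a2 := hp.a2
  have l0 : 0 < lam := by linarith
  unfold rosenT
  split_ifs with hx
  · constructor <;> nlinarith
  · have h1 : Real.sign x / x = lam * |1 / (lam * x)| := by
      rcases lt_or_gt_of_ne hx with h | h
      · rw [Real.sign_of_neg h, abs_of_neg]
        · field_simp
        · apply div_neg_of_pos_of_neg one_pos; nlinarith
      · rw [Real.sign_of_pos h, abs_of_pos (by positivity)]
        field_simp
    have h2 := Int.floor_le (|1 / (lam * x)| + 1 - α)
    have h3 := Int.lt_floor_add_one (|1 / (lam * x)| + 1 - α)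
    rw [h1]
    unfold rosenD
    constructor <;> nlinarith

lemma orbit_mem (hp : RPar lam α) {x : ℝ} (hx : x ∈ Set.Ico ((α - 1) * lam) (α * lam)) (n : ℕ) :
    (α - 1) * lam ≤ (rosenT lam α)^[n] x ∧ (rosenT lam α)^[n] x < α * lam := by
  cases n with
  | zero => exact hx
  | succ n => rw [Function.iterate_succ_apply']; exact rosenT_mem hp

lemma rosenD_pos (hp : RPar lam α) {x : ℝ} (h0 : x ≠ 0) (h1 : (α - 1) * lam ≤ x)
    (h2 : x < α * lam) : 1 ≤ rosenD lam α x := by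
  have l1 := hp.l1
  have a1 := hp.a1
  have a2 := hp.a2
  have l0 : 0 < lam := by linarith
  unfold rosenD
  rw [Int.le_floor]
  have hx : |x| ≤ α * lam := by rw [abs_le]; constructor <;> nlinarith
  have hx0 : 0 < |x| := abs_pos.2 h0
  have : α ≤ |1 / (lam * x)| := by
    rw [abs_div, abs_one, abs_mul, abs_of_pos l0, le_div_iff₀ (by positivity)]
    have : α * lam * |x| ≤ 1 * 1 := by
      apply mul_le_mul a2 (by linarith) hx0.le (by norm_num)
    linarith
  push_cast
  linarith

/-- steps of the orbit -/
lemma orbit_stp (hp : RPar lam α) {x v v' : ℝ} (h0 : x ≠ 0) (h1 : (α - 1) * lam ≤ x)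
    (h2 : x < α * lam)
    (hv : v' = 1 / (rosenD lam α x * lam + Real.sign x * v)) :
    RStp lam α x v (rosenD lam α x) (rosenT lam α x) v' (1 / |x|) := by
  have h3 := rosenT_mem hp (x := x)
  have hx0 : 0 < |x| := abs_pos.2 h0
  refine ⟨by positivity, h1, h2, h3.1, h3.2, rosenD_pos hp h0 h1 h2, ?_, ?_⟩
  · rw [rosenT, if_neg h0]
    rcases lt_or_gt_of_ne h0 with h | h
    · rw [Real.sign_of_neg h, abs_of_neg h, one_div, neg_div, one_div, inv_neg]; ring
    · rw [Real.sign_of_pos h, abs_of_pos h]; ring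
  · rcases lt_or_gt_of_ne h0 with h | h
    · right
      rw [Real.sign_of_neg h] at hv
      rw [abs_of_neg h, hv]
      constructor
      · field_simp
      · ring
    · left
      rw [Real.sign_of_pos h] at hv
      rw [abs_of_pos h, hv]
      constructor
      · field_simp
      · ring

lemma RStp.dneg {t v t' v' a : ℝ} {d : ℤ} (hp : RPar lam α) (h : RStp lam α t v d t' v' a)
    (v1 : v ≤ 1) (ha : t * a = -1) : 0 < d * lam - v := by
  have l1 := hp.l1
  rcases h.cases with hd | hd
  · have ht := h.ht
    have hi := h.hi'
    have a2 := hp.a2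
    have aa := h.a_lo2 hp ha
    rw [hd] at ht ⊢; push_cast at *
    rcases eq_or_lt_of_le l1 with hl | hl
    · subst hl; linarith
    · linarith
  · have : (2 : ℤ) ≤ d := by omega
    have : (2 : ℝ) ≤ d := by exact_mod_cast this
    nlinarith

/-- the denominators -/
noncomputable def rQ (lam α x : ℝ) (n : ℕ) : ℝ := rosenPQ lam α x 0 1 n
/-- the numerators -/
noncomputable def rP (lam α x : ℝ) (n : ℕ) : ℝ := rosenPQ lam α x 1 0 n

lemma rPQ_succ (x a b : ℝ) (n : ℕ) : rosenPQ lam α x a b (n + 2)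
    = (rosenD lam α ((rosenT lam α)^[n] x) : ℝ) * lam * rosenPQ lam α x a b (n + 1)
        + Real.sign ((rosenT lam α)^[n] x) * rosenPQ lam α x a b n := rfl

/-- full data of an orbit -/
structure ROrb (lam α x : ℝ) (I : ℝ → ℝ → Prop) : Prop where
  inv : ∀ n, I ((rosenT lam α)^[n] x) (rQ lam α x n / rQ lam α x (n + 1))
  qpos : ∀ n, 0 < rQ lam α x (n + 1)
  stp : ∀ n, RStp lam α ((rosenT lam α)^[n] x) (rQ lam α x n / rQ lam α x (n + 1))
    (rosenD lam α ((rosenT lam α)^[n] x)) ((rosenT lam α)^[n + 1] x)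
    (rQ lam α x (n + 1) / rQ lam α x (n + 2)) (1 / |(rosenT lam α)^[n] x|)

lemma orb_of_inv (hp : RPar lam α) {x : ℝ} (hx : x ∈ Set.Ico ((α - 1) * lam) (α * lam))
    (hg : GIrrational lam α x) (I : ℝ → ℝ → Prop) (i0 : ∀ t, I t 0)
    (i1 : ∀ t v, I t v → 0 ≤ v ∧ v ≤ 1)
    (i2 : ∀ t v d t' v' a, RStp lam α t v d t' v' a → I t v → I t' v') :
    ROrb lam α x I := by
  have st : ∀ n, 0 < rQ lam α x (n + 1) →
     RStp lam α ((rosenT lam α)^[n] x) (rQ lam α x n / rQ lam α x (n + 1))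
    (rosenD lam α ((rosenT lam α)^[n] x)) ((rosenT lam α)^[n + 1] x)
    (rQ lam α x (n + 1) / rQ lam α x (n + 2)) (1 / |(rosenT lam α)^[n] x|) := by
    intro n hq
    have hm := orbit_mem hp hx n
    rw [Function.iterate_succ_apply']
    apply orbit_stp hp (hg n) hm.1 hm.2
    have e := rPQ_succ (lam := lam) (α := α) x 0 1 n
    simp only [rQ] at *
    rw [e]
    have e2 : ∀ Q1 Q0 D sg : ℝ, 0 < Q1 → Q1 / (D * Q1 + sg * Q0) = 1 / (D + sg * (Q0 / Q1)) := by
      intro Q1 Q0 D sg hQ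
      have : D * Q1 + sg * Q0 = Q1 * (D + sg * (Q0 / Q1)) := by field_simp
      rw [this, div_mul_eq_div_div, div_self hQ.ne']
    exact e2 _ _ _ _ hq
  have key : ∀ n, I ((rosenT lam α)^[n] x) (rQ lam α x n / rQ lam α x (n + 1)) ∧
      0 < rQ lam α x (n + 1) := by
    intro n
    induction n with
    | zero =>
      have e0 : rQ lam α x 0 = 0 := rfl
      have e1 : rQ lam α x (0 + 1) = 1 := rfl
      rw [e0, e1]
      refine ⟨by simpa using i0 _, one_pos⟩
    | succ n ih =>
      obtain ⟨h1, h2⟩ := ih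
      have S := st n h2
      refine ⟨i2 _ _ _ _ _ _ S h1, ?_⟩
      have hv := i1 _ _ h1
      have e : rQ lam α x (n + 1 + 1) = rQ lam α x (n + 1) *
        (rosenD lam α ((rosenT lam α)^[n] x) * lam + Real.sign ((rosenT lam α)^[n] x) *
          (rQ lam α x n / rQ lam α x (n + 1))) := by
        have := rPQ_succ (lam := lam) (α := α) x 0 1 n
        simp only [rQ] at *
        rw [this]; field_simp
      rw [e]
      apply mul_pos h2
      have d1 : (1 : ℝ) ≤ rosenD lam α ((rosenT lam α)^[n] x) := by exact_mod_cast S.d1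
      have l1 := hp.l1
      rcases lt_or_gt_of_ne (hg n) with h | h
      · rw [Real.sign_of_neg h]
        have := S.dneg hp hv.2 (by rw [abs_of_neg h]; have := h.ne; field_simp)
        linarith
      · rw [Real.sign_of_pos h]
        nlinarith
  exact ⟨fun n => (key n).1, fun n => (key n).2, fun n => st n (key n).2⟩

lemma rdet {x : ℝ} (n : ℕ) (h : ∀ k, k < n → (rosenT lam α)^[k] x ≠ 0) :
    |rP lam α x n * rQ lam α x (n + 1) - rP lam α x (n + 1) * rQ lam α x n| = 1 := by
  induction n with
  | zero => simp [rP, rQ, rosenPQ]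
  | succ n ih =>
    have ih := ih (fun k hk => h k (by omega))
    have e1 := rPQ_succ (lam := lam) (α := α) x 0 1 n
    have e2 := rPQ_succ (lam := lam) (α := α) x 1 0 n
    simp only [rP, rQ] at *
    rw [show n + 1 + 1 = n + 2 by ring, e1, e2]
    have hs : |Real.sign ((rosenT lam α)^[n] x)| = 1 := by
      rcases lt_or_gt_of_ne (h n (by omega)) with h | h
      · rw [Real.sign_of_neg h]; simp
      · rw [Real.sign_of_pos h]; simp
    have gen : ∀ a b c e sg D : ℝ, |sg| = 1 → |a * b - c * e| = 1 →
        |c * (D * b + sg * e) - (D * c + sg * a) * b| = 1 := by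
      intro a b c e sg D h1 h2
      have : c * (D * b + sg * e) - (D * c + sg * a) * b = - (sg * (a * b - c * e)) := by ring
      rw [this, abs_neg, abs_mul, h1, h2, one_mul]
    exact gen _ _ _ _ _ _ hs ih

lemma rE {x : ℝ} (n : ℕ) (h : ∀ k, k < n → (rosenT lam α)^[k] x ≠ 0) :
    rQ lam α x (n + 1) * x - rP lam α x (n + 1)
      = - (rosenT lam α)^[n] x * (rQ lam α x n * x - rP lam α x n) := by
  induction n with
  | zero => simp [rP, rQ, rosenPQ]
  | succ n ih =>
    have ih := ih (fun k hk => h k (by omega))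
    have e1 := rPQ_succ (lam := lam) (α := α) x 0 1 n
    have e2 := rPQ_succ (lam := lam) (α := α) x 1 0 n
    have h0 := h n (by omega)
    simp only [rP, rQ] at *
    rw [show n + 1 + 1 = n + 2 by ring, e1, e2, Function.iterate_succ_apply']
    set z := (rosenT lam α)^[n] x
    have e3 : rosenT lam α z = Real.sign z / z - lam * (rosenD lam α z : ℝ) := by
      rw [rosenT, if_neg h0]
    have e4 : Real.sign z / z * z = Real.sign z := div_mul_cancel₀ _ h0
    rw [e3]
    linear_combination (Real.sign z / z) * ih -
      (rosenPQ lam α x 0 1 n * x - rosenPQ lam α x 1 0 n) * e4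

lemma rTheta {x : ℝ} (hg : GIrrational lam α x) (n : ℕ) (hq : 0 < rQ lam α x (n + 1)) :
    rosenTheta lam α x n * |1 / (rosenT lam α)^[n] x + rQ lam α x n / rQ lam α x (n + 1)| = 1 := by
  have h1 := rdet (lam := lam) (α := α) (x := x) n (fun k _ => hg k)
  have h2 := rE (lam := lam) (α := α) (x := x) n (fun k _ => hg k)
  have h0 := hg n
  have e : rosenTheta lam α x n = |rQ lam α x (n + 1) * (rQ lam α x (n + 1) * x - rP lam α x (n + 1))| := by
    unfold rosenTheta
    change rQ lam α x (n + 1) ^ 2 * |x - rP lam α x (n + 1) / rQ lam α x (n + 1)| = _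
    rw [← abs_of_nonneg (sq_nonneg (rQ lam α x (n + 1))), ← abs_mul]
    congr 1
    field_simp
  rw [e, ← abs_mul]
  rw [h2]
  set z := (rosenT lam α)^[n] x
  have : rQ lam α x (n + 1) * (-z * (rQ lam α x n * x - rP lam α x n)) *
      (1 / z + rQ lam α x n / rQ lam α x (n + 1))
      = - (rQ lam α x n * x - rP lam α x n) * (rQ lam α x (n + 1) + z * rQ lam α x n) := by
    field_simp
  rw [this]
  have e5 : - (rQ lam α x n * x - rP lam α x n) * (rQ lam α x (n + 1) + z * rQ lam α x n)
      = rP lam α x n * rQ lam α x (n + 1) - rP lam α x (n + 1) * rQ lam α x n := by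
    linear_combination -(rQ lam α x n) * h2
  rw [e5]; exact h1

end


section
variable {lam α x : ℝ}

lemma ROrb.mono {I J : ℝ → ℝ → Prop} (h : ROrb lam α x I) (hIJ : ∀ t v, I t v → J t v) :
    ROrb lam α x J := ⟨fun n => hIJ _ _ (h.inv n), h.qpos, h.stp⟩

lemma ROrb.bad (hp : RPar lam α) (hg : GIrrational lam α x)
    (o : ROrb lam α x (fun _ v => 0 ≤ v ∧ v ≤ 1)) {h : ℝ} (h0 : 0 < h) {N : ℕ}
    (hN : ∀ n, N ≤ n → 1 / h < rosenTheta lam α x n) :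
    RBad lam α h (fun n => (rosenT lam α)^[n] x) (fun n => rQ lam α x n / rQ lam α x (n + 1))
      (fun n => 1 / |(rosenT lam α)^[n] x|) (fun n => rosenD lam α ((rosenT lam α)^[n] x)) N := by
  have key : ∀ n, N ≤ n → |1 / (rosenT lam α)^[n] x + rQ lam α x n / rQ lam α x (n + 1)| < h := by
    intro n hn
    have h1 := rTheta hg n (o.qpos n)
    have h2 := hN n hn
    rw [div_lt_iff₀ h0] at h2
    have h3 : 0 < 1 / h := by positivity
    have h4 := hN n hn
    by_contra hc
    push Not at hc
    have := mul_le_mul_of_nonneg_left hc (by linarith : 0 ≤ rosenTheta lam α x n)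
    linarith
  refine ⟨hp, o.stp, fun n => (o.inv n).1, fun n => (o.inv n).2, ?_, ?_, ?_, ?_⟩
  · intro n _
    have d1 : (1 : ℝ) ≤ rosenD lam α ((rosenT lam α)^[n] x) := by exact_mod_cast (o.stp n).d1
    have := (o.inv n).1
    have := hp.l1
    nlinarith
  · intro n ha
    exact (o.stp n).dneg hp (o.inv n).2 ha
  · intro n hn ha
    have := (o.stp n).tpos ha
    have k := (abs_lt.1 (key n hn)).2
    rw [abs_of_pos this]; exact k
  · intro n hn ha
    have := (o.stp n).tneg ha
    have k := (abs_lt.1 (key n hn)).1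
    rw [abs_of_neg this, one_div, inv_neg]
    rw [one_div] at k
    linarith

lemma RChain.zero {q : ℕ} {s : ℕ → ℝ} (hs : SFacts q lam s) {X : ℕ → ℝ} {w t : ℝ} (hw : w ≤ 0) {K : ℕ}
    (hK : K < q) : RChain X (rlin s w) K t 0 := by
  intro j hj _ _
  have := rlin_pos' hs hw j (by omega)
  rw [zero_mul]; exact this.le


lemma orb_even {k : ℕ} {s : ℕ → ℝ} (hp : RPar lam α) (hx : x ∈ Set.Ico ((α - 1) * lam) (α * lam))
    (hg : GIrrational lam α x) 
    (hs : SFacts (2 * (k + 2)) lam s) : ROrb lam α x (EInv s k) := by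
  apply orb_of_inv hp hx hg
  · exact fun t => ⟨le_rfl, zero_le_one, RChain.zero hs (by norm_num) (by omega)⟩
  · exact fun t v h => ⟨h.1, h.2.1⟩
  · exact fun t v d t' v' a h hi => even_step hs hp h hi

lemma orb_odd1 {k : ℕ} {s : ℕ → ℝ} (hp : RPar lam α) (hx : x ∈ Set.Ico ((α - 1) * lam) (α * lam))
    (hg : GIrrational lam α x) 
    {P r : ℝ} (g : RGold lam P r) (hs : SFacts (2 * (k + 2) + 1) lam s)
    (hr : α * lam ≤ r) : ROrb lam α x (OInv P r s k) := by
  have rp := g.rpos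
  have := g.facts hp.l1 hp.l2
  apply orb_of_inv hp hx hg
  · exact fun t => ⟨le_rfl, zero_le_one, RChain.zero hs (by linarith) (by omega),
      RChain.zero hs (by linarith) (by omega)⟩
  · exact fun t v h => ⟨h.1, h.2.1⟩
  · exact fun t v d t' v' a h hi => odd_step g hs hp hr h hi

lemma orb_odd2 {k : ℕ} {s : ℕ → ℝ} (hp : RPar lam α) (hx : x ∈ Set.Ico ((α - 1) * lam) (α * lam))
    (hg : GIrrational lam α x) 
    (hs : SFacts (2 * (k + 2) + 1) lam s)
    (hr : 1 / 2 < α) : ROrb lam α x (PInv lam s k) := by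
  apply orb_of_inv hp hx hg
  · exact fun t => ⟨le_rfl, zero_le_one, RChain.zero hs (by linarith) (by omega)⟩
  · exact fun t v h => ⟨h.1, h.2.1⟩
  · exact fun t v d t' v' a h hi => odd_step2 hs hp hr h hi

lemma orb_three1 (hp : RPar 1 α) (hx : x ∈ Set.Ico ((α - 1) * 1) (α * 1))
    (hg : GIrrational 1 α x) {P r : ℝ} (g : RGold 1 P r) (hr : α ≤ r) :
    ROrb 1 α x (TInv r) := by
  have rp := g.rpos
  have := g.mul
  have := g.sub
  have := g.facts hp.l1 hp.l2
  apply orb_of_inv hp hx hg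
  · exact fun t => ⟨le_rfl, rp.le, fun _ _ => by linarith⟩
  · exact fun t v h => ⟨h.1, by linarith [h.2.1]⟩
  · exact fun t v d t' v' a h hi => three_step rp (by nlinarith) hp hr h hi

lemma orb_three2 (hp : RPar 1 α) (hx : x ∈ Set.Ico ((α - 1) * 1) (α * 1))
    (hg : GIrrational 1 α x) :
    ROrb 1 α x (fun _ v => 0 ≤ v ∧ v ≤ 1) := by
  apply orb_of_inv hp hx hg
  · exact fun t => ⟨le_rfl, zero_le_one⟩
  · exact fun t v h => h
  · exact fun t v d t' v' a h hi => three_step2 hp h hi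

/-- The number-theoretic constant: `h = 1 / H`. -/
def RCst (q : ℕ) (lam h : ℝ) : Prop :=
  (∃ k, q = 2 * (k + 2) ∧ h = 2) ∨
  (∃ P r, RGold lam P r ∧ h = P + r ∧ ((q = 3 ∧ lam = 1) ∨ ∃ k, q = 2 * (k + 2) + 1))

lemma rpar_of (q : ℕ) (hq : 3 ≤ q) (hlam : lam = 2 * Real.cos (Real.pi / (q : ℝ)))
    (hα : α ∈ Set.Icc (1 / 2 : ℝ) (1 / lam)) : RPar lam α := by
  have hq3 : (3 : ℝ) ≤ q := by exact_mod_cast hq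
  have hpi := Real.pi_pos
  have h1 : Real.pi / q ≤ Real.pi / 3 := by gcongr
  have h0 : 0 < Real.pi / q := by positivity
  have h2 : Real.cos (Real.pi / 3) ≤ Real.cos (Real.pi / q) :=
    Real.cos_le_cos_of_nonneg_of_le_pi h0.le (by linarith) h1
  have h3 : Real.cos (Real.pi / q) < Real.cos 0 :=
    Real.cos_lt_cos_of_nonneg_of_le_pi le_rfl (by linarith) h0
  rw [Real.cos_pi_div_three] at h2
  rw [Real.cos_zero] at h3
  have l1 : 1 ≤ lam := by linarith
  refine ⟨l1, by linarith, hα.1, ?_⟩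
  have := hα.2
  rwa [le_div_iff₀ (by linarith)] at this

lemma rcst_of (q : ℕ) (hq : 3 ≤ q) (hlam : lam = 2 * Real.cos (Real.pi / (q : ℝ)))
    (hp : RPar lam α) (H : ℝ)
    (hH : H = if Even q then (1 / 2 : ℝ) else 1 / Real.sqrt (lam ^ 2 - 4 * lam + 8)) :
    ∃ h, RCst q lam h ∧ 0 < h ∧ H = 1 / h := by
  by_cases he : Even q
  · rw [if_pos he] at hH
    obtain ⟨m, hm⟩ := he
    exact ⟨2, Or.inl ⟨m - 2, by omega, rfl⟩, by norm_num, hH⟩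
  · rw [if_neg he] at hH
    have l1 := hp.l1
    have l2 := hp.l2
    have hpos : 0 < lam ^ 2 - 4 * lam + 8 := by nlinarith [sq_nonneg (lam - 2)]
    set h := Real.sqrt (lam ^ 2 - 4 * lam + 8) with hh
    have hsq : h ^ 2 = lam ^ 2 - 4 * lam + 8 := Real.sq_sqrt hpos.le
    have h0 : 0 < h := Real.sqrt_pos.2 hpos
    have h2 : 2 - lam < h := by
      by_contra hc
      push Not at hc
      nlinarith
    refine ⟨h, Or.inr ⟨(h + 2 - lam) / 2, (h - 2 + lam) / 2, ⟨?_, by ring, by linarith⟩, by ring, ?_⟩, h0, hH⟩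
    · nlinarith
    · rw [Nat.not_even_iff_odd] at he
      obtain ⟨m, hm⟩ := he
      by_cases h3 : q = 3
      · left
        refine ⟨h3, ?_⟩
        rw [hlam, h3]; push_cast; rw [Real.cos_pi_div_three]; norm_num
      · right
        exact ⟨m - 2, by omega⟩

lemma orb_any {q : ℕ} {s : ℕ → ℝ} {h : ℝ} (hp : RPar lam α) (hs : SFacts q lam s)
    (hc : RCst q lam h)
    (hx : x ∈ Set.Ico ((α - 1) * lam) (α * lam)) (hg : GIrrational lam α x) :
    ROrb lam α x (fun _ v => 0 ≤ v ∧ v ≤ 1) := by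
  rcases hc with ⟨k, rfl, -⟩ | ⟨P, r, g, -, ⟨-, rfl⟩ | ⟨k, rfl⟩⟩
  · exact (orb_even hp hx hg hs).mono (fun t v h => ⟨h.1, h.2.1⟩)
  · exact orb_three2 hp hx hg
  · rcases le_or_gt (α * lam) r with hr | hr
    · exact (orb_odd1 hp hx hg g hs hr).mono (fun t v h => ⟨h.1, h.2.1⟩)
    · have := g.facts hp.l1 hp.l2
      have l1 := hp.l1
      exact (orb_odd2 hp hx hg hs (by nlinarith)).mono (fun t v h => ⟨h.1, h.2.1⟩)

theorem rosen_part1 {q : ℕ} {s : ℕ → ℝ} {h : ℝ} (hp : RPar lam α) (hs : SFacts q lam s)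
    (hc : RCst q lam h) (h0 : 0 < h)
    (hx : x ∈ Set.Ico ((α - 1) * lam) (α * lam)) (hg : GIrrational lam α x) :
    {n : ℕ | rosenTheta lam α x n ≤ 1 / h}.Infinite := by
  intro hf
  obtain ⟨N, hN⟩ := hf.bddAbove
  have hN' : ∀ n, N + 1 ≤ n → 1 / h < rosenTheta lam α x n := by
    intro n hn
    by_contra hcon
    have := hN (a := n) (not_lt.1 hcon)
    omega
  have B := (orb_any hp hs hc hx hg).bad hp hg h0 hN'
  rcases hc with ⟨k, rfl, rfl⟩ | ⟨P, r, g, rfl, ⟨-, rfl⟩ | ⟨k, rfl⟩⟩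
  · exact even_contra hs B (orb_even hp hx hg hs).inv
  · exact three_contra g B (fun hr => (orb_three1 hp hx hg g hr).inv)
  · rcases le_or_gt (α * lam) r with hr | hr
    · exact odd_contra1 g hs B hr (orb_odd1 hp hx hg g hs hr).inv
    · exact odd_contra2 g hs B hr

end


section
variable {lam α x : ℝ}

lemma ROrb.gap (hp : RPar lam α) (hg : GIrrational lam α x)
    (o : ROrb lam α x (fun _ v => 0 ≤ v ∧ v ≤ 1)) :
    ∃ c : ℝ, 0 ≤ c ∧ c < 1 ∧ ∀ n, rQ lam α x n / rQ lam α x (n + 1) ≤ c ∨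
      rQ lam α x (n + 1) / rQ lam α x (n + 2) ≤ c ∨
      rQ lam α x (n + 2) / rQ lam α x (n + 3) ≤ c := by
  have l1 := hp.l1
  have l2 := hp.l2
  have a2 := hp.a2
  rcases eq_or_lt_of_le l1 with hl | hl
  · subst hl
    refine ⟨2 / 3, by norm_num, by norm_num, fun n => ?_⟩
    have S := o.stp n
    have S' := o.stp (n + 1)
    obtain ⟨v0, v1⟩ := o.inv n
    obtain ⟨w0, w1⟩ := o.inv (n + 1)
    have hne := hg (n + 1)
    have pos : ∀ {t v d t' v' a}, RStp 1 α t v d t' v' a → 0 ≤ v → t * a = 1 → v ≤ 2 / 3 ∨ v' ≤ 2 / 3 := by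
      intro t v d t' v' a h v0 ht
      have hd : (1 : ℝ) ≤ d := by exact_mod_cast h.d1
      have h1 := h.vle (c := 1 + v) (by linarith) (fun _ => by linarith) (fun h' => by linarith)
      by_contra hc
      push Not at hc
      nlinarith
    rcases S.sg with ⟨ha, -⟩ | ⟨ha, -⟩
    · rcases pos S v0 ha with h | h
      · exact Or.inl h
      · exact Or.inr (Or.inl h)
    · have h2 := S.a_lo2 hp ha
      have ht := S.ht
      have hi := S.hi'
      rcases S.cases with hd | hd | hd
      · rw [hd] at ht; push_cast at ht; linarith
      · rw [hd] at ht; push_cast at ht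
        right
        rcases S'.sg with ⟨hb, -⟩ | ⟨hb, -⟩
        · exact pos S' w0 hb
        · have := S'.tneg hb
          linarith
      · right; left
        have hd' : (3 : ℝ) ≤ rosenD 1 α ((rosenT 1 α)^[n] x) := by exact_mod_cast hd
        have := S.vle (c := 2) (by norm_num) (fun _ => by linarith) (fun _ => by linarith)
        linarith
  · have l0 : 0 < lam := by linarith
    refine ⟨max (lam - 1) (1 / lam), le_max_of_le_left (by linarith),
      max_lt (by linarith) (by rw [div_lt_one l0]; exact hl), fun n => ?_⟩
    have S := o.stp n
    obtain ⟨v0, v1⟩ := o.inv n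
    obtain ⟨w0, w1⟩ := o.inv (n + 1)
    by_cases hc : rosenD lam α ((rosenT lam α)^[n] x) = 1 ∧
      (rosenT lam α)^[n] x * (1 / |(rosenT lam α)^[n] x|) = -1
    · left
      apply le_max_of_le_left
      have hd := S.dneg hp v1 hc.2
      rcases S.sg with ⟨ha, e⟩ | ⟨ha, e⟩
      · have := hc.2; linarith
      · change rQ lam α x (n + 1) / rQ lam α x (n + 2) ≤ 1 at w1
        rw [e, div_le_one hd, hc.1] at w1
        push_cast at w1
        linarith
    · right; left
      apply le_max_of_le_right
      rw [le_div_iff₀ l0]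
      exact (S.vub hp v0 v1 hc).2

lemma ROrb.fin (hp : RPar lam α) (hg : GIrrational lam α x)
    (o : ROrb lam α x (fun _ v => 0 ≤ v ∧ v ≤ 1)) (M : ℝ) :
    {n : ℕ | rQ lam α x (n + 1) ≤ M}.Finite := by
  obtain ⟨c, c0, c1, hc⟩ := o.gap hp hg
  have mono1 : ∀ n, rQ lam α x (n + 1) ≤ rQ lam α x (n + 1 + 1) := by
    intro n
    have := (o.inv (n + 1)).2
    rwa [div_le_one (o.qpos (n + 1))] at this
  have mono : Monotone (fun n => rQ lam α x (n + 1)) := monotone_nat_of_le_succ mono1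
  have grow : ∀ n, rQ lam α x (n + 1) ≤ c * rQ lam α x (n + 1 + 3) := by
    intro n
    have m1 : rQ lam α x (n + 1) ≤ rQ lam α x (n + 2) := mono1 n
    have m2 : rQ lam α x (n + 2) ≤ rQ lam α x (n + 3) := mono1 (n + 1)
    have m3 : rQ lam α x (n + 3) ≤ rQ lam α x (n + 4) := mono1 (n + 2)
    change _ ≤ c * rQ lam α x (n + 4)
    rcases hc (n + 1) with h | h | h
    · rw [div_le_iff₀ (o.qpos (n + 1))] at h
      have : c * rQ lam α x (n + 2) ≤ c * rQ lam α x (n + 4) := by gcongr; linarith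
      exact h.trans this
    · rw [div_le_iff₀ (o.qpos (n + 2))] at h
      have : c * rQ lam α x (n + 3) ≤ c * rQ lam α x (n + 4) := by gcongr
      exact m1.trans (h.trans this)
    · rw [div_le_iff₀ (o.qpos (n + 3))] at h
      exact m1.trans (m2.trans h)
  have pw : ∀ i : ℕ, 1 ≤ c ^ i * rQ lam α x (3 * i + 1) := by
    intro i
    induction i with
    | zero => simp [rQ, rosenPQ]
    | succ i ih =>
      have := mul_le_mul_of_nonneg_left (grow (3 * i)) (pow_nonneg c0 i)
      rw [show 3 * (i + 1) + 1 = 3 * i + 1 + 3 by ring, pow_succ]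
      linarith
  obtain ⟨i, hi⟩ := exists_pow_lt_of_lt_one (show (0 : ℝ) < 1 / (|M| + 1) by positivity) c1
  apply (Set.finite_lt_nat (3 * i)).subset
  intro n hn
  by_contra hcon
  have hcon : 3 * i ≤ n := not_lt.1 hcon
  have h1 : rQ lam α x (3 * i + 1) ≤ rQ lam α x (n + 1) := mono hcon
  have h2 : rQ lam α x (n + 1) ≤ M := hn
  have h3 : rQ lam α x (3 * i + 1) ≤ |M| + 1 := by linarith [le_abs_self M]
  have h4 := pw i
  rw [lt_div_iff₀ (by positivity)] at hi
  have := mul_le_mul_of_nonneg_left h3 (pow_nonneg c0 i)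
  linarith

lemma rv_conv {q : ℕ} {s : ℕ → ℝ} (hs : SFacts q lam s) (hq : 3 ≤ q) (hl : 1 ≤ lam) (n : ℕ)
    (h : ∀ k, k < n → (rosenT lam α)^[k] x ≠ 0) : ∀ X Y : ℝ, RV q s X Y →
    RV q s (rP lam α x n * X + rP lam α x (n + 1) * Y)
      (rQ lam α x n * X + rQ lam α x (n + 1) * Y) := by
  induction n with
  | zero => intro X Y hXY; simpa [rP, rQ, rosenPQ] using hXY
  | succ n ih =>
    intro X Y hXY
    have ih := ih (fun k hk => h k (by omega))
    have e1 := rPQ_succ (lam := lam) (α := α) x 0 1 n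
    have e2 := rPQ_succ (lam := lam) (α := α) x 1 0 n
    have h0 := h n (by omega)
    simp only [rP, rQ] at *
    rw [show n + 1 + 1 = n + 2 by ring, e1, e2]
    set z := (rosenT lam α)^[n] x
    have k1 := (RV.shiftInt hs hq hl hXY (rosenD lam α z)).swap hs
    have k2 : RV q s (Real.sign z * Y) (X + rosenD lam α z * lam * Y) := by
      rcases lt_or_gt_of_ne h0 with h | h
      · rw [Real.sign_of_neg h, neg_one_mul]; exact k1.neg_left
      · rw [Real.sign_of_pos h, one_mul]; exact k1
    have k3 := ih _ _ k2
    convert k3 using 1 <;> ring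

lemma rv_pq {q : ℕ} {s : ℕ → ℝ} (hs : SFacts q lam s) (hq : 3 ≤ q) (hl : 1 ≤ lam) (n : ℕ)
    (h : ∀ k, k < n → (rosenT lam α)^[k] x ≠ 0) :
    RV q s (rP lam α x (n + 1)) (rQ lam α x (n + 1)) := by
  have h01 : RV q s 0 1 := by unfold RV; rw [abs_zero, abs_one]; exact RW.e2
  simpa using rv_conv hs hq hl n h 0 1 h01

lemma girr_of_form {q : ℕ} {s : ℕ → ℝ} (hs : SFacts q lam s) (hq : 3 ≤ q) (hl : 1 ≤ lam)
    {x' : ℝ} (F : ∀ p Q, RV q s p Q → 1 ≤ |(p - x * Q) * (p - x' * Q)|) :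
    GIrrational lam α x := by
  intro n
  induction n using Nat.strong_induction_on with
  | _ n ih =>
    intro h0
    have h1 := F _ _ (rv_pq (α := α) hs hq hl n ih)
    have h2 := rE n ih
    rw [h0] at h2
    have h3 : rP lam α x (n + 1) - x * rQ lam α x (n + 1) = 0 := by linarith
    rw [h3, zero_mul, abs_zero] at h1
    linarith

lemma rform {q : ℕ} {s : ℕ → ℝ} {h : ℝ} (hp : RPar lam α) (hs : SFacts q lam s) (hq : 3 ≤ q)
    (hc : RCst q lam h) : ∃ x0 x0' : ℝ, x0 - x0' = h ∧
      ∀ p Q, RV q s p Q → 1 ≤ |(p - x0 * Q) * (p - x0' * Q)| := by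
  rcases hc with ⟨k, rfl, rfl⟩ | ⟨P, r, g, rfl, hk⟩
  · refine ⟨1, -1, by norm_num, fun p Q hpQ => ?_⟩
    have := form_even (by omega) hs hpQ
    rw [sq_abs, sq_abs] at this
    convert this using 2; ring
  · refine ⟨P, -r, by ring, fun p Q hpQ => ?_⟩
    obtain ⟨m, hm, rfl⟩ : ∃ m, 1 ≤ m ∧ q = 2 * m + 1 := by
      rcases hk with ⟨rfl, -⟩ | ⟨k, rfl⟩
      · exact ⟨1, le_rfl, rfl⟩
      · exact ⟨k + 2, by omega, rfl⟩
    obtain ⟨f1, f2⟩ := form_odd hm hs hp.l1 hp.l2 hpQ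
    have e : (p - P * Q) * (p - -r * Q) = p ^ 2 - (2 - lam) * p * Q - Q ^ 2 := by
      linear_combination (-Q ^ 2) * g.mul - p * Q * g.sub
    rw [e]
    rw [sq_abs, sq_abs, mul_assoc, ← abs_mul, ] at f1 f2
    rcases abs_choice (p * Q) with h | h
    · rw [h] at f1
      convert f1 using 2; ring
    · rw [h] at f2
      convert f2 using 2; ring

theorem rosen_part2 {q : ℕ} {s : ℕ → ℝ} {h : ℝ} (hp : RPar lam α) (hs : SFacts q lam s)
    (hq : 3 ≤ q) (hc : RCst q lam h) (h0 : 0 < h) (c : ℝ) (hch : c < 1 / h) :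
    ∃ x ∈ Set.Ico ((α - 1) * lam) (α * lam),
      GIrrational lam α x ∧ {n : ℕ | rosenTheta lam α x n ≤ c}.Finite := by
  obtain ⟨x0, x0', hd, F0⟩ := rform hp hs hq hc
  have l1 := hp.l1
  have l0 : 0 < lam := by linarith
  obtain ⟨j, hj1, hj2⟩ : ∃ j : ℤ, (α - 1) * lam ≤ x0 - j * lam ∧ x0 - j * lam < α * lam := by
    refine ⟨⌊x0 / lam - (α - 1)⌋, ?_, ?_⟩
    · have := Int.floor_le (x0 / lam - (α - 1))
      have e : x0 / lam * lam = x0 := by field_simp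
      nlinarith
    · have := Int.lt_floor_add_one (x0 / lam - (α - 1))
      have e : x0 / lam * lam = x0 := by field_simp
      nlinarith
  have F : ∀ p Q, RV q s p Q → 1 ≤ |(p - (x0 - j * lam) * Q) * (p - (x0' - j * lam) * Q)| := by
    intro p Q hpQ
    have := F0 _ _ (hpQ.shiftInt hs hq l1 j)
    convert this using 2; ring
  have hdd : (x0 - j * lam) - (x0' - j * lam) = h := by linarith
  generalize x0 - j * lam = x at *
  generalize x0' - j * lam = x' at *
  have hg : GIrrational lam α x := girr_of_form hs hq l1 F
  have o := orb_any hp hs hc ⟨hj1, hj2⟩ hg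
  refine ⟨x, ⟨hj1, hj2⟩, hg, ?_⟩
  obtain ⟨b, b0, cb, bh⟩ : ∃ b, 0 < b ∧ c ≤ b ∧ b * h < 1 := by
    refine ⟨max c (1 / h / 2), lt_max_of_lt_right (by positivity), le_max_left _ _, ?_⟩
    rw [← lt_div_iff₀ h0]
    exact max_lt hch (half_lt_self (by positivity))
  apply (o.fin hp hg (b ^ 2 / (1 - b * h) + 1)).subset
  intro n hn
  have hn : rosenTheta lam α x n ≤ b := le_trans hn cb
  have f := F _ _ (rv_pq (α := α) hs hq l1 n (fun k _ => hg k))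
  have qp := o.qpos n
  have e : rosenTheta lam α x n = rQ lam α x (n + 1) * |rP lam α x (n + 1) - x * rQ lam α x (n + 1)| := by
    unfold rosenTheta
    change rQ lam α x (n + 1) ^ 2 * |x - rP lam α x (n + 1) / rQ lam α x (n + 1)| = _
    have : rP lam α x (n + 1) - x * rQ lam α x (n + 1)
      = - (rQ lam α x (n + 1) * (x - rP lam α x (n + 1) / rQ lam α x (n + 1))) := by
      field_simp; ring
    rw [this, abs_neg, abs_mul, abs_of_pos qp]; ring
  rw [e] at hn
  change rQ lam α x (n + 1) ≤ b ^ 2 / (1 - b * h) + 1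
  generalize rQ lam α x (n + 1) = Q at *
  generalize rP lam α x (n + 1) = p at *
  rw [abs_mul] at f
  have tri : |p - x' * Q| ≤ |p - x * Q| + h * Q := by
    have : p - x' * Q = (p - x * Q) + h * Q := by rw [← hdd]; ring
    rw [this]
    refine (abs_add_le _ _).trans ?_
    rw [abs_of_pos (mul_pos h0 qp)]
  set E := |p - x * Q| with hE
  have E0 : 0 ≤ E := abs_nonneg _
  have g1 : 1 ≤ E * (E + h * Q) := f.trans (by gcongr)
  have g2 : Q ^ 2 ≤ (Q * E) ^ 2 + (Q * E) * h * Q ^ 2 := by nlinarith [sq_nonneg Q, mul_le_mul_of_nonneg_left g1 (sq_nonneg Q)]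
  have g3 : (Q * E) ^ 2 ≤ b ^ 2 := by gcongr
  have g4 : (Q * E) * h * Q ^ 2 ≤ b * h * Q ^ 2 := by gcongr
  have g5 : Q ^ 2 ≤ b ^ 2 / (1 - b * h) := by
    rw [le_div_iff₀ (by linarith)]; linarith
  nlinarith [sq_nonneg (Q - 1)]

end

/-- **Borel's theorem for α-Rosen fractions** (Theorem 1.7).
Let `q ≥ 3`, `λ = 2cos(π/q)` and `α ∈ [1/2, 1/λ]`.  For every `G_q`-irrational
`x ∈ [(α-1)λ, αλ)` there are infinitely many `n` with `Θ_n(x) ≤ ℋ_q`, where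
`ℋ_q = 1/2` for even `q` and `ℋ_q = 1/√(λ²-4λ+8)` for odd `q`.  Moreover the
constant `ℋ_q` is best possible. -/
theorem borel_alpha_rosen (q : ℕ) (hq : 3 ≤ q)
    (lam : ℝ) (hlam : lam = 2 * Real.cos (Real.pi / (q : ℝ)))
    (α : ℝ) (hα : α ∈ Set.Icc (1 / 2 : ℝ) (1 / lam))
    (H : ℝ)
    (hH : H = if Even q then (1 / 2 : ℝ) else 1 / Real.sqrt (lam ^ 2 - 4 * lam + 8)) :
    (∀ x ∈ Set.Ico ((α - 1) * lam) (α * lam), GIrrational lam α x →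
      {n : ℕ | rosenTheta lam α x n ≤ H}.Infinite) ∧
    ∀ c : ℝ, c < H → ∃ x ∈ Set.Ico ((α - 1) * lam) (α * lam),
      GIrrational lam α x ∧ {n : ℕ | rosenTheta lam α x n ≤ c}.Finite := by
  have hp : RPar lam α := rpar_of q hq hlam hα
  obtain ⟨h, hc, h0, rfl⟩ := rcst_of q hq hlam hp H hH
  have hs := sfacts q hq lam hlam
  exact ⟨fun x hx hg => rosen_part1 hp hs hc h0 hx hg,
    fun c hch => rosen_part2 hp hs hq hc h0 c hch⟩
end

section
/- Let q = 2p be even with p ≥ 3, λ = 2·cos(π/q), and α ∈ [1/2, 1/λ]. Define the Möbius map N(z) = ((λ²−2)z + λ)/((λ−λ³)z − λ² − 2), set τ_0 = −1/((α+1)λ) if α < 1/λ and τ_0 = −2/(3λ) if α = 1/λ, τ_k = N(τ_{k−1}) for k ≥ 1, and c_k = −τ_{k−1}/(1 + (λ−1)·τ_{k−1}) for k ≥ 1. Then there exists a positive integer K such that for every G_q-irrational x ∈ [(α−1)λ, αλ) and all integers n ≥ 1 and k > K one has min{Θ_{n−1}(x), Θ_n(x), …, Θ_{n+k(p−1)}(x)}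 < c_k. Moreover c_{k+1} < c_k for every k ≥ 1, and lim_{k→∞} c_k = 1/2. -/
structure TrigD (P : ℕ) (lam : ℝ) (s c : ℕ → ℝ) : Prop where
  srec : ∀ j, s (j+2) = lam * s (j+1) - s j
  crec : ∀ j, c (j+2) = lam * c (j+1) - c j
  s0 : s 0 = 0
  c0 : c 0 = 1
  c1 : c 1 = lam / 2
  spos : ∀ j, 1 ≤ j → j ≤ P + 3 → 0 < s j
  cpos : ∀ j, j ≤ P + 2 → 0 < c j
  sP3 : s (P+3) = 1
  sP2 : s (P+2) = lam / 2
  cP3 : c (P+3) = 0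
  l1 : 3 ≤ lam ^ 2
  l2 : lam < 2
  l0 : 0 < lam

lemma trigD_mk (P : ℕ) (lam : ℝ) (hlam : lam = 2 * Real.cos (Real.pi / ((2 * (P + 3) : ℕ) : ℝ))) :
    TrigD P lam (fun j => Real.sin (j * (Real.pi / ((2 * (P + 3) : ℕ) : ℝ))))
      (fun j => Real.cos (j * (Real.pi / ((2 * (P + 3) : ℕ) : ℝ)))) := by
  set θ := Real.pi / ((2 * (P + 3) : ℕ) : ℝ) with hθ
  have hpi := Real.pi_pos
  have hP : (0:ℝ) ≤ P := Nat.cast_nonneg P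
  have hθ0 : 0 < θ := by rw [hθ]; positivity
  have hmul : ((P:ℝ) + 3) * θ = Real.pi / 2 := by
    rw [hθ]; push_cast; field_simp
  have hθ6 : θ ≤ Real.pi / 6 := by nlinarith
  have hc6 : Real.sqrt 3 / 2 ≤ Real.cos θ := by
    rw [← Real.cos_pi_div_six]
    exact Real.cos_le_cos_of_nonneg_of_le_pi hθ0.le (by linarith) hθ6
  have hs3 : Real.sqrt 3 ^ 2 = 3 := Real.sq_sqrt (by norm_num)
  have hs3' : 0 < Real.sqrt 3 := Real.sqrt_pos.mpr (by norm_num)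
  have hcl : Real.cos θ < 1 := by
    have := Real.cos_lt_cos_of_nonneg_of_le_pi (le_refl 0) (by linarith : θ ≤ Real.pi) hθ0
    simpa using this
  constructor
  · intro j
    have e1 : ((j + 2 : ℕ) : ℝ) * θ = ((j+1 : ℕ) : ℝ) * θ + θ := by push_cast; ring
    have e2 : (j : ℝ) * θ = ((j+1 : ℕ) : ℝ) * θ - θ := by push_cast; ring
    simp only [e1, e2, Real.sin_add, Real.sin_sub, hlam]; ring
  · intro j
    have e1 : ((j + 2 : ℕ) : ℝ) * θ = ((j+1 : ℕ) : ℝ) * θ + θ := by push_cast; ring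
    have e2 : (j : ℝ) * θ = ((j+1 : ℕ) : ℝ) * θ - θ := by push_cast; ring
    simp only [e1, e2, Real.cos_add, Real.cos_sub, hlam]; ring
  · simp
  · simp
  · simp [hlam]
  · intro j h1 h2
    have h1' : (1:ℝ) ≤ j := by exact_mod_cast h1
    have h2' : (j:ℝ) ≤ P + 3 := by exact_mod_cast h2
    apply Real.sin_pos_of_pos_of_lt_pi
    · positivity
    · nlinarith
  · intro j h2
    have h2' : (j:ℝ) ≤ P + 2 := by exact_mod_cast h2
    have h0 : (0:ℝ) ≤ j := Nat.cast_nonneg j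
    apply Real.cos_pos_of_mem_Ioo
    constructor
    · nlinarith
    · nlinarith
  · have : ((P + 3 : ℕ) : ℝ) * θ = Real.pi / 2 := by push_cast; exact hmul
    simp only [this, Real.sin_pi_div_two]
  · have : ((P + 2 : ℕ) : ℝ) * θ = Real.pi / 2 - θ := by push_cast; linarith
    simp only [this, Real.sin_pi_div_two_sub, hlam]; ring
  · have : ((P + 3 : ℕ) : ℝ) * θ = Real.pi / 2 := by push_cast; exact hmul
    simp only [this, Real.cos_pi_div_two]
  · rw [hlam]; nlinarith
  · rw [hlam]; linarith
  · rw [hlam]; linarith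

structure SysD (lam α : ℝ) (t v : ℕ → ℝ) (d : ℕ → ℤ) : Prop where
  lo : ∀ n, (α - 1) * lam ≤ t n
  hi : ∀ n, t n < α * lam
  ne : ∀ n, t n ≠ 0
  d1 : ∀ n, 1 ≤ d n
  v0 : v 0 = 0
  tp : ∀ n, 0 < t n → t (n+1) = 1 / t n - d n * lam
  vp : ∀ n, 0 < t n → v (n+1) = 1 / (d n * lam + v n)
  tn : ∀ n, t n < 0 → t (n+1) = -1 / t n - d n * lam
  vn : ∀ n, t n < 0 → v (n+1) = 1 / (d n * lam - v n)

section core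
variable {P : ℕ} {lam α : ℝ} {s c : ℕ → ℝ} {t v : ℕ → ℝ} {d : ℕ → ℤ}

lemma TrigD.lam_gt (H : TrigD P lam s c) : 17 / 10 < lam := by
  have := H.l1; have := H.l0; nlinarith

lemma TrigD.sP1 (H : TrigD P lam s c) : s (P+1) = lam ^ 2 / 2 - 1 := by
  have := H.srec (P+1); rw [show P+1+2 = P+3 from rfl, show P+1+1=P+2 from rfl, H.sP3, H.sP2] at this
  linarith

lemma TrigD.sP (H : TrigD P lam s c) : s P = lam ^ 3 / 2 - 3 * lam / 2 := by
  have := H.srec P; rw [H.sP2, H.sP1] at this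
  linarith

lemma TrigD.s2 (H : TrigD P lam s c) : s 2 = lam * s 1 := by
  have := H.srec 0; simp [H.s0] at this; exact this

lemma TrigD.snn (H : TrigD P lam s c) (j : ℕ) (hj : j ≤ P + 3) : 0 ≤ s j := by
  rcases Nat.eq_zero_or_pos j with h | h
  · rw [h, H.s0]
  · exact (H.spos j h hj).le

/-- nonnegativity of `v` and the basic height bounds -/
lemma SysD.inv1 (H : TrigD P lam s c) (S : SysD lam α t v d) (hα : 1/2 ≤ α) (n : ℕ) :
    0 ≤ v n ∧ ∀ i, i ≤ P + 2 → t n * c i + c (i+1) < 0 → v n * s (i+1) ≤ s i := by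
  have hl := H.lam_gt
  have hl2 := H.l2
  induction n with
  | zero =>
    refine ⟨S.v0.ge, fun i hi _ => ?_⟩
    rw [S.v0, zero_mul]; exact H.snn i (by omega)
  | succ n ih =>
    obtain ⟨hv, hI⟩ := ih
    have hd : (1:ℝ) ≤ d n := by exact_mod_cast S.d1 n
    have hlo' : -(lam/2) ≤ t (n+1) := by have := S.lo (n+1); nlinarith
    rcases lt_or_gt_of_ne (S.ne n) with ht | ht
    · have hvl : v n ≤ lam / 2 := by
        have := hI (P+2) le_rfl (by rw [H.cP3]; have := H.cpos (P+2) le_rfl; nlinarith)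
        rw [H.sP3, H.sP2] at this; linarith
      have hD : 0 < d n * lam - v n := by nlinarith
      rw [S.vn n ht]
      refine ⟨by positivity, fun i hi hc => ?_⟩
      rw [div_mul_eq_mul_div, one_mul, div_le_iff₀ hD]
      rcases i with _ | i
      · rw [H.c0, H.c1] at hc; linarith
      · rw [H.srec i]
        have hsi := H.snn i (by omega)
        have hsi1 := H.spos (i+1) (by omega) (by omega)
        rcases (S.d1 n).eq_or_lt with h1 | h1
        · have h1' : (d n : ℝ) = 1 := by rw [← h1]; simp
          have hx0 := S.ne n
          have := hI i (by omega) (by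
            rw [H.crec i, S.tn n ht, h1'] at hc
            have e : (-1 / t n - 1 * lam) * c (i+1) + (lam * c (i+1) - c i)
                = -(t n * c i + c (i+1)) / t n := by field_simp; ring
            rw [e] at hc
            by_contra hcon
            push Not at hcon
            have : 0 ≤ -(t n * c i + c (i+1)) / t n :=
              div_nonneg_of_nonpos (by linarith) ht.le
            linarith)
          rw [h1']; nlinarith
        · have h2 : (2:ℝ) ≤ d n := by exact_mod_cast h1
          nlinarith [mul_nonneg (by linarith : (0:ℝ) ≤ d n - 2) (by linarith : 0 ≤ lam),
            mul_nonneg hsi1.le (by nlinarith : 0 ≤ d n * lam - v n - lam)]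
    · have hD : 0 < d n * lam + v n := by nlinarith
      rw [S.vp n ht]
      refine ⟨by positivity, fun i hi hc => ?_⟩
      rw [div_mul_eq_mul_div, one_mul, div_le_iff₀ hD]
      rcases i with _ | i
      · rw [H.c0, H.c1] at hc; linarith
      · rw [H.srec i]
        have hsi := H.snn i (by omega)
        have hsi1 := H.spos (i+1) (by omega) (by omega)
        nlinarith [mul_nonneg hsi1.le (by nlinarith : 0 ≤ d n * lam + v n - lam)]

lemma SysD.vnn (H : TrigD P lam s c) (S : SysD lam α t v d) (hα : 1/2 ≤ α) (n : ℕ) : 0 ≤ v n :=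
  (S.inv1 H hα n).1

lemma SysD.vle (H : TrigD P lam s c) (S : SysD lam α t v d) (hα : 1/2 ≤ α) (n : ℕ)
    (ht : t n < 0) : v n ≤ lam / 2 := by
  have := (S.inv1 H hα n).2 (P+2) le_rfl
    (by rw [H.cP3]; have := H.cpos (P+2) le_rfl; nlinarith)
  rw [H.sP3, H.sP2] at this; linarith

lemma SysD.tge (H : TrigD P lam s c) (S : SysD lam α t v d) (hα : 1/2 ≤ α) (n : ℕ) :
    -(lam/2) ≤ t n := by
  have := S.lo n; have := H.l0; nlinarith

lemma SysD.dpos (H : TrigD P lam s c) (S : SysD lam α t v d) (hα : 1/2 ≤ α) (n : ℕ) :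
    0 < 1 + t n * v n := by
  have hv := S.vnn H hα n
  have hl := H.l0
  have hl2 := H.l2
  rcases lt_or_gt_of_ne (S.ne n) with ht | ht
  · have := S.vle H hα n ht
    have := S.tge H hα n
    nlinarith [mul_nonneg hv (by linarith : 0 ≤ t n + lam/2)]
  · nlinarith [mul_nonneg ht.le hv]

/-- end of the periodic orbit of the comparison point -/
lemma TrigD.endX (H : TrigD P lam s c) {β x x' : ℝ} (hβ0 : lam / 2 < β) (hβ1 : β ≤ 1) (hx : x < 0)
    (hx' : x' = -1 / x - 2 * lam) (h : β * x' + β * lam - 1 ≤ 0) :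
    x * (β * s (P+2) - s (P+1)) + (β * s (P+3) - s (P+2)) ≤ 0 := by
  have hl := H.lam_gt
  have hl2 := H.l2
  rw [H.sP3, H.sP2, H.sP1]
  have h1 : β + x * (β * lam + 1) ≤ 0 := by
    have hx0 := hx.ne
    have e : β * x' + β * lam - 1 = (β + x * (β * lam + 1)) / (-x) := by
      rw [hx']; field_simp; ring
    rw [e] at h
    by_contra hc
    push Not at hc
    have : 0 < (β + x * (β * lam + 1)) / (-x) := div_pos hc (by linarith)
    linarith
  have hb : 0 < β * lam + 1 := by nlinarith
  have hX : 0 < β * (lam/2) - (lam^2/2-1) := by nlinarith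
  have key : (x * (β * (lam/2) - (lam^2/2-1)) + (β * 1 - lam/2)) * (β * lam + 1) ≤ 0 := by
    nlinarith [mul_nonneg hX.le (by linarith : 0 ≤ -(β + x * (β * lam + 1))), mul_nonneg (by linarith : 0 ≤ lam) (by nlinarith : 0 ≤ 1 - β^2)]
  by_contra hc
  push Not at hc
  nlinarith [mul_pos hc hb]

lemma SysD.inv2 (H : TrigD P lam s c) (S : SysD lam α t v d) (hα : 1/2 ≤ α) {β : ℝ}
    (hβ0 : lam / 2 < β) (hβ1 : β ≤ 1) (hαβ : α * lam ≤ β) (n : ℕ) :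
    ∀ j, j ≤ P + 1 → t n * (β * s (j+1) - s j) + (β * s (j+2) - s (j+1)) ≤ 0 →
      v n * (s (j+2) + s (j+1)) < s (j+1) + s j := by
  have hl := H.lam_gt
  have hl2 := H.l2
  induction n with
  | zero =>
    intro j hj _
    rw [S.v0, zero_mul]
    have := H.snn j (by omega)
    have := H.spos (j+1) (by omega) (by omega)
    linarith
  | succ n ih =>
    intro j hj hc
    have hd : (1:ℝ) ≤ d n := by exact_mod_cast S.d1 n
    have hv := S.vnn H hα n
    have hs1 := H.spos 1 le_rfl (by omega)
    rcases lt_or_gt_of_ne (S.ne n) with ht | ht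
    · have hvl := S.vle H hα n ht
      have hD : 0 < d n * lam - v n := by nlinarith
      rw [S.vn n ht, div_mul_eq_mul_div, one_mul, div_lt_iff₀ hD]
      rcases j with _ | j
      · simp only [zero_add, H.s0, H.s2] at hc ⊢
        have hc' : β * t (n+1) + β * lam - 1 ≤ 0 := by
          by_contra hcon; push Not at hcon
          nlinarith [mul_pos hs1 hcon]
        suffices lam + 1 < d n * lam - v n by nlinarith
        rcases (S.d1 n).eq_or_lt with h1 | h1
        · exfalso
          have hx0 := S.ne n
          have h1' : (d n : ℝ) = 1 := by rw [← h1]; simp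
          rw [S.tn n ht, h1'] at hc'
          have e : β * (-1 / t n - 1 * lam) + β * lam - 1 = (β + t n) / (- t n) := by
            field_simp; ring
          rw [e] at hc'
          have h3 := S.tge H hα n
          have : 0 < (β + t n) / (- t n) := div_pos (by linarith) (by linarith)
          linarith
        · rcases (show 2 ≤ d n by omega).eq_or_lt with h2 | h2
          · have h2' : (d n : ℝ) = 2 := by rw [← h2]; simp
            have := ih (P+1) le_rfl (H.endX hβ0 hβ1 ht (by rw [S.tn n ht, h2']) hc')
            rw [show P+1+2 = P+3 from rfl, show P+1+1=P+2 from rfl, H.sP3, H.sP2, H.sP1] at this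
            have hvv : v n < lam - 1 := by
              by_contra hcon; push Not at hcon
              nlinarith
            rw [h2']; linarith
          · have h3 : (3:ℝ) ≤ d n := by exact_mod_cast h2
            nlinarith
      · have hsj := H.snn j (by omega)
        have hsj1 := H.spos (j+1) (by omega) (by omega)
        have hsj2 := H.spos (j+2) (by omega) (by omega)
        have r1 := H.srec j
        have r2 := H.srec (j+1)
        rw [show j+1+2 = j+3 from rfl, show j+1+1 = j+2 from rfl] at *
        have hY : s (j+3) + s (j+2) = lam * (s (j+2) + s (j+1)) - (s (j+1) + s j) := by linarith
        rcases (S.d1 n).eq_or_lt with h1 | h1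
        · have h1' : (d n : ℝ) = 1 := by rw [← h1]; simp
          have hx0 := S.ne n
          have := ih j (by omega) (by
            rw [S.tn n ht, h1'] at hc
            have e : (-1 / t n - 1 * lam) * (β * s (j+2) - s (j+1)) + (β * s (j+3) - s (j+2))
                = -(t n * (β * s (j+1) - s j) + (β * s (j+2) - s (j+1))) / t n := by
              rw [r2, r1]; field_simp; ring
            rw [e] at hc
            by_contra hcon
            push Not at hcon
            have : 0 < -(t n * (β * s (j+1) - s j) + (β * s (j+2) - s (j+1))) / t n :=
              div_pos_of_neg_of_neg (by linarith) ht
            linarith)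
          rw [h1', hY]; linarith
        · have h2 : (2:ℝ) ≤ d n := by exact_mod_cast h1
          rw [hY]
          nlinarith [mul_nonneg (by linarith : (0:ℝ) ≤ d n - 2) (by linarith : 0 ≤ lam),
            mul_nonneg (by linarith : 0 ≤ s (j+2) + s (j+1)) (by nlinarith : 0 ≤ d n * lam - v n - lam)]
    · have hD : 0 < d n * lam + v n := by nlinarith
      rw [S.vp n ht, div_mul_eq_mul_div, one_mul, div_lt_iff₀ hD]
      rcases j with _ | j
      · simp only [zero_add, H.s0, H.s2] at hc ⊢
        have hc' : β * t (n+1) + β * lam - 1 ≤ 0 := by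
          by_contra hcon; push Not at hcon
          nlinarith [mul_pos hs1 hcon]
        suffices lam + 1 < d n * lam + v n by nlinarith
        rcases (S.d1 n).eq_or_lt with h1 | h1
        · exfalso
          have hx0 := S.ne n
          have h1' : (d n : ℝ) = 1 := by rw [← h1]; simp
          rw [S.tp n ht, h1'] at hc'
          have e : β * (1 / t n - 1 * lam) + β * lam - 1 = (β - t n) / (t n) := by
            field_simp; ring
          rw [e] at hc'
          have h3 := S.hi n
          have : 0 < (β - t n) / (t n) := div_pos (by linarith) (by linarith)
          linarith
        · have h2 : (2:ℝ) ≤ d n := by exact_mod_cast h1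
          nlinarith
      · have hsj := H.snn j (by omega)
        have hsj1 := H.spos (j+1) (by omega) (by omega)
        have hsj2 := H.spos (j+2) (by omega) (by omega)
        have r1 := H.srec j
        have r2 := H.srec (j+1)
        rw [show j+1+2 = j+3 from rfl, show j+1+1 = j+2 from rfl] at *
        have hY : s (j+3) + s (j+2) = lam * (s (j+2) + s (j+1)) - (s (j+1) + s j) := by linarith
        rw [hY]
        nlinarith [mul_nonneg (by linarith : 0 ≤ s (j+2) + s (j+1)) (by nlinarith : 0 ≤ d n * lam + v n - lam)]

/-- the large approximation coefficients condition at index `m` -/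
def GoodAt (t v : ℕ → ℝ) (d : ℕ → ℤ) (m : ℕ) : Prop :=
  t m < 0 ∧ (d m = 1 ∨ d m = 2) ∧ 1 < -t m * (2 + v m)

lemma SysD.negdig (S : SysD lam α t v d) {m : ℕ} (ht : t m < 0) :
    (d m - 1 + α) * lam * (-t m) ≤ 1 := by
  have h := S.lo (m+1)
  rw [S.tn m ht] at h
  have hx0 := S.ne m
  have e : -1 / t m * (-t m) = 1 := by field_simp
  nlinarith [mul_le_mul_of_nonneg_right h (by linarith : 0 ≤ -t m)]

lemma SysD.good (H : TrigD P lam s c) (S : SysD lam α t v d) (hα : 1/2 ≤ α) (hα1 : α * lam ≤ 1)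
    {m : ℕ} (h1 : 1/2 < v m / (1 + t m * v m)) (h2 : 1/2 < |t m| / (1 + t m * v m)) :
    GoodAt t v d m := by
  have hD := S.dpos H hα m
  have hv := S.vnn H hα m
  have hl := H.lam_gt
  have hl2 := H.l2
  rw [lt_div_iff₀ hD] at h1 h2
  rcases lt_or_gt_of_ne (S.ne m) with ht | ht
  · rw [abs_of_neg ht] at h2
    have hvl := S.vle H hα m ht
    have hg : 1 < -t m * (2 + v m) := by linarith
    refine ⟨ht, ?_, hg⟩
    by_contra hcon
    have hd : 3 ≤ d m := by have := S.d1 m; omega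
    have hd' : (3:ℝ) ≤ d m := by exact_mod_cast hd
    have h3 := S.negdig ht
    have h4 : 5/2 * lam * (-t m) ≤ 1 := by
      refine le_trans ?_ h3
      apply mul_le_mul_of_nonneg_right _ (by linarith)
      apply mul_le_mul_of_nonneg_right _ (by linarith)
      linarith
    nlinarith
  · exfalso
    rw [abs_of_pos ht] at h2
    have ht1 : t m < 1 := lt_of_lt_of_le (S.hi m) hα1
    have e1 : 1 < v m * (2 - t m) := by linarith
    have e2 : t m * v m < 2 * t m - 1 := by linarith
    nlinarith [sq_nonneg (t m - 1), mul_lt_mul_of_pos_left e1 ht, mul_lt_mul_of_pos_right e2 (by linarith : 0 < 2 - t m)]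

lemma SysD.ones (H : TrigD P lam s c) (S : SysD lam α t v d) (hα : 1/2 ≤ α) (n j : ℕ)
    (h : ∀ i < j, t (n+i) < 0 ∧ d (n+i) = 1) : 0 ≤ t (n+j) * c j + c (j+1) := by
  induction j with
  | zero => have := S.tge H hα n; simp [H.c0, H.c1]; linarith
  | succ j ih =>
    have ih := ih (fun i hi => h i (by omega))
    obtain ⟨ht, hd⟩ := h j (by omega)
    have hx0 := ht.ne
    rw [show n + (j+1) = n+j+1 from rfl, S.tn _ ht, hd, H.crec j]
    have e : (-1 / t (n+j) - ((1:ℤ):ℝ) * lam) * c (j+1) + (lam * c (j+1) - c j)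
        = (t (n+j) * c j + c (j+1)) / (- t (n+j)) := by push_cast; field_simp; ring
    rw [e]
    exact div_nonneg ih (by linarith)

lemma SysD.ones_end (H : TrigD P lam s c) (S : SysD lam α t v d) (hα : 1/2 ≤ α) (n : ℕ)
    (h : ∀ i < P + 2, t (n+i) < 0 ∧ d (n+i) = 1) : 0 ≤ t (n+(P+2)) := by
  have := S.ones H hα n (P+2) h
  rw [H.cP3, add_zero] at this
  have h2 := H.cpos (P+2) le_rfl
  by_contra hc; push Not at hc
  nlinarith

lemma SysD.gap (H : TrigD P lam s c) (S : SysD lam α t v d) (hα : 1/2 ≤ α) (r : ℕ)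
    (hr : t r < 0) (hd : d r = 2) (j : ℕ)
    (h : ∀ i < j, t (r+1+i) < 0 ∧ d (r+1+i) = 1) :
    v (r+1+j) * (2 * s (j+2) + lam * s (j+1)) ≤ 2 * s (j+1) + lam * s j := by
  have hl := H.lam_gt
  induction j with
  | zero =>
    have hs1 := H.spos 1 le_rfl (by omega)
    have hv := S.vle H hα r hr
    simp only [add_zero, zero_add, H.s0, H.s2]
    rw [S.vn r hr, hd, div_mul_eq_mul_div, div_le_iff₀ (by push_cast; linarith)]
    push_cast
    nlinarith
  | succ j ih =>
    have ih := ih (fun i hi => h i (by omega))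
    obtain ⟨ht, hd⟩ := h j (by omega)
    have hv := S.vle H hα _ ht
    rw [show r+1 + (j+1) = r+1+j+1 from rfl, S.vn _ ht, hd, div_mul_eq_mul_div,
      div_le_iff₀ (by push_cast; linarith)]
    have r1 := H.srec j
    have r2 := H.srec (j+1)
    rw [show j+1+2 = j+3 from rfl, show j+1+1 = j+2 from rfl] at *
    push_cast
    have e : 2 * s (j+3) + lam * s (j+2) = lam * (2 * s (j+2) + lam * s (j+1)) - (2 * s (j+1) + lam * s j) := by
      linear_combination 2 * r2 + lam * r1
    linarith

lemma TrigD.zbound (H : TrigD P lam s c) (i j : ℕ) (hij : i + j = P) :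
    2 * s (j+1) + lam * s j ≤ (3/2 * lam - 2) * (2 * s (j+2) + lam * s (j+1)) := by
  have hl := H.lam_gt
  have hl2 := H.l2
  induction i generalizing j with
  | zero =>
    obtain rfl : j = P := by omega
    rw [H.sP2, H.sP1, H.sP]
    have : 0 ≤ (2 - lam) * (2 + lam + lam^2 - lam^3/2) :=
      mul_nonneg (by linarith) (by nlinarith)
    nlinarith
  | succ i ih =>
    have ih := ih (j+1) (by omega)
    have r1 := H.srec j
    have r2 := H.srec (j+1)
    have p0 := H.snn j (by omega)
    have p1 := H.spos (j+1) (by omega) (by omega)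
    have p2 := H.spos (j+2) (by omega) (by omega)
    have p3 := H.spos (j+3) (by omega) (by omega)
    rw [show j+1+2 = j+3 from rfl, show j+1+1 = j+2 from rfl] at *
    set A := 2 * s (j+1) + lam * s j with hA
    set B := 2 * s (j+2) + lam * s (j+1) with hB
    set C := 2 * s (j+3) + lam * s (j+2) with hC
    have e : C = lam * B - A := by rw [hA, hB, hC]; linear_combination 2 * r2 + lam * r1
    have hApos : 0 < A := by rw [hA]; positivity
    have hBpos : 0 < B := by rw [hB]; positivity
    have hCpos : 0 < C := by rw [hC]; positivity
    have h1 : A * C ≤ B * B := by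
      rw [e]; nlinarith [sq_nonneg (A - B), mul_pos hApos hBpos]
    have h2 : A * C ≤ (3/2*lam-2) * B * C := by nlinarith
    exact le_of_mul_le_mul_right h2 hCpos

lemma SysD.nogap (H : TrigD P lam s c) (S : SysD lam α t v d) (hα : 1/2 ≤ α) (r : ℕ)
    (hr : t r < 0) (hd : d r = 2) (j : ℕ) (hj : j ≤ P)
    (h : ∀ i < j, t (r+1+i) < 0 ∧ d (r+1+i) = 1) (hg : GoodAt t v d (r+1+j)) :
    d (r+1+j) = 1 := by
  have hl := H.lam_gt
  have hl2 := H.l2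
  obtain ⟨ht, hdd, hgt⟩ := hg
  rcases hdd with hdd | hdd
  · exact hdd
  exfalso
  have g1 := S.gap H hα r hr hd j h
  have g2 := H.zbound (P - j) j (by omega)
  have hp : 0 < 2 * s (j+2) + lam * s (j+1) := by
    have p1 := H.spos (j+1) (by omega) (by omega)
    have p2 := H.spos (j+2) (by omega) (by omega)
    have := H.l0
    positivity
  have g3 : v (r+1+j) ≤ 3/2*lam - 2 := le_of_mul_le_mul_right (g1.trans g2) hp
  have g4 := S.negdig ht
  rw [hdd] at g4
  push_cast at g4
  have g5 : (3/2) * lam * (-t (r+1+j)) ≤ 1 := by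
    refine le_trans ?_ g4
    apply mul_le_mul_of_nonneg_right _ (by linarith)
    apply mul_le_mul_of_nonneg_right _ (by linarith)
    linarith
  nlinarith

lemma SysD.stepOnes (H : TrigD P lam s c) (S : SysD lam α t v d) (hα : 1/2 ≤ α) {r : ℕ}
    (hd : d r = 2) (hG : ∀ m, r ≤ m → m ≤ r + (P+3) → GoodAt t v d m) :
    (∀ i < P + 1, t (r+1+i) < 0 ∧ d (r+1+i) = 1) ∧ d (r+(P+2)) = 2 := by
  have hr := (hG r le_rfl (by omega)).1
  have h1 : ∀ i < P + 1, t (r+1+i) < 0 ∧ d (r+1+i) = 1 := by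
    intro i
    induction i using Nat.strong_induction_on with
    | _ i ih =>
      intro hi
      have hg := hG (r+1+i) (by omega) (by omega)
      exact ⟨hg.1, S.nogap H hα r hr hd i (by omega) (fun i' hi' => ih i' hi' (by omega)) hg⟩
  refine ⟨h1, ?_⟩
  have hg := hG (r+(P+2)) (by omega) (by omega)
  rcases hg.2.1 with h | h
  · exfalso
    have := S.ones_end H hα (r+1) (by
      intro i hi
      rcases Nat.lt_or_ge i (P+1) with h' | h'
      · exact h1 i h'
      · obtain rfl : i = P+1 := by omega
        rw [show r+1+(P+1) = r+(P+2) by omega]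
        exact ⟨hg.1, h⟩)
    rw [show r+1+(P+2) = r+(P+3) by omega] at this
    have := (hG (r+(P+3)) (by omega) (by omega)).1
    linarith
  · exact h

/-- linearising coordinates -/
noncomputable def aCo (lam x : ℝ) : ℝ := -(1 + (lam+1) * x) / (1 + (lam-1) * x)
noncomputable def bCo (lam y : ℝ) : ℝ := (y - lam + 1) / (lam + 1 - y)

lemma aCo_one {x : ℝ} (h : 1 + (lam-1) * x ≠ 0) :
    1 + aCo lam x = 2 * (-x) / (1 + (lam-1) * x) := by
  unfold aCo
  rw [eq_div_iff h, add_mul, div_mul_cancel₀ _ h]; ring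

lemma bCo_one {y : ℝ} (h : lam + 1 - y ≠ 0) : 1 + bCo lam y = 2 / (lam + 1 - y) := by
  unfold bCo
  rw [eq_div_iff h, add_mul, div_mul_cancel₀ _ h]; ring

lemma abCo_one {x y : ℝ} (h : 1 + (lam-1) * x ≠ 0) (h0 : lam + 1 - y ≠ 0) :
    1 - aCo lam x * bCo lam y
      = 2 * (1 + x * y) / ((1 + (lam-1) * x) * (lam + 1 - y)) := by
  unfold aCo bCo
  rw [div_mul_div_comm, eq_div_iff (mul_ne_zero h h0), sub_mul,
    div_mul_cancel₀ _ (mul_ne_zero h h0)]; ring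

lemma theta_co {x y : ℝ} (h : 1 + (lam-1) * x ≠ 0) (h0 : lam + 1 - y ≠ 0) (h1 : 1 + x * y ≠ 0) :
    -x / (1 + x * y) = (1 + aCo lam x) * (1 + bCo lam y) / (1 - aCo lam x * bCo lam y) / 2 := by
  rw [aCo_one h, bCo_one h0, abCo_one h h0]
  generalize 1 + (lam-1) * x = D1 at *
  generalize lam + 1 - y = D2 at *
  generalize 1 + x * y = E at *
  field_simp

lemma SysD.denA (H : TrigD P lam s c) (S : SysD lam α t v d) (hα : 1/2 ≤ α) (m : ℕ) :
    0 < 1 + (lam - 1) * t m := by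
  have hl := H.lam_gt
  have hl2 := H.l2
  have := S.tge H hα m
  nlinarith

lemma SysD.perT (H : TrigD P lam s c) (S : SysD lam α t v d) (r : ℕ)
    (hr : t r < 0) (hd : d r = 2) (j : ℕ)
    (h : ∀ i < j, t (r+1+i) < 0 ∧ d (r+1+i) = 1) :
    t (r+1+j) * (s (j+1) - (t (r+1) + lam) * s j) + (s (j+2) - (t (r+1) + lam) * s (j+1)) = 0 := by
  induction j with
  | zero => simp [H.s0, H.s2]; ring
  | succ j ih =>
    have ih := ih (fun i hi => h i (by omega))
    obtain ⟨ht, hd⟩ := h j (by omega)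
    have r1 := H.srec j
    have r2 := H.srec (j+1)
    rw [show r+1 + (j+1) = r+1+j+1 from rfl, S.tn _ ht, hd]
    rw [show j+1+2 = j+3 from rfl, show j+1+1 = j+2 from rfl] at *
    have hx0 := ht.ne
    push_cast
    have e : -1 / t (r+1+j) * t (r+1+j) = -1 := by field_simp
    apply mul_right_cancel₀ hx0
    rw [zero_mul]
    rw [r2]
    linear_combination (s (j+2) - (t (r+1) + lam) * s (j+1)) * e - ih - (t (r+1) + lam) * t (r+1+j) * r1

lemma SysD.perV (H : TrigD P lam s c) (S : SysD lam α t v d) (hα : 1/2 ≤ α) (r : ℕ)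
    (hr : t r < 0) (hd : d r = 2) (j : ℕ)
    (h : ∀ i < j, t (r+1+i) < 0 ∧ d (r+1+i) = 1) :
    v (r+1+j) * (s (j+2) + (lam - v r) * s (j+1)) = s (j+1) + (lam - v r) * s j := by
  have hl := H.lam_gt
  induction j with
  | zero =>
    have := S.vle H hα r hr
    simp only [add_zero, zero_add, H.s0, H.s2]
    have h0 : 2 * lam - v r ≠ 0 := by linarith
    rw [S.vn r hr, hd]; push_cast; field_simp; ring
  | succ j ih =>
    have ih := ih (fun i hi => h i (by omega))
    obtain ⟨ht, hd⟩ := h j (by omega)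
    have hv := S.vle H hα _ ht
    have r1 := H.srec j
    have r2 := H.srec (j+1)
    rw [show r+1 + (j+1) = r+1+j+1 from rfl, S.vn _ ht, hd]
    rw [show j+1+2 = j+3 from rfl, show j+1+1 = j+2 from rfl] at *
    push_cast
    have h0 : 1 * lam - v (r+1+j) ≠ 0 := by linarith
    rw [div_mul_eq_mul_div, div_eq_iff h0]
    rw [r2]
    linear_combination ih + (lam - v r) * r1

lemma SysD.perA (H : TrigD P lam s c) (S : SysD lam α t v d) (hα : 1/2 ≤ α) (r : ℕ)
    (hr : t r < 0) (hd : d r = 2)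
    (h : ∀ i < P + 1, t (r+1+i) < 0 ∧ d (r+1+i) = 1) :
    aCo lam (t r) = (2 - lam) / (2 + lam) * aCo lam (t (r+(P+2))) := by
  have e := S.perT H r hr hd (P+1) h
  rw [show r+1+(P+1) = r+(P+2) by omega, show P+1+2=P+3 from rfl, show P+1+1=P+2 from rfl,
    H.sP3, H.sP2, H.sP1, S.tn r hr, hd] at e
  push_cast at e
  have d1 := S.denA H hα r
  have d2 := S.denA H hα (r+(P+2))
  have hl := H.l0
  have hx0 := hr.ne
  unfold aCo
  have e' : t (r+(P+2)) * (lam/2 * t r + (1 + lam * t r) * (lam^2/2-1)) + (t r + (1 + lam * t r) * (lam/2)) = 0 := by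
    have e3 : -1 / t r * t r = -1 := by field_simp
    linear_combination t r * e + (t (r+(P+2)) * (lam^2/2-1) + lam/2) * e3
  have h2 : (2 + lam) ≠ 0 := by linarith
  have d1' := d1.ne'
  have d2' := d2.ne'
  rw [div_mul_div_comm, div_eq_div_iff d1' (mul_ne_zero h2 d2')]
  linear_combination (-4) * e'

lemma SysD.perB (H : TrigD P lam s c) (S : SysD lam α t v d) (hα : 1/2 ≤ α) (r : ℕ)
    (hr : t r < 0) (hd : d r = 2)
    (h : ∀ i < P + 1, t (r+1+i) < 0 ∧ d (r+1+i) = 1) (hr' : t (r+(P+2)) < 0) :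
    bCo lam (v (r+(P+2))) = (2 - lam) / (2 + lam) * bCo lam (v r) := by
  have e := S.perV H hα r hr hd (P+1) h
  rw [show r+1+(P+1) = r+(P+2) by omega, show P+1+2=P+3 from rfl, show P+1+1=P+2 from rfl,
    H.sP3, H.sP2, H.sP1] at e
  have hl := H.l0
  have v1 := S.vle H hα r hr
  have v2 := S.vle H hα _ hr'
  unfold bCo
  have h2 : (2 + lam) ≠ 0 := by linarith
  have d1' : lam + 1 - v r ≠ 0 := by linarith
  have d2' : lam + 1 - v (r+(P+2)) ≠ 0 := by linarith
  rw [div_mul_div_comm, div_eq_div_iff d2' (mul_ne_zero h2 d1')]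
  linear_combination 4 * e

lemma SysD.chain (H : TrigD P lam s c) (S : SysD lam α t v d) (hα : 1/2 ≤ α) (n k : ℕ)
    (hG : ∀ m, n ≤ m → m ≤ n + (k+1) * (P+2) → GoodAt t v d m) :
    ∃ r r', n ≤ r ∧ r ≤ r' ∧ r' ≤ n + (k+1) * (P+2) ∧ d r = 2 ∧ d r' = 2 ∧
      aCo lam (t r) = ((2 - lam) / (2 + lam)) ^ k * aCo lam (t r') ∧
      bCo lam (v r') = ((2 - lam) / (2 + lam)) ^ k * bCo lam (v r) := by
  have hk : (k+1) * (P+2) = k * (P+2) + (P+2) := by ring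
  have h0 : ∃ j, j ≤ P + 1 ∧ d (n+j) = 2 := by
    by_contra hcon
    push Not at hcon
    have := S.ones_end H hα n (by
      intro i hi
      have hg := hG (n+i) (by omega) (by nlinarith)
      refine ⟨hg.1, ?_⟩
      rcases hg.2.1 with h | h
      · exact h
      · exact absurd h (hcon i (by omega)))
    have := (hG (n+(P+2)) (by omega) (by nlinarith)).1
    linarith
  obtain ⟨j, hj, hdj⟩ := h0
  have key : ∀ i ≤ k, d (n+j+i*(P+2)) = 2 ∧
      aCo lam (t (n+j)) = ((2 - lam) / (2 + lam)) ^ i * aCo lam (t (n+j+i*(P+2))) ∧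
      bCo lam (v (n+j+i*(P+2))) = ((2 - lam) / (2 + lam)) ^ i * bCo lam (v (n+j)) := by
    intro i
    induction i with
    | zero => intro _; simp [hdj]
    | succ i ih =>
      intro hi
      obtain ⟨h1, h2, h3⟩ := ih (by omega)
      have hik : (i+1)*(P+2) ≤ k * (P+2) := Nat.mul_le_mul_right _ hi
      have hi1 : (i+1)*(P+2) = i * (P+2) + (P+2) := by ring
      have hG' : ∀ m, n+j+i*(P+2) ≤ m → m ≤ n+j+i*(P+2) + (P+3) → GoodAt t v d m := by
        intro m hm1 hm2
        exact hG m (by omega) (by omega)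
      obtain ⟨o, o2⟩ := S.stepOnes H hα h1 hG'
      have hn := (hG' _ le_rfl (by omega)).1
      have hn' := (hG' (n+j+i*(P+2)+(P+2)) (by omega) (by omega)).1
      rw [show n+j+(i+1)*(P+2) = n+j+i*(P+2)+(P+2) by omega]
      refine ⟨o2, ?_, ?_⟩
      · rw [h2, S.perA H hα _ hn h1 o]; ring
      · rw [S.perB H hα _ hn h1 o hn', h3]; ring
  obtain ⟨h1, h2, h3⟩ := key k le_rfl
  exact ⟨n+j, n+j+k*(P+2), by omega, by omega, by omega, hdj, h1, h2, h3⟩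

set_option maxHeartbeats 1000000 in
/-- the key estimate -/
lemma SysD.final (H : TrigD P lam s c) (S : SysD lam α t v d) (hα : 1/2 ≤ α) (hα1 : α * lam ≤ 1)
    {A : ℝ} (hA : (1 - α * lam) / (1 + α * lam) ≤ A) (n k : ℕ)
    (hK : (α * lam = 1 ∧ (2 - lam) / (2 + lam) ≤ A) ∨
      ((2 - lam) / (2 + lam)) ^ (2 * k + 1) ≤ (1 - (α * lam + 1) / 2) / (1 + (α * lam + 1) / 2))
    (hA0 : 0 ≤ A)
    (hG : ∀ m, n ≤ m → m ≤ n + (k+1) * (P+2) → GoodAt t v d m) :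
    ∃ m, n ≤ m ∧ m ≤ n + (k+1) * (P+2) ∧
      |t m| / (1 + t m * v m) < (1 + ((2 - lam) / (2 + lam)) ^ k * A) / 2 := by
  have hl := H.lam_gt
  have hl2 := H.l2
  obtain ⟨r, r', hnr, hrr, hrn, hd, hd', ha, hb⟩ := S.chain H hα n k hG
  have hr := (hG r hnr (by omega)).1
  have hr' := (hG r' (by omega) hrn).1
  set m := (2 - lam) / (2 + lam) with hm
  have hm0 : 0 < m := div_pos (by linarith) (by linarith)
  have hm1 : m < 1 := by rw [hm, div_lt_one (by linarith)]; linarith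
  set β := (α * lam + 1) / 2 with hβ
  have hal : lam / 2 ≤ α * lam := by nlinarith
  have hmk := pow_pos hm0 k
  by_cases hcase : t r * (β * s (P+2) - s (P+1)) + (β * s (P+3) - s (P+2)) ≤ 0
  · refine ⟨r, hnr, by omega, ?_⟩
    have hv := S.inv2 H hα (β := β) (by rw [hβ]; linarith) (by rw [hβ]; linarith)
      (by rw [hβ]; linarith) r (P+1) le_rfl hcase
    rw [show P+1+2 = P+3 from rfl, show P+1+1=P+2 from rfl, H.sP3, H.sP2, H.sP1] at hv
    have hvv : v r < lam - 1 := by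
      by_contra hcon; push Not at hcon
      nlinarith
    have hD := S.dpos H hα r
    have dA := S.denA H hα r
    have dA' := S.denA H hα r'
    have s1 : |t r| / (1 + t r * v r) < (1 + aCo lam (t r)) / 2 := by
      have e : (1 + aCo lam (t r)) / 2 = (-t r) / (1 + (lam - 1) * t r) := by
        rw [aCo_one dA.ne']; ring
      rw [e, abs_of_neg hr]
      apply div_lt_div_of_pos_left (by linarith) dA
      nlinarith
    have s2 : aCo lam (t r') ≤ A := by
      refine le_trans ?_ hA
      have h3 := S.negdig hr'
      rw [hd'] at h3; push_cast at h3
      unfold aCo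
      rw [div_le_div_iff₀ dA' (by linarith)]
      nlinarith
    rw [ha] at s1
    have := mul_le_mul_of_nonneg_left s2 hmk.le
    linarith
  · push Not at hcase
    refine ⟨r', by omega, hrn, ?_⟩
    have dA := S.denA H hα r
    have dA' := S.denA H hα r'
    have hβ1 : β ≤ 1 := by rw [hβ]; linarith
    have hβ0 : lam / 2 < β := by rw [hβ]; linarith
    have hx : 0 < β + t r * (β * lam + 1) := by
      by_contra hcon
      push Not at hcon
      have := H.endX (x := t r) hβ0 hβ1 hr rfl (by
        have hx0 := hr.ne
        have e : β * (-1 / t r - 2 * lam) + β * lam - 1 = (β + t r * (β * lam + 1)) / (-t r) := by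
          field_simp; ring
        rw [e]
        exact div_nonpos_of_nonpos_of_nonneg hcon (by linarith))
      linarith
    have ha0 : aCo lam (t r) < -((1 - β) / (1 + β)) := by
      unfold aCo
      rw [← neg_div, div_lt_div_iff₀ dA (by linarith)]
      nlinarith
    have hβ' : 0 ≤ (1 - β) / (1 + β) := div_nonneg (by linarith) (by linarith)
    set a := aCo lam (t r') with hadef
    set b := bCo lam (v r') with hbdef
    have hvr := S.vle H hα r hr
    have hvr' := S.vle H hα r' hr'
    have hv0 := S.vnn H hα r'
    have hb0 : bCo lam (v r) ≤ m := by
      unfold bCo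
      rw [hm, div_le_div_iff₀ (by linarith) (by linarith)]
      nlinarith
    have hbm : b ≤ m ^ k * m := by rw [hb]; exact mul_le_mul_of_nonneg_left hb0 hmk.le
    have haneg : a < 0 := by
      by_contra hcon; push Not at hcon
      have := mul_nonneg hmk.le hcon
      linarith
    have ha1 : 0 < 1 + a := by
      have e : 1 + a = 2 * (-t r') / (1 + (lam - 1) * t r') := aCo_one dA'.ne'
      rw [e]; exact div_pos (by linarith) dA'
    have hb1 : 0 < 1 + b := by
      have h0 : lam + 1 - v r' ≠ 0 := by linarith
      have e : 1 + b = 2 / (lam + 1 - v r') := bCo_one h0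
      rw [e]; exact div_pos (by linarith) (by linarith)
    have hbm1 : b < 1 := by
      have : m ^ k ≤ 1 := pow_le_one₀ hm0.le hm1.le
      nlinarith
    have hab : 0 < 1 - a * b := by nlinarith
    have hD := S.dpos H hα r'
    have hTh : |t r'| / (1 + t r' * v r') = (1 + a) * (1 + b) / (1 - a * b) / 2 := by
      rw [abs_of_neg hr']
      exact theta_co dA'.ne' (by linarith) hD.ne'
    rw [hTh]
    have hfin : (1 + a) * (1 + b) / (1 - a * b) < 1 + m ^ k * A := by
      rw [div_lt_iff₀ hab]
      rcases hK with ⟨h1, h2⟩ | h3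
      · have hle : b ≤ m ^ k * A := hbm.trans (mul_le_mul_of_nonneg_left h2 hmk.le)
        have : (1 + b) * (1 - a * b) ≤ (1 + m ^ k * A) * (1 - a * b) :=
          mul_le_mul_of_nonneg_right (by linarith) hab.le
        have h5 := mul_pos (mul_pos hb1 hb1) (neg_pos.mpr haneg)
        have h6 : (1 + b) * (1 - a * b) - (1 + a) * (1 + b) = (1 + b) * (1 + b) * (-a) := by ring
        linarith
      · have hAk : 0 ≤ m ^ k * A := mul_nonneg hmk.le hA0
        have : 1 * (1 - a * b) ≤ (1 + m ^ k * A) * (1 - a * b) :=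
          mul_le_mul_of_nonneg_right (by linarith) hab.le
        suffices a + b + 2 * a * b < 0 by
          have h6 : (1 + a) * (1 + b) - 1 * (1 - a * b) = a + b + 2 * a * b := by ring
          linarith
        rcases le_or_gt b 0 with hb' | hb'
        · nlinarith [mul_pos (neg_pos.mpr haneg) hb1]
        · have hs : a + b < 0 := by
            have : m ^ k * a + m ^ k * b < 0 := by
              have e1 : m ^ k * b ≤ m ^ (2*k+1) := by
                calc m ^ k * b ≤ m ^ k * (m ^ k * m) := mul_le_mul_of_nonneg_left hbm hmk.le
                  _ = m ^ (2*k+1) := by ring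
              linarith
            by_contra hcon; push Not at hcon
            have := mul_nonneg hmk.le hcon
            linarith
          nlinarith [mul_pos (neg_pos.mpr haneg) hb']
    linarith
end core

lemma tau_closed {lam m A : ℝ} {τ : ℕ → ℝ} (hl : 17 / 10 < lam) (hl2 : lam < 2)
    (hm : m = (2 - lam) / (2 + lam))
    (hτ : ∀ k : ℕ,
      τ (k + 1) = ((lam ^ 2 - 2) * τ k + lam) / ((lam - lam ^ 3) * τ k - lam ^ 2 - 2))
    (hA0 : 0 < A) (hτA : τ 0 = -((1 + A) / 2) / (1 + (lam - 1) * ((1 + A) / 2))) (k : ℕ) :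
    τ k = -((1 + m ^ k * A) / 2) / (1 + (lam - 1) * ((1 + m ^ k * A) / 2)) := by
  have hm0 : 0 < m := by rw [hm]; exact div_pos (by linarith) (by linarith)
  induction k with
  | zero => simpa using hτA
  | succ k ih =>
    have hC' : (1 + m ^ (k+1) * A) / 2
        = (lam + (2 - lam) * ((1 + m ^ k * A) / 2)) / (2 + lam) := by
      have h2 : 2 + lam ≠ 0 := by linarith
      rw [eq_div_iff h2, pow_succ]
      have : m * (2 + lam) = 2 - lam := by rw [hm]; field_simp
      linear_combination (m ^ k * A / 2) * this
    rw [hτ, ih, hC']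
    have hC : 0 < (1 + m ^ k * A) / 2 := by positivity
    generalize (1 + m ^ k * A) / 2 = C at hC
    have hD : 0 < 1 + (lam - 1) * C := by nlinarith
    have hE : 0 < lam ^ 2 + 2 + (lam - 1) * (2 - lam) * C := by
      have : 0 < (lam - 1) * (2 - lam) * C := by
        apply mul_pos (mul_pos _ _) hC <;> linarith
      positivity
    have h2 : 2 + lam ≠ 0 := by linarith
    have e1 : (lam ^ 2 - 2) * (-C / (1 + (lam - 1) * C)) + lam
        = (lam + (2 - lam) * C) / (1 + (lam - 1) * C) := by
      rw [eq_div_iff hD.ne', add_mul, mul_assoc, div_mul_cancel₀ _ hD.ne']; ring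
    have e2 : (lam - lam ^ 3) * (-C / (1 + (lam - 1) * C)) - lam ^ 2 - 2
        = -(lam ^ 2 + 2 + (lam - 1) * (2 - lam) * C) / (1 + (lam - 1) * C) := by
      rw [eq_div_iff hD.ne', sub_mul, sub_mul, mul_assoc, div_mul_cancel₀ _ hD.ne']; ring
    have e3 : 1 + (lam - 1) * ((lam + (2 - lam) * C) / (2 + lam))
        = (lam ^ 2 + 2 + (lam - 1) * (2 - lam) * C) / (2 + lam) := by
      rw [eq_div_iff h2, add_mul, mul_assoc, div_mul_cancel₀ _ h2]; ring
    rw [e1, e2, e3, div_div_div_cancel_right₀ hD.ne', neg_div', div_div_div_cancel_right₀ h2, neg_div, div_neg]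

/-- the past coordinate -/
noncomputable def vSeq (lam : ℝ) (t : ℕ → ℝ) (d : ℕ → ℤ) : ℕ → ℝ
  | 0 => 0
  | n + 1 => 1 / (d n * lam + Real.sign (t n) * vSeq lam t d n)

noncomputable abbrev tS (lam α x : ℝ) (n : ℕ) : ℝ := (rosenT lam α)^[n] x
noncomputable abbrev dS (lam α x : ℝ) (n : ℕ) : ℤ := rosenD lam α (tS lam α x n)

lemma rosenT_eq {lam α x : ℝ} (hx : x ≠ 0) :
    rosenT lam α x = Real.sign x / x - rosenD lam α x * lam := by
  rw [rosenT, if_neg hx, mul_comm]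

lemma rosenT_mem_s2 {lam α x : ℝ} (hl : 0 < lam) (hx : x ≠ 0) :
    rosenT lam α x ∈ Set.Ico ((α - 1) * lam) (α * lam) := by
  have e : Real.sign x / x = |1 / (lam * x)| * lam := by
    rcases lt_or_gt_of_ne hx with h | h
    · rw [Real.sign_of_neg h, abs_of_neg (div_neg_of_pos_of_neg one_pos (mul_neg_of_pos_of_neg hl h))]
      field_simp
    · rw [Real.sign_of_pos h, abs_of_pos (by positivity)]
      field_simp
  rw [rosenT_eq hx, e, rosenD]
  set y := |1 / (lam * x)|
  have h1 := Int.floor_le (y + 1 - α)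
  have h2 := Int.lt_floor_add_one (y + 1 - α)
  constructor
  · nlinarith
  · nlinarith

lemma sysD_mk {lam α x : ℝ} (hl : 0 < lam) (hl2 : lam < 2) (hα0 : 1 / 2 ≤ α)
    (hα1 : α * lam ≤ 1) (hx : x ∈ Set.Ico ((α - 1) * lam) (α * lam))
    (hirr : GIrrational lam α x) :
    SysD lam α (tS lam α x) (vSeq lam (tS lam α x) (dS lam α x)) (dS lam α x) := by
  have hmem : ∀ n, tS lam α x n ∈ Set.Ico ((α - 1) * lam) (α * lam) := by
    intro n
    rcases n with _ | n
    · exact hx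
    · simp only [tS]; rw [Function.iterate_succ_apply']
      exact rosenT_mem_s2 hl (hirr n)
  have hT : ∀ n, tS lam α x (n+1) = Real.sign (tS lam α x n) / tS lam α x n
      - dS lam α x n * lam := by
    intro n
    simp only [tS, dS]; rw [Function.iterate_succ_apply']
    exact rosenT_eq (hirr n)
  refine ⟨fun n => (hmem n).1, fun n => (hmem n).2, hirr, ?_, rfl, ?_, ?_, ?_, ?_⟩
  · intro n
    have h := hmem n
    have h0 : tS lam α x n ≠ 0 := hirr n
    simp only [dS, rosenD]
    rw [Int.le_floor]
    generalize tS lam α x n = y at h h0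
    have hy : |y| ≤ α * lam := by
      rw [abs_le]; constructor
      · have := h.1; nlinarith
      · exact h.2.le
    have hy0 := abs_pos.mpr h0
    have : α ≤ |1 / (lam * y)| := by
      rw [abs_div, abs_one, abs_mul, abs_of_pos hl, le_div_iff₀ (by positivity)]
      nlinarith
    push_cast
    linarith
  · intro n h; rw [hT, Real.sign_of_pos h]
  · intro n h; rw [vSeq, Real.sign_of_pos h, one_mul]
  · intro n h; rw [hT, Real.sign_of_neg h]
  · intro n h; rw [vSeq, Real.sign_of_neg h]; ring_nf

lemma SysD.prev {P : ℕ} {lam α : ℝ} {s c t v : ℕ → ℝ} {d : ℕ → ℤ} (H : TrigD P lam s c)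
    (S : SysD lam α t v d) (hα : 1/2 ≤ α) (i : ℕ) :
    v (i+1) / (1 + t (i+1) * v (i+1)) = |t i| / (1 + t i * v i) := by
  have hD := (S.dpos H hα i).ne'
  have hD' := (S.dpos H hα (i+1)).ne'
  have hl := H.lam_gt
  have hd : (1:ℝ) ≤ d i := by exact_mod_cast S.d1 i
  have hx0 := S.ne i
  rw [div_eq_div_iff hD' hD]
  rcases lt_or_gt_of_ne hx0 with h | h
  · have hv := S.vle H hα i h
    have hE : d i * lam - v i ≠ 0 := by nlinarith
    rw [S.tn i h, S.vn i h, abs_of_neg h]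
    field_simp; ring
  · have hv := S.vnn H hα i
    have hE : d i * lam + v i ≠ 0 := by nlinarith
    rw [S.tp i h, S.vp i h, abs_of_pos h]
    field_simp; ring

lemma theta_formula {P : ℕ} {lam α x : ℝ} {s c v : ℕ → ℝ} (H : TrigD P lam s c)
    (S : SysD lam α (tS lam α x) v (dS lam α x)) (hα : 1/2 ≤ α)
    (hirr : GIrrational lam α x) (n : ℕ) :
    rosenTheta lam α x n = |tS lam α x n| / (1 + tS lam α x n * v n) := by
  have hl := H.lam_gt
  set q := rosenPQ lam α x 0 1 with hq
  set p := rosenPQ lam α x 1 0 with hp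
  set t := tS lam α x with ht
  set d := dS lam α x with hd
  have qrec : ∀ n, q (n+2) = d n * lam * q (n+1) + Real.sign (t n) * q n := fun n => by
    rw [hq, rosenPQ]
  have prec : ∀ n, p (n+2) = d n * lam * p (n+1) + Real.sign (t n) * p n := fun n => by
    rw [hp, rosenPQ]
  have hQ : ∀ n, 0 < q (n+1) ∧ q n = v n * q (n+1) := by
    intro n
    induction n with
    | zero => simp [hq, rosenPQ, S.v0]
    | succ n ih =>
      obtain ⟨h1, h2⟩ := ih
      have hd1 : (1:ℝ) ≤ d n := by exact_mod_cast S.d1 n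
      rw [show n+1+1 = n+2 from rfl, qrec n]
      rcases lt_or_gt_of_ne (S.ne n) with h | h
      · have hv := S.vle H hα n h
        have hE : 0 < d n * lam - v n := by nlinarith
        have hE' := hE.ne'
        have e : d n * lam * q (n+1) + Real.sign (t n) * q n = (d n * lam - v n) * q (n+1) := by
          rw [Real.sign_of_neg h, h2]; ring
        rw [e, S.vn n h]
        refine ⟨by positivity, ?_⟩
        field_simp
      · have hv := S.vnn H hα n
        have hE : 0 < d n * lam + v n := by nlinarith
        have hE' := hE.ne'
        have e : d n * lam * q (n+1) + Real.sign (t n) * q n = (d n * lam + v n) * q (n+1) := by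
          rw [Real.sign_of_pos h, h2]; ring
        rw [e, S.vp n h]
        refine ⟨by positivity, ?_⟩
        field_simp
  have hδ : ∀ n, x * q (n+1) - p (n+1) = -t n * (x * q n - p n) ∧
      |x * q n - p n| * (q (n+1) + q n * t n) = 1 := by
    intro n
    induction n with
    | zero => simp [hq, hp, rosenPQ, ht, tS]
    | succ n ih =>
      obtain ⟨h1, h2⟩ := ih
      have hx0 := S.ne n
      rw [show n+1+1 = n+2 from rfl, qrec n, prec n]
      rcases lt_or_gt_of_ne hx0 with h | h
      · have e : -1 / t n * t n = -1 := by field_simp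
        rw [S.tn n h, Real.sign_of_neg h]
        constructor
        · linear_combination (-1 / t n) * h1 - (x * q n - p n) * e
        · rw [h1, abs_mul, abs_neg, abs_of_neg h]
          linear_combination h2 - |x * q n - p n| * q (n+1) * e
      · have e : 1 / t n * t n = 1 := by field_simp
        rw [S.tp n h, Real.sign_of_pos h]
        constructor
        · linear_combination (1 / t n) * h1 - (x * q n - p n) * e
        · rw [h1, abs_mul, abs_neg, abs_of_pos h]
          linear_combination h2 + |x * q n - p n| * q (n+1) * e
  obtain ⟨h1, h2⟩ := hδ n
  obtain ⟨h3, h4⟩ := hQ n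
  have hD := S.dpos H hα n
  rw [eq_div_iff hD.ne']
  have e1 : x - p (n+1) / q (n+1) = (x * q (n+1) - p (n+1)) / q (n+1) := by
    field_simp
  rw [rosenTheta, ← hq, ← hp, e1, abs_div, abs_of_pos h3, h1, abs_mul, abs_neg]
  have e2 : q (n+1) ^ 2 * (|t n| * |x * q n - p n| / q (n+1))
      = |t n| * (|x * q n - p n| * q (n+1)) := by field_simp
  rw [e2]
  rw [h4] at h2 ⊢
  linear_combination |t n| * h2
/-- **Tong's spectrum for even α-Rosen fractions** (Theorem 3.2).
Fix even `q = 2p`, `p ≥ 3`, `λ = 2cos(π/q)`, `α ∈ [1/2, 1/λ]`.  With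
`N(z) = ((λ²-2)z + λ)/((λ-λ³)z - λ² - 2)`, `τ_0 = -1/((α+1)λ)` (or `-2/(3λ)` when
`α = 1/λ`), `τ_k = N(τ_{k-1})` and `c_k = -τ_{k-1}/(1 + (λ-1)τ_{k-1})`, there is a
positive integer `K` such that for every `G_q`-irrational `x`, all `n ≥ 1` and
`k > K`, `min{Θ_{n-1}, …, Θ_{n+k(p-1)}} < c_k`; moreover `c_{k+1} < c_k` and
`c_k → 1/2`. -/
theorem tong_even_alpha_rosen (p q : ℕ) (hp : 3 ≤ p) (hq : q = 2 * p)
    (lam : ℝ) (hlam : lam = 2 * Real.cos (Real.pi / (q : ℝ)))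
    (α : ℝ) (hα : α ∈ Set.Icc (1 / 2 : ℝ) (1 / lam))
    (τ : ℕ → ℝ)
    (hτ0 : τ 0 = if α = 1 / lam then -2 / (3 * lam) else -1 / ((α + 1) * lam))
    (hτ : ∀ k : ℕ,
      τ (k + 1) = ((lam ^ 2 - 2) * τ k + lam) / ((lam - lam ^ 3) * τ k - lam ^ 2 - 2))
    (c : ℕ → ℝ)
    (hc : ∀ k : ℕ, 1 ≤ k → c k = -τ (k - 1) / (1 + (lam - 1) * τ (k - 1))) :
    (∃ K : ℕ, 0 < K ∧
      ∀ x ∈ Set.Ico ((α - 1) * lam) (α * lam), GIrrational lam α x →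
        ∀ n k : ℕ, 1 ≤ n → K < k →
          ∃ m : ℕ, n - 1 ≤ m ∧ m ≤ n + k * (p - 1) ∧ rosenTheta lam α x m < c k) ∧
    (∀ k : ℕ, 1 ≤ k → c (k + 1) < c k) ∧
    Filter.Tendsto c Filter.atTop (nhds (1 / 2)) := by
  obtain ⟨P, rfl⟩ : ∃ P, p = P + 3 := ⟨p - 3, by omega⟩
  subst hq
  have H := trigD_mk P lam hlam
  have hl := H.lam_gt
  have hl2 := H.l2
  have hα1 : α * lam ≤ 1 := by
    have := hα.2
    rwa [le_div_iff₀ (by linarith)] at this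
  have hα0 : 1 / 2 ≤ α := hα.1
  have hal : 0 < α * lam := by nlinarith
  set m := (2 - lam) / (2 + lam) with hm
  have hm0 : 0 < m := div_pos (by linarith) (by linarith)
  have hm1 : m < 1 := by rw [hm, div_lt_one (by linarith)]; linarith
  have hmeq : m * (2 + lam) = 2 - lam := by rw [hm]; field_simp
  obtain ⟨A, hA0, hA, hτA, hAm⟩ : ∃ A : ℝ, 0 < A ∧ (1 - α * lam) / (1 + α * lam) ≤ A ∧
      τ 0 = -((1 + A) / 2) / (1 + (lam - 1) * ((1 + A) / 2)) ∧
      ((α * lam = 1 ∧ m ≤ A) ∨ α * lam < 1) := by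
    by_cases h : α = 1 / lam
    · have h1 : α * lam = 1 := by rw [h]; field_simp
      refine ⟨m, hm0, ?_, ?_, Or.inl ⟨h1, le_rfl⟩⟩
      · rw [h1]; simpa using hm0.le
      · rw [hτ0, if_pos h, div_eq_div_iff (by linarith) (by nlinarith)]
        have : m * lam = 2 - lam - 2 * m := by linarith
        nlinarith
    · have h1 : α * lam < 1 := by
        refine lt_of_le_of_ne hα1 fun h2 => h ?_
        rw [eq_div_iff (by linarith)]; exact h2
      refine ⟨(1 - α * lam) / (1 + α * lam), div_pos (by linarith) (by linarith), le_rfl, ?_,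
        Or.inr h1⟩
      have h2 : (1 + (1 - α * lam) / (1 + α * lam)) / 2 = 1 / (1 + α * lam) := by
        field_simp; ring
      have h3 : 1 + (lam - 1) * (1 / (1 + α * lam)) = (α + 1) * lam / (1 + α * lam) := by
        field_simp; ring
      rw [hτ0, if_neg h, h2, h3]
      have : α + 1 ≠ 0 := by linarith
      field_simp
  have hτk := tau_closed hl hl2 hm hτ hA0 hτA
  have hck : ∀ k, c (k+1) = (1 + m ^ k * A) / 2 := by
    intro k
    have hmk := pow_pos hm0 k
    rw [hc (k+1) (by omega), Nat.add_sub_cancel, hτk k]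
    have hC : 0 < (1 + m ^ k * A) / 2 := by positivity
    generalize (1 + m ^ k * A) / 2 = C at hC
    have h1 : 0 < 1 + (lam - 1) * C := by nlinarith
    have h1' := h1.ne'
    have h2 : 1 + (lam - 1) * (-C / (1 + (lam - 1) * C)) = 1 / (1 + (lam - 1) * C) := by
      rw [eq_div_iff h1', add_mul, mul_assoc, div_mul_cancel₀ _ h1']; ring
    rw [h2]
    generalize 1 + (lam - 1) * C = E at *
    field_simp
  refine ⟨?_, ?_, ?_⟩
  · obtain ⟨K, hK0, hK⟩ : ∃ K : ℕ, 0 < K ∧ ∀ k, K ≤ k → ((α * lam = 1 ∧ m ≤ A) ∨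
        m ^ (2 * k + 1) ≤ (1 - (α * lam + 1) / 2) / (1 + (α * lam + 1) / 2)) := by
      rcases hAm with h | h
      · exact ⟨1, one_pos, fun _ _ => Or.inl h⟩
      · have hpos : 0 < (1 - (α * lam + 1) / 2) / (1 + (α * lam + 1) / 2) :=
          div_pos (by linarith) (by linarith)
        obtain ⟨K, hK⟩ := exists_pow_lt_of_lt_one hpos hm1
        refine ⟨K + 1, by omega, fun k hk => Or.inr ?_⟩
        exact (pow_le_pow_of_le_one hm0.le hm1.le (by omega)).trans hK.le
    refine ⟨K, hK0, fun x hx hirr n k hn hk => ?_⟩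
    obtain ⟨k, rfl⟩ : ∃ k', k = k' + 1 := ⟨k - 1, by omega⟩
    rw [hck k, show P + 3 - 1 = P + 2 from rfl]
    have S := sysD_mk (by linarith : 0 < lam) hl2 hα0 hα1 hx hirr
    have hth := theta_formula H S hα0 hirr
    by_contra hcon
    push Not at hcon
    have hmk := pow_pos hm0 k
    have hhalf : 1 / 2 < (1 + m ^ k * A) / 2 := by
      have := mul_pos hmk hA0
      linarith
    obtain ⟨j, h1, h2, h3⟩ := S.final H hα0 hα1 hA n k (hK k (by omega)) hA0.le (by
      intro j h1 h2
      obtain ⟨i, rfl⟩ : ∃ i, j = i + 1 := ⟨j - 1, by omega⟩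
      apply S.good H hα0 hα1
      · rw [S.prev H hα0 i, ← hth]
        exact lt_of_lt_of_le hhalf (hcon i (by omega) (by omega))
      · rw [← hth]
        exact lt_of_lt_of_le hhalf (hcon (i+1) (by omega) (by omega)))
    have := hcon j (by omega) h2
    rw [hth] at this
    linarith
  · intro k hk
    obtain ⟨k, rfl⟩ : ∃ k', k = k' + 1 := ⟨k - 1, by omega⟩
    rw [hck, hck, pow_succ]
    have := mul_pos (mul_pos (pow_pos hm0 k) hA0) (by linarith : 0 < 1 - m)
    nlinarith
  · rw [← Filter.tendsto_add_atTop_iff_nat 1]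
    have h1 := tendsto_pow_atTop_nhds_zero_of_lt_one hm0.le hm1
    have h2 : Filter.Tendsto (fun k : ℕ => (1 + m ^ k * A) / 2) Filter.atTop
        (nhds ((1 + 0 * A) / 2)) := ((h1.mul_const A).const_add 1).div_const 2
    simp only [zero_mul, add_zero] at h2
    exact h2.congr fun k => (hck k).symm
end
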